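/- arXiv:1703.00438 — 4 statements merged into one kernel-verified Lean document; each statement's English description precedes it below -/
import Mathlib

section
/- Let I = (g_1,…,g_n) ⊆ S be a balanced complete intersection ideal of type (d)^n with d ≥ 2, and assume I is indecomposable. Then for every k-algebra automorphism φ of S induced by an invertible k-linear change of the variables x_1,…,x_n and for every tuple of integers (w_1,…,w_n), not all zero, with w_1 + … + w_n = 0, there exists a monomial x_1^{c_1}⋯x_n^{c_n} of total degree n(d−1) such that x_1^{c_1}⋯x_n^{c_n} ∉ φ(I) and w_1c_1 + … + w_nc_n > 0. (This is the Hilbert–Mumford statement that for every nontrivial one-parameter subgroup ρ of SL(n) defined over k, the limit as t→0 of ρ(t) applied to the associated form of I does not exist; consequently the associated form is polystable.) -/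
open MvPolynomial

/-- The `k`-algebra endomorphism of `k[x_1,…,x_n]` induced by the linear change of
variables `x_i ↦ ∑ j A i j • x_j`. -/
noncomputable def changeVars {k : Type*} [CommSemiring k] {n : ℕ}
    (A : Matrix (Fin n) (Fin n) k) :
    MvPolynomial (Fin n) k →ₐ[k] MvPolynomial (Fin n) k :=
  aeval fun i => ∑ j, A i j • X j

/-- A family `g : Fin n → k[x_1,…,x_n]` (spanning `U = ⟨g_1,…,g_n⟩`) is decomposable if
there exist a basis `y_1,…,y_n` of the linear forms, an integer `1 ≤ a ≤ n-1`, and a basis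
`h_1,…,h_n` of `U` such that `h_{a+1},…,h_n ∈ k[y_{a+1},…,y_n]`. -/
def Decomposable {k : Type*} [Field k] {n : ℕ}
    (g : Fin n → MvPolynomial (Fin n) k) : Prop :=
  ∃ (y : Fin n → MvPolynomial (Fin n) k) (a : ℕ) (h : Fin n → MvPolynomial (Fin n) k),
    LinearIndependent k y ∧ (∀ i, (y i).IsHomogeneous 1) ∧
    1 ≤ a ∧ a ≤ n - 1 ∧
    LinearIndependent k h ∧
    Submodule.span k (Set.range h) = Submodule.span k (Set.range g) ∧
    ∀ i : Fin n, a ≤ (i : ℕ) →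
      h i ∈ Algebra.adjoin k {p | ∃ j : Fin n, a ≤ (j : ℕ) ∧ p = y j}

theorem supportDim_quotient_add_length_le_of_isRegular {R : Type*} [CommRing R] [IsNoetherianRing R]
    (rs : List R) {M : Type*} [AddCommGroup M] [Module R M] [Module.Finite R M]
    (reg : RingTheory.Sequence.IsRegular M rs) :
    Module.supportDim R (M ⧸ Ideal.ofList rs • (⊤ : Submodule R M)) + rs.length ≤
      Module.supportDim R M := by
  induction rs generalizing M with
  | nil =>
    rw [Ideal.ofList_nil, Submodule.bot_smul]
    simpa using (Module.supportDim_eq_of_equiv (Submodule.quotEquivOfEqBot ⊥ rfl)).le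
  | cons x rs' ih =>
    have h := (RingTheory.Sequence.isRegular_cons_iff M _ _).mp reg
    have h2 := ih h.2
    have h3 := Module.supportDim_quotSMulTop_succ_le_of_notMem_minimalPrimes
      (M := M) (fun p hp => h.1.notMem_of_mem_minimalPrimes hp)
    rw [Module.supportDim_eq_of_equiv
      (Submodule.quotOfListConsSMulTopEquivQuotSMulTopInner M x _)]
    simp only [List.length_cons, Nat.cast_add, Nat.cast_one, ← add_assoc]
    exact (add_le_add_left h2 1).trans h3

theorem finite_quotient_span_of_isRegular {k : Type*} [Field k] {n : ℕ}
    (g : Fin n → MvPolynomial (Fin n) k)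
    (hreg : RingTheory.Sequence.IsRegular (MvPolynomial (Fin n) k) (List.ofFn g)) :
    Module.Finite k (MvPolynomial (Fin n) k ⧸ Ideal.span (Set.range g)) := by
  have h := supportDim_quotient_add_length_le_of_isRegular _ hreg
  have e : Ideal.ofList (List.ofFn g) • (⊤ : Ideal (MvPolynomial (Fin n) k)) =
      Ideal.span (Set.range g) := by
    simp [Ideal.ofList, Set.range, List.mem_ofFn]
  rw [Module.supportDim_self_eq_ringKrullDim, MvPolynomial.ringKrullDim_of_isNoetherianRing,
    ringKrullDim_eq_zero_of_field, e, Module.supportDim_quotient_eq_ringKrullDim] at h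
  rw [Module.finite_iff_krullDimLE_zero, Ring.krullDimLE_iff]
  simp only [List.length_ofFn, zero_add, Nat.card_eq_fintype_card, Fintype.card_fin] at h
  generalize ringKrullDim (MvPolynomial (Fin n) k ⧸ Ideal.span (Set.range g)) = D at h ⊢
  induction D with
  | bot => simp
  | coe D =>
    induction D with
    | top =>
      exfalso
      have : ((⊤ : ℕ∞) : WithBot ℕ∞) + n = ⊤ := by rfl
      rw [this] at h
      exact absurd (top_le_iff.mp h) fun h' => ENat.natCast_ne_top n (WithBot.coe_injective h')
    | coe D =>
      norm_cast at h ⊢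
      have : D + n ≤ n := by exact_mod_cast h
      omega

section Graded

variable {σ k : Type*} [Field k]

attribute [local instance] MvPolynomial.gradedAlgebra in
theorem coe_decompose_eq_homogeneousComponent (f : MvPolynomial σ k) (i : ℕ) :
    (DirectSum.decompose (homogeneousSubmodule σ k) f i : MvPolynomial σ k) =
      homogeneousComponent i f :=
  decomposition.decompose'_apply f i

attribute [local instance] MvPolynomial.gradedAlgebra in
theorem homogeneousComponent_add_mul {h : MvPolynomial σ k} {d : ℕ} (hh : h.IsHomogeneous d)
    (f : MvPolynomial σ k) (e : ℕ) :
    homogeneousComponent (d + e) (h * f) = h * homogeneousComponent e f := by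
  have := DirectSum.coe_decompose_mul_add_of_left_mem (homogeneousSubmodule σ k) (i := d) (j := e)
    (a := h) (b := f) hh
  simpa only [coe_decompose_eq_homogeneousComponent] using this

attribute [local instance] MvPolynomial.gradedAlgebra in
theorem homogeneousComponent_mul_of_lt {h : MvPolynomial σ k} {d e : ℕ} (hh : h.IsHomogeneous d)
    (f : MvPolynomial σ k) (he : e < d) :
    homogeneousComponent e (h * f) = 0 := by
  have := DirectSum.coe_decompose_mul_of_left_mem_of_not_le (homogeneousSubmodule σ k) (i := d)
    (n := e) (a := h) (b := f) hh (not_le.mpr he)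
  simpa only [coe_decompose_eq_homogeneousComponent] using this

/-- An ideal of a polynomial ring containing the homogeneous components of its elements. -/
def IsGradedIdeal (J : Ideal (MvPolynomial σ k)) : Prop :=
  ∀ f ∈ J, ∀ m, homogeneousComponent m f ∈ J

attribute [local instance] MvPolynomial.gradedAlgebra in
theorem isGradedIdeal_span {s : Set (MvPolynomial σ k)}
    (hs : ∀ f ∈ s, ∃ m, f.IsHomogeneous m) : IsGradedIdeal (Ideal.span s) := by
  intro f hf m
  exact homogeneousComponent_mem_of_mem
    (Ideal.homogeneous_span (homogeneousSubmodule σ k) s fun x hx => hs x hx) hf m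

theorem IsGradedIdeal.mem_of_components {J : Ideal (MvPolynomial σ k)}
    {f : MvPolynomial σ k} (h : ∀ m, homogeneousComponent m f ∈ J) : f ∈ J := by
  rw [← sum_homogeneousComponent f]
  exact J.sum_mem fun i _ => h i

theorem homogeneous_mem_span_of_lt {s : Set (MvPolynomial σ k)} {d e : ℕ}
    (hs : ∀ f ∈ s, f.IsHomogeneous d) {f : MvPolynomial σ k} (hf : f ∈ Ideal.span s)
    (hfe : f.IsHomogeneous e) (he : e < d) : f = 0 := by
  have key : ∀ a, homogeneousComponent e (a * f) = 0 := by
    clear hfe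
    induction hf using Submodule.span_induction with
    | mem x hx =>
      intro a
      rw [mul_comm, homogeneousComponent_mul_of_lt (hs x hx) a he]
    | zero => simp
    | add x y _ _ hx hy => intro a; simp [mul_add, hx, hy]
    | smul b x _ hx => intro a; rw [smul_eq_mul, ← mul_assoc, hx]
  have := key 1
  rwa [one_mul, homogeneousComponent_eq_self hfe] at this

end Graded

section Nilpotent

variable {k : Type*} [Field k] {n : ℕ}

theorem mem_of_forall_monomial_mem {σ : Type*} {J : Ideal (MvPolynomial σ k)}
    {f : MvPolynomial σ k} (h : ∀ c ∈ f.support, monomial c (1 : k) ∈ J) : f ∈ J := by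
  rw [← support_sum_monomial_coeff f]
  refine J.sum_mem fun c hc => ?_
  have : monomial c (coeff c f) = C (coeff c f) * monomial c (1 : k) := by
    rw [C_mul_monomial, mul_one]
  rw [this]
  exact J.mul_mem_left _ (h c hc)

theorem exists_X_pow_mem {σ : Type*} {J : Ideal (MvPolynomial σ k)} (hJ : IsGradedIdeal J)
    [Module.Finite k (MvPolynomial σ k ⧸ J)] (i : σ) : ∃ e, X i ^ e ∈ J := by
  obtain ⟨p, hp, h0⟩ := Algebra.IsIntegral.isIntegral (R := k) (Ideal.Quotient.mk J (X i))
  refine ⟨p.natDegree, ?_⟩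
  have h1 : Polynomial.aeval (X i : MvPolynomial σ k) p ∈ J := by
    rw [← Ideal.Quotient.eq_zero_iff_mem, ← h0]
    exact (Polynomial.aeval_algHom_apply (Ideal.Quotient.mkₐ k J) (X i) p).symm
  have h2 := hJ _ h1 p.natDegree
  rw [Polynomial.aeval_eq_sum_range, map_sum, Finset.sum_eq_single p.natDegree] at h2
  · rw [map_smul, homogeneousComponent_eq_self (by simpa using isHomogeneous_X_pow i p.natDegree),
      hp.coeff_natDegree, one_smul] at h2
    exact h2
  · intro j _ hj
    rw [map_smul, homogeneousComponent_of_mem (n := j)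
      (by simpa using isHomogeneous_X_pow i j), if_neg hj.symm, smul_zero]
  · simp

theorem exists_degree_bound {J : Ideal (MvPolynomial (Fin n) k)} (hJ : IsGradedIdeal J)
    [Module.Finite k (MvPolynomial (Fin n) k ⧸ J)] :
    ∃ M, ∀ m, M ≤ m → ∀ f : MvPolynomial (Fin n) k, f.IsHomogeneous m → f ∈ J := by
  choose e he using fun i : Fin n => exists_X_pow_mem hJ i
  refine ⟨∑ i, e i + 1, fun m hm f hf => mem_of_forall_monomial_mem fun c hc => ?_⟩
  have hdeg : c.degree = m := by
    by_contra h
    exact (mem_support_iff.mp hc) (hf.coeff_eq_zero h)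
  obtain ⟨i, hi⟩ : ∃ i, e i ≤ c i := by
    by_contra! h
    have h1 : ∑ i, c i ≤ ∑ i, e i := Finset.sum_le_sum fun i _ => (h i).le
    rw [Finsupp.degree_eq_sum] at hdeg
    omega
  refine J.mem_of_dvd ?_ (he i)
  rw [X_pow_eq_monomial, monomial_dvd_monomial]
  simpa using hi

end Nilpotent

section Exchange

variable {R : Type*} [CommRing R]

/-- `f` is a nonzerodivisor modulo `J`. -/
def IsRegularMod (J : Ideal R) (f : R) : Prop := ∀ r, f * r ∈ J → r ∈ J

theorem mem_sup_span_singleton_iff {J : Ideal R} {f h : R} :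
    f ∈ J ⊔ Ideal.span {h} ↔ ∃ u, f - h * u ∈ J := by
  rw [sup_comm, Ideal.mem_span_singleton_sup]
  constructor
  · rintro ⟨a, b, hb, rfl⟩
    exact ⟨a, by ring_nf; exact hb⟩
  · rintro ⟨u, hu⟩
    exact ⟨u, _, hu, by ring⟩

theorem mem_sup_iff_of_mul_sub_mul_mem {J : Ideal R} {x h r s : R} (hx : IsRegularMod J x)
    (hh : IsRegularMod J h) (hrs : x * r - h * s ∈ J) :
    r ∈ J ⊔ Ideal.span {h} ↔ s ∈ J ⊔ Ideal.span {x} := by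
  rw [mem_sup_span_singleton_iff, mem_sup_span_singleton_iff]
  constructor
  · rintro ⟨u, hu⟩
    refine ⟨u, hh _ ?_⟩
    convert J.sub_mem (J.mul_mem_left x hu) hrs using 1
    ring
  · rintro ⟨u, hu⟩
    refine ⟨u, hx _ ?_⟩
    convert J.add_mem (J.mul_mem_left h hu) hrs using 1
    ring

theorem mul_mem_sup_of_mul_sub_mul_mem {J : Ideal R} {x h r s : R} (hh : IsRegularMod J h)
    (hrs : x * r - h * s ∈ J) {y : R} (hy : y * r ∈ J ⊔ Ideal.span {h}) :
    y * s ∈ J ⊔ Ideal.span {x} := by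
  rw [mem_sup_span_singleton_iff] at hy ⊢
  obtain ⟨u, hu⟩ := hy
  refine ⟨u, hh _ ?_⟩
  convert J.sub_mem (J.mul_mem_left x hu) (J.mul_mem_left y hrs) using 1
  ring

/-- The ideal generated by the first `i` terms of `h` and the first `j` terms of `x`. -/
def flagIdeal (x h : ℕ → R) (i j : ℕ) : Ideal R :=
  Ideal.span (h '' Set.Iio i ∪ x '' Set.Iio j)

theorem flagIdeal_succ_left (x h : ℕ → R) (i j : ℕ) :
    flagIdeal x h (i + 1) j = flagIdeal x h i j ⊔ Ideal.span {h i} := by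
  rw [flagIdeal, flagIdeal, ← Ideal.span_union, Set.Iio_add_one_eq_Iic, ← Set.Iio_insert,
    Set.image_insert_eq]
  congr 1
  ext
  simp only [Set.mem_union, Set.mem_insert_iff, Set.mem_singleton_iff]
  tauto

theorem flagIdeal_succ_right (x h : ℕ → R) (i j : ℕ) :
    flagIdeal x h i (j + 1) = flagIdeal x h i j ⊔ Ideal.span {x j} := by
  rw [flagIdeal, flagIdeal, ← Ideal.span_union, Set.Iio_add_one_eq_Iic, ← Set.Iio_insert,
    Set.image_insert_eq]
  congr 1
  ext
  simp only [Set.mem_union, Set.mem_insert_iff, Set.mem_singleton_iff]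
  tauto

theorem flagIdeal_congr (x : ℕ → R) {h h' : ℕ → R} {i : ℕ} (hh : ∀ l < i, h l = h' l) (j : ℕ) :
    flagIdeal x h i j = flagIdeal x h' i j := by
  have : h '' Set.Iio i = h' '' Set.Iio i := Set.image_congr fun l hl => hh l hl
  rw [flagIdeal, flagIdeal, this]

/-- The terms of `x` and of `h` are nonzerodivisors modulo the flag ideals below them. -/
structure IsRegularFlag (x h : ℕ → R) (n m : ℕ) : Prop where
  left_zero : ∀ j < n, IsRegularMod (flagIdeal x h 0 j) (x j)
  right : ∀ i < m, ∀ j, i + j < n → IsRegularMod (flagIdeal x h i j) (h i)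

theorem IsRegularFlag.left {x h : ℕ → R} {n m : ℕ} (H : IsRegularFlag x h n m) {i : ℕ}
    (hi : i ≤ m) {j : ℕ} (hij : i + j < n) : IsRegularMod (flagIdeal x h i j) (x j) := by
  induction i generalizing j with
  | zero => exact H.left_zero j (by omega)
  | succ i ih =>
    intro r hr
    rw [flagIdeal_succ_left] at hr ⊢
    obtain ⟨s, hs⟩ := mem_sup_span_singleton_iff.mp hr
    rw [mem_sup_iff_of_mul_sub_mul_mem (ih (by omega) (by omega))
      (H.right i (by omega) j (by omega)) hs, ← flagIdeal_succ_right]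
    refine H.right i (by omega) (j + 1) (by omega) _ ?_
    rw [flagIdeal_succ_right, mem_sup_span_singleton_iff]
    refine ⟨r, ?_⟩
    rw [← neg_mem_iff]
    convert hs using 1
    ring

theorem IsRegularFlag.mem_of_forall_mul_mem {x h : ℕ → R} {n m : ℕ} (H : IsRegularFlag x h n m)
    {i : ℕ} (hi : i ≤ m) {j : ℕ} (hij : i + j < n) {r : R}
    (hr : ∀ l < n, x l * r ∈ flagIdeal x h i j) : r ∈ flagIdeal x h i j := by
  induction i generalizing j r with
  | zero => exact H.left_zero j (by omega) r (hr j (by omega))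
  | succ i ih =>
    rw [flagIdeal_succ_left] at hr ⊢
    obtain ⟨s, hs⟩ := mem_sup_span_singleton_iff.mp (hr j (by omega))
    have hh := H.right i (by omega) j (by omega)
    rw [mem_sup_iff_of_mul_sub_mul_mem (H.left (by omega) (by omega)) hh hs,
      ← flagIdeal_succ_right]
    refine ih (by omega) (by omega) fun l hl => ?_
    rw [flagIdeal_succ_right]
    exact mul_mem_sup_of_mul_sub_mul_mem hh hs (hr l hl)

theorem exists_isRegularMod_of_forall {k : Type*} [Field k] [Infinite k] [Algebra k R]
    [IsNoetherianRing R] (U : Submodule k R) {m : Set R}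
    (hU : ∀ P : Ideal R, P.IsPrime → (U : Set R) ⊆ P → m ⊆ P)
    {s : Set (Ideal R)} (hs : s.Finite)
    (hdepth : ∀ J ∈ s, ∀ r, (∀ y ∈ m, y * r ∈ J) → r ∈ J) :
    ∃ u ∈ U, ∀ J ∈ s, IsRegularMod J u := by
  have hfin : (⋃ J ∈ s, associatedPrimes R (R ⧸ J)).Finite :=
    hs.biUnion fun J _ => associatedPrimes.finite R (R ⧸ J)
  classical
  let T : Finset (Subspace k U) := hfin.toFinset.image fun P =>
    (P.restrictScalars k).comap U.subtype
  have hT : ⊤ ∉ T := by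
    intro h
    obtain ⟨P, hP, hPt⟩ := Finset.mem_image.mp h
    rw [Set.Finite.mem_toFinset, Set.mem_iUnion₂] at hP
    obtain ⟨J, hJ, hPJ⟩ := hP
    obtain ⟨hprime, z, hz⟩ := isAssociatedPrime_iff.mp (AssociatedPrimes.mem_iff.mp hPJ)
    obtain ⟨r, rfl⟩ := Ideal.Quotient.mk_surjective z
    have key : ∀ y, y ∈ P ↔ y * r ∈ J := by
      intro y
      rw [hz, Submodule.mem_colon_singleton, Submodule.mem_bot, ← Ideal.Quotient.eq_zero_iff_mem,
        map_mul]
      rfl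
    have hUP : (U : Set R) ⊆ P := by
      intro u hu
      have : (⟨u, hu⟩ : U) ∈ (P.restrictScalars k).comap U.subtype := by
        rw [hPt]; trivial
      exact this
    have hmP := hU P hprime hUP
    have hrJ := hdepth J hJ r fun y hy => (key y).mp (hmP hy)
    exact hprime.ne_top ((Ideal.eq_top_iff_one P).mpr ((key 1).mpr (by simpa using hrJ)))
  have hne := Subspace.biUnion_ne_univ_of_top_notMem hT
  obtain ⟨u, hu⟩ := (Set.ne_univ_iff_exists_notMem _).mp hne
  refine ⟨u, u.2, fun J hJ r hr => ?_⟩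
  by_contra hrJ
  have hzd : (u : R) ∈ ⋃ p ∈ associatedPrimes R (R ⧸ J), (p : Set R) := by
    rw [biUnion_associatedPrimes_eq_zero_divisors]
    refine ⟨Ideal.Quotient.mk J r, fun h => hrJ (Ideal.Quotient.eq_zero_iff_mem.mp h), ?_⟩
    rw [← Ideal.Quotient.eq_zero_iff_mem, map_mul] at hr
    exact hr
  obtain ⟨P, hP, huP⟩ := Set.mem_iUnion₂.mp hzd
  apply hu
  refine Set.mem_iUnion₂.mpr ⟨_, Finset.mem_image_of_mem _
    (hfin.mem_toFinset.mpr (Set.mem_iUnion₂.mpr ⟨J, hJ, hP⟩)), huP⟩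

theorem exists_isRegularFlag {k : Type*} [Field k] [Infinite k] [Algebra k R]
    [IsNoetherianRing R] (U : Submodule k R) (x : ℕ → R) (n : ℕ)
    (hx : ∀ j < n, IsRegularMod (Ideal.span (x '' Set.Iio j)) (x j))
    (hU : ∀ P : Ideal R, P.IsPrime → (U : Set R) ⊆ P → ∀ l < n, x l ∈ P) (m : ℕ) (hm : m ≤ n) :
    ∃ h : ℕ → R, (∀ i, h i ∈ U) ∧ IsRegularFlag x h n m := by
  induction m with
  | zero =>
    refine ⟨fun _ => 0, fun _ => U.zero_mem, ⟨fun j hj => ?_, by simp⟩⟩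
    simpa [flagIdeal] using hx j hj
  | succ m ih =>
    obtain ⟨h, hhU, H⟩ := ih (by omega)
    obtain ⟨u, huU, hu⟩ := exists_isRegularMod_of_forall U (m := x '' Set.Iio n)
      (fun P hP hUP => by
        rintro _ ⟨l, hl, rfl⟩
        exact hU P hP hUP l hl)
      (s := (fun j => flagIdeal x h m j) '' Set.Iio (n - m)) ((Set.finite_Iio _).image _)
      (by
        rintro _ ⟨j, hj, rfl⟩ r hr
        have hj : j < n - m := hj
        exact H.mem_of_forall_mul_mem le_rfl (by omega) fun l hl =>
          hr _ (Set.mem_image_of_mem _ hl))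
    have hne : ∀ l, l ≠ m → Function.update h m u l = h l := fun l hl => by simp [hl]
    refine ⟨Function.update h m u, fun i => ?_, ⟨fun j hj => ?_, fun i hi j hij => ?_⟩⟩
    · rcases eq_or_ne i m with rfl | hi
      · simpa using huU
      · rw [hne i hi]; exact hhU i
    · rw [flagIdeal_congr x (h' := h) (by simp)]
      exact H.left_zero j hj
    · rw [flagIdeal_congr x (h' := h) (fun l hl => hne l (by omega))]
      rcases eq_or_ne i m with rfl | him
      · rw [Function.update_self]
        exact hu _ (Set.mem_image_of_mem _ (show j < n - i by omega))
      · rw [hne i him]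
        exact H.right i (by omega) j hij

end Exchange

section GradedExchange

variable {σ k : Type*} [Field k]

theorem isGradedIdeal_flagIdeal {x h : ℕ → MvPolynomial σ k} {a b : ℕ}
    (hx : ∀ j, (x j).IsHomogeneous a) (hh : ∀ i, (h i).IsHomogeneous b) (i j : ℕ) :
    IsGradedIdeal (flagIdeal x h i j) := by
  refine isGradedIdeal_span ?_
  rintro _ (⟨l, _, rfl⟩ | ⟨l, _, rfl⟩)
  exacts [⟨b, hh l⟩, ⟨a, hx l⟩]

theorem exists_homogeneous_mul_sub_mul_mem {J : Ideal (MvPolynomial σ k)} (hJ : IsGradedIdeal J)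
    {x h r : MvPolynomial σ k} {D e : ℕ} (hx : x.IsHomogeneous 1) (hh : h.IsHomogeneous (D + 1))
    (hr : r.IsHomogeneous e) (hxr : x * r ∈ J ⊔ Ideal.span {h}) :
    ∃ s, x * r - h * s ∈ J ∧ (∀ e', e' + D = e → s.IsHomogeneous e') ∧ (e < D → s = 0) := by
  obtain ⟨u, hu⟩ := mem_sup_span_singleton_iff.mp hxr
  have hc := hJ _ hu (e + 1)
  rw [map_sub, homogeneousComponent_eq_self (by simpa [add_comm] using hx.mul hr)] at hc
  rcases lt_or_ge e D with hlt | hge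
  · rw [homogeneousComponent_mul_of_lt hh u (by omega)] at hc
    exact ⟨0, by simpa using hc, fun _ _ => isHomogeneous_zero _ _ _, fun _ => rfl⟩
  · obtain ⟨e', rfl⟩ := Nat.exists_eq_add_of_le hge
    rw [show D + e' + 1 = D + 1 + e' by ring, homogeneousComponent_add_mul hh] at hc
    refine ⟨_, hc, fun e'' he => ?_, fun h => by omega⟩
    obtain rfl : e'' = e' := by omega
    exact homogeneousComponent_isHomogeneous _ _

theorem IsRegularFlag.exists_exchange {x h : ℕ → MvPolynomial σ k} {n m D : ℕ}
    (H : IsRegularFlag x h n m) (hx : ∀ j, (x j).IsHomogeneous 1)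
    (hh : ∀ i, (h i).IsHomogeneous (D + 1)) {ι : Type*} (b : Set (MvPolynomial σ k)) (i t : ℕ)
    (him : i + t ≤ m) {j : ℕ} (hij : i + t + j ≤ n) (hb : ∀ l, j ≤ l → l < j + t → x l ∈ b)
    {e : ℕ} (r : ι → MvPolynomial σ k) (hr : ∀ β, (r β).IsHomogeneous e)
    (hbr : ∀ β, ∀ y ∈ b, y * r β ∈ flagIdeal x h (i + t) j) :
    ∃ s : ι → MvPolynomial σ k, (∀ β, ∀ y ∈ b, y * s β ∈ flagIdeal x h i (j + t)) ∧
      (∀ β e', e' + t * D = e → (s β).IsHomogeneous e') ∧ (e < t * D → ∀ β, s β = 0) ∧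
      ∀ (T : Finset ι) (v : ι → MvPolynomial σ k),
        ∑ β ∈ T, v β * r β ∈ flagIdeal x h (i + t) j ↔
          ∑ β ∈ T, v β * s β ∈ flagIdeal x h i (j + t) := by
  induction t generalizing j e r with
  | zero =>
    refine ⟨r, hbr, fun β e' he => ?_, by simp, fun T v => Iff.rfl⟩
    obtain rfl : e' = e := by omega
    exact hr β
  | succ t ih =>
    rw [← add_assoc, flagIdeal_succ_left] at hbr
    have hstep := fun β => exists_homogeneous_mul_sub_mul_mem
      (isGradedIdeal_flagIdeal hx hh (i + t) j) (hx j) (hh (i + t)) (hr β)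
      (hbr β _ (hb j le_rfl (by omega)))
    choose r' hr' hdeg hzero using hstep
    have hxreg := H.left (i := i + t) (by omega) (j := j) (by omega)
    have hhreg := H.right (i + t) (by omega) j (by omega)
    have hbr' : ∀ β, ∀ y ∈ b, y * r' β ∈ flagIdeal x h (i + t) (j + 1) := by
      intro β y hy
      rw [flagIdeal_succ_right]
      exact mul_mem_sup_of_mul_sub_mul_mem hhreg (hr' β) (hbr β y hy)
    have hiff : ∀ (T : Finset ι) (v : ι → MvPolynomial σ k),
        ∑ β ∈ T, v β * r β ∈ flagIdeal x h (i + t + 1) j ↔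
          ∑ β ∈ T, v β * r' β ∈ flagIdeal x h (i + t) (j + 1) := by
      intro T v
      rw [flagIdeal_succ_left, flagIdeal_succ_right]
      refine mem_sup_iff_of_mul_sub_mul_mem hxreg hhreg ?_
      rw [Finset.mul_sum, Finset.mul_sum, ← Finset.sum_sub_distrib]
      refine Ideal.sum_mem _ fun β _ => ?_
      convert Ideal.mul_mem_left _ (v β) (hr' β) using 1
      ring
    have hcount : (t + 1) * D = t * D + D := by ring
    rw [show i + (t + 1) = i + t + 1 by ring, show j + (t + 1) = j + 1 + t by ring]
    rcases lt_or_ge e D with hlt | hge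
    · refine ⟨fun _ => 0, by simp, fun _ _ _ => isHomogeneous_zero _ _ _, fun _ _ => rfl,
        fun T v => ?_⟩
      rw [hiff]
      simp [hzero _ hlt]
    · obtain ⟨e', rfl⟩ := Nat.exists_eq_add_of_le hge
      obtain ⟨s, h1, h2, h3, h4⟩ := ih (by omega) (j := j + 1) (by omega)
        (fun l hl hl' => hb l (by omega) (by omega)) r' (fun β => hdeg β e' (by omega)) hbr'
      exact ⟨s, h1, fun β e'' he => h2 β e'' (by omega), fun he => h3 (by omega),
        fun T v => (hiff T v).trans (h4 T v)⟩

end GradedExchange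

section Variables

variable {k : Type*} [Field k] {n : ℕ}

theorem isRegularMod_span_X_image {σ : Type*} {s : Set σ} {i : σ} (hi : i ∉ s) :
    IsRegularMod (Ideal.span (X '' s : Set (MvPolynomial σ k))) (X i) := by
  intro r hr
  rw [mem_ideal_span_X_image] at hr ⊢
  intro m hm
  obtain ⟨j, hj, hne⟩ := hr (Finsupp.single i 1 + m) (by
    rw [mem_support_iff, coeff_X_mul]
    exact mem_support_iff.mp hm)
  refine ⟨j, hj, ?_⟩
  have hij : i ≠ j := fun h => hi (h ▸ hj)
  simpa [Finsupp.single_apply, hij] using hne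

/-- The variables in the order given by a permutation, extended by zero. -/
noncomputable def permVar (k : Type*) [Field k] (σ : Equiv.Perm (Fin n)) (j : ℕ) :
    MvPolynomial (Fin n) k :=
  if hj : j < n then X (σ ⟨j, hj⟩) else 0

theorem permVar_coe (σ : Equiv.Perm (Fin n)) (i : Fin n) : permVar k σ i = X (σ i) := by
  simp [permVar]

theorem isHomogeneous_permVar (σ : Equiv.Perm (Fin n)) (j : ℕ) :
    (permVar k σ j).IsHomogeneous 1 := by
  unfold permVar
  split_ifs
  exacts [isHomogeneous_X _ _, isHomogeneous_zero _ _ _]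

theorem permVar_image_Iio (σ : Equiv.Perm (Fin n)) {j : ℕ} (hj : j ≤ n) :
    permVar k σ '' Set.Iio j = X '' {i : Fin n | (σ.symm i : ℕ) < j} := by
  ext f
  constructor
  · rintro ⟨l, hl, rfl⟩
    have hl : l < j := hl
    refine ⟨σ ⟨l, by omega⟩, by simpa using hl, ?_⟩
    rw [← permVar_coe]
  · rintro ⟨i, hi, rfl⟩
    refine ⟨σ.symm i, hi, ?_⟩
    rw [permVar_coe, Equiv.apply_symm_apply]

theorem isRegularMod_permVar (σ : Equiv.Perm (Fin n)) {j : ℕ} (hj : j < n) :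
    IsRegularMod (Ideal.span (permVar k σ '' Set.Iio j)) (permVar k σ j) := by
  rw [permVar_image_Iio σ hj.le, show permVar k σ j = X (σ ⟨j, hj⟩) from
    permVar_coe σ ⟨j, hj⟩]
  exact isRegularMod_span_X_image (by simp)

end Variables

section AdaptedFlag

theorem linearIndependent_of_notMem_span_image_Iio {k V : Type*} [DivisionRing k]
    [AddCommGroup V] [Module k V] {n : ℕ} (h : ℕ → V)
    (hh : ∀ i < n, h i ∉ Submodule.span k (h '' Set.Iio i)) :
    LinearIndependent k fun i : Fin n => h i := by
  induction n with
  | zero => exact linearIndependent_empty_type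
  | succ n ih =>
    rw [linearIndependent_finSucc']
    refine ⟨ih fun i hi => hh i (by omega), fun hmem => hh n (by omega) ?_⟩
    refine Submodule.span_mono ?_ hmem
    rintro _ ⟨i, rfl⟩
    exact ⟨i, i.2, rfl⟩

theorem ideal_span_eq_of_span_eq {k R : Type*} [CommSemiring k] [CommSemiring R] [Algebra k R]
    {s t : Set R} (h : Submodule.span k s = Submodule.span k t) :
    Ideal.span s = Ideal.span t := by
  have key : ∀ {s t : Set R}, Submodule.span k s = Submodule.span k t →
      Ideal.span s ≤ Ideal.span t := by
    intro s t h
    refine Ideal.span_le.mpr fun x hx => ?_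
    have : x ∈ Submodule.span k t := h ▸ Submodule.subset_span hx
    exact Submodule.span_le_restrictScalars k R t this
  exact le_antisymm (key h) (key h.symm)

variable {k : Type*} [Field k] {n : ℕ}

/-- A basis `h` of the span of `g`, together with the variables ordered by `σ`, forms a
regular flag. -/
structure IsAdaptedFlag (g : Fin n → MvPolynomial (Fin n) k) (σ : Equiv.Perm (Fin n)) (D : ℕ)
    (h : ℕ → MvPolynomial (Fin n) k) : Prop where
  regular : IsRegularFlag (permVar k σ) h n n
  homogeneous : ∀ i, (h i).IsHomogeneous (D + 1)
  linearIndependent : LinearIndependent k fun i : Fin n => h i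
  span_eq : Submodule.span k (Set.range fun i : Fin n => h i) = Submodule.span k (Set.range g)
  flagIdeal_eq : flagIdeal (permVar k σ) h n 0 = Ideal.span (Set.range g)

theorem exists_isAdaptedFlag [Infinite k] {D : ℕ} (g : Fin n → MvPolynomial (Fin n) k)
    (hg : ∀ i, (g i).IsHomogeneous (D + 1))
    [Module.Finite k (MvPolynomial (Fin n) k ⧸ Ideal.span (Set.range g))]
    (σ : Equiv.Perm (Fin n)) : ∃ h, IsAdaptedFlag g σ D h := by
  have hI : IsGradedIdeal (Ideal.span (Set.range g)) :=
    isGradedIdeal_span (by rintro _ ⟨i, rfl⟩; exact ⟨_, hg i⟩)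
  obtain ⟨h, hU, H⟩ := exists_isRegularFlag (Submodule.span k (Set.range g)) (permVar k σ) n
    (fun j hj => isRegularMod_permVar σ hj)
    (fun P hP hUP l hl => by
      obtain ⟨e, he⟩ := exists_X_pow_mem hI (σ ⟨l, hl⟩)
      have hle : Ideal.span (Set.range g) ≤ P :=
        Ideal.span_le.mpr (Submodule.subset_span.trans hUP)
      rw [show permVar k σ l = X (σ ⟨l, hl⟩) from permVar_coe σ ⟨l, hl⟩]
      exact hP.mem_of_pow_mem _ (hle he)) n le_rfl
  have hle : Submodule.span k (Set.range g) ≤ homogeneousSubmodule (Fin n) k (D + 1) :=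
    Submodule.span_le.mpr (by rintro _ ⟨i, rfl⟩; exact hg i)
  have hhom : ∀ i, (h i).IsHomogeneous (D + 1) := fun i => hle (hU i)
  have hli : LinearIndependent k fun i : Fin n => h i := by
    refine linearIndependent_of_notMem_span_image_Iio h fun i hi hmem => ?_
    have h1 : h i * 1 ∈ flagIdeal (permVar k σ) h i 0 := by
      rw [mul_one]
      have := Submodule.span_le_restrictScalars k (MvPolynomial (Fin n) k) _ hmem
      exact Ideal.span_mono Set.subset_union_left this
    have h2 := H.right i hi 0 (by omega) 1 h1
    have h3 := homogeneous_mem_span_of_lt (d := D + 1) (by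
      rintro _ (⟨l, _, rfl⟩ | ⟨l, hl, rfl⟩)
      · exact hhom l
      · exact absurd hl (by simp)) h2 (isHomogeneous_one _ _) (by omega)
    exact one_ne_zero h3
  have hspan : Submodule.span k (Set.range fun i : Fin n => h i) =
      Submodule.span k (Set.range g) := by
    have : FiniteDimensional k (Submodule.span k (Set.range g)) :=
      FiniteDimensional.span_of_finite k (Set.finite_range g)
    refine Submodule.eq_of_le_of_finrank_le (Submodule.span_le.mpr ?_) ?_
    · rintro _ ⟨i, rfl⟩
      exact hU i
    · rw [finrank_span_eq_card hli]
      exact finrank_range_le_card g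
  refine ⟨h, H, hhom, hli, hspan, ?_⟩
  rw [← ideal_span_eq_of_span_eq hspan, flagIdeal]
  congr 1
  ext f
  simp only [Set.mem_union, Set.mem_image, Set.mem_Iio, Set.mem_range, not_lt_zero, false_and,
    exists_false, or_false]
  exact ⟨fun ⟨l, hl, e⟩ => ⟨⟨l, hl⟩, e⟩, fun ⟨i, e⟩ => ⟨i, i.2, e⟩⟩

end AdaptedFlag

section Duality

variable {k : Type*} [Field k] {n : ℕ}

theorem IsAdaptedFlag.isGradedIdeal_flagIdeal {g : Fin n → MvPolynomial (Fin n) k}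
    {σ : Equiv.Perm (Fin n)} {D : ℕ} {h : ℕ → MvPolynomial (Fin n) k} (H : IsAdaptedFlag g σ D h)
    (i j : ℕ) : IsGradedIdeal (flagIdeal (permVar k σ) h i j) :=
  _root_.isGradedIdeal_flagIdeal (isHomogeneous_permVar σ) H.homogeneous i j

theorem IsAdaptedFlag.exists_exchange {g : Fin n → MvPolynomial (Fin n) k}
    {σ : Equiv.Perm (Fin n)} {D : ℕ} {h : ℕ → MvPolynomial (Fin n) k} (H : IsAdaptedFlag g σ D h)
    {ι : Type*} {m a : ℕ} (hma : m + a = n) {e : ℕ} (r : ι → MvPolynomial (Fin n) k)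
    (hr : ∀ β, (r β).IsHomogeneous e)
    (har : ∀ β, ∀ i, (σ.symm i : ℕ) < a → X i * r β ∈ Ideal.span (Set.range g)) :
    ∃ s : ι → MvPolynomial (Fin n) k,
      (∀ β e', e' + a * D = e → (s β).IsHomogeneous e') ∧ (e < a * D → ∀ β, s β = 0) ∧
      ∀ (T : Finset ι) (v : ι → MvPolynomial (Fin n) k),
        ∑ β ∈ T, v β * r β ∈ Ideal.span (Set.range g) ↔
          ∑ β ∈ T, v β * s β ∈ flagIdeal (permVar k σ) h m a := by
  have hbr : ∀ β, ∀ y ∈ (X '' {i | (σ.symm i : ℕ) < a} : Set (MvPolynomial (Fin n) k)),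
      y * r β ∈ flagIdeal (permVar k σ) h (m + a) 0 := by
    rintro β _ ⟨i, hi, rfl⟩
    rw [hma, H.flagIdeal_eq]
    exact har β i hi
  obtain ⟨s, -, h2, h3, h4⟩ := H.regular.exists_exchange (isHomogeneous_permVar σ) H.homogeneous
    _ m a hma.le (j := 0) hma.le (fun l _ hl => by
      rw [← permVar_image_Iio σ (by omega)]
      exact Set.mem_image_of_mem _ (by simpa using hl)) r hr hbr
  rw [hma, H.flagIdeal_eq, zero_add] at h4
  exact ⟨s, h2, h3, h4⟩

theorem flagIdeal_zero_permVar (σ : Equiv.Perm (Fin n)) (h : ℕ → MvPolynomial (Fin n) k) :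
    flagIdeal (permVar k σ) h 0 n = Ideal.span (X '' Set.univ) := by
  rw [flagIdeal, permVar_image_Iio σ le_rfl]
  congr 1
  simp

theorem mem_span_X_of_isHomogeneous {σ : Type*} {f : MvPolynomial σ k} {e : ℕ}
    (hf : f.IsHomogeneous e) (he : e ≠ 0) : f ∈ Ideal.span (X '' Set.univ) := by
  rw [mem_ideal_span_X_image]
  intro m hm
  have hm0 : m ≠ 0 := by
    rintro rfl
    exact (mem_support_iff.mp hm) (hf.coeff_eq_zero (by simpa using he.symm))
  obtain ⟨i, hi⟩ := Finsupp.ne_iff.mp hm0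
  exact ⟨i, trivial, hi⟩

theorem one_notMem_span {D : ℕ} {g : Fin n → MvPolynomial (Fin n) k}
    (hg : ∀ i, (g i).IsHomogeneous (D + 1)) :
    (1 : MvPolynomial (Fin n) k) ∉ Ideal.span (Set.range g) := fun h =>
  one_ne_zero (homogeneous_mem_span_of_lt (d := D + 1) (by rintro _ ⟨i, rfl⟩; exact hg i) h
    (isHomogeneous_one _ _) (by omega))

variable [Infinite k] {D : ℕ} {g : Fin n → MvPolynomial (Fin n) k}
    [Module.Finite k (MvPolynomial (Fin n) k ⧸ Ideal.span (Set.range g))]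

theorem degree_eq_of_socle (hg : ∀ i, (g i).IsHomogeneous (D + 1))
    {r : MvPolynomial (Fin n) k} {e : ℕ} (hr : r.IsHomogeneous e)
    (hX : ∀ i, X i * r ∈ Ideal.span (Set.range g)) (hrI : r ∉ Ideal.span (Set.range g)) :
    e = n * D := by
  obtain ⟨h, H⟩ := exists_isAdaptedFlag g hg 1
  obtain ⟨s, h2, h3, h4⟩ := H.exists_exchange (ι := Unit) (m := 0) (a := n) (zero_add n)
    (fun _ => r) (fun _ => hr) (fun _ i _ => hX i)
  have hiff := h4 {()} 1
  simp only [Pi.one_apply, one_mul, Finset.sum_singleton] at hiff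
  rw [hiff] at hrI
  rcases lt_or_ge e (n * D) with hlt | hge
  · exact absurd (h3 hlt () ▸ Ideal.zero_mem _) hrI
  · obtain ⟨e', rfl⟩ := Nat.exists_eq_add_of_le hge
    by_contra hne
    apply hrI
    rw [flagIdeal_zero_permVar]
    exact mem_span_X_of_isHomogeneous (h2 () e' (by ring)) (by omega)

theorem exists_monomial_mul_notMem (hg : ∀ i, (g i).IsHomogeneous (D + 1))
    {f : MvPolynomial (Fin n) k} {j : ℕ} (hf : f.IsHomogeneous j)
    (hfI : f ∉ Ideal.span (Set.range g)) :
    ∃ c : Fin n →₀ ℕ, j + c.degree = n * D ∧ f * monomial c 1 ∉ Ideal.span (Set.range g) := by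
  have hI : IsGradedIdeal (Ideal.span (Set.range g)) :=
    isGradedIdeal_span (by rintro _ ⟨i, rfl⟩; exact ⟨_, hg i⟩)
  obtain ⟨M, hM⟩ := exists_degree_bound hI
  have hhom : ∀ c : Fin n →₀ ℕ, (f * monomial c (1 : k)).IsHomogeneous (j + c.degree) :=
    fun c => hf.mul (isHomogeneous_monomial _ rfl)
  classical
  let P : ℕ → Prop := fun e => ∃ c : Fin n →₀ ℕ, c.degree = e ∧
    f * monomial c 1 ∉ Ideal.span (Set.range g)
  have hP0 : P 0 := ⟨0, by simp, by simpa using hfI⟩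
  obtain ⟨c, hc, hcI⟩ := Nat.findGreatest_spec (Nat.zero_le M) hP0
  refine ⟨c, degree_eq_of_socle hg (hhom c) (fun i => ?_) hcI, hcI⟩
  by_contra hi
  have he : X i * (f * monomial c (1 : k)) = f * monomial (Finsupp.single i 1 + c) 1 := by
    rw [X, mul_left_comm, monomial_mul, one_mul]
  rw [he] at hi
  have hlt : Nat.findGreatest P M < c.degree + 1 := by omega
  by_cases hcM : c.degree + 1 ≤ M
  · exact Nat.findGreatest_is_greatest hlt hcM ⟨_, by simp [add_comm], hi⟩
  · refine hi (hM (j + (Finsupp.single i 1 + c).degree) ?_ _ (hhom _))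
    rw [map_add, Finsupp.degree_single]
    omega

theorem mem_span_of_degree_lt (hg : ∀ i, (g i).IsHomogeneous (D + 1))
    {f : MvPolynomial (Fin n) k} {j : ℕ} (hf : f.IsHomogeneous j) (hj : n * D < j) :
    f ∈ Ideal.span (Set.range g) := by
  by_contra h
  obtain ⟨c, hc, -⟩ := exists_monomial_mul_notMem hg hf h
  omega

theorem exists_smul_add_smul_mem (hg : ∀ i, (g i).IsHomogeneous (D + 1))
    {p q : MvPolynomial (Fin n) k} (hp : p.IsHomogeneous (n * D)) (hq : q.IsHomogeneous (n * D))
    (hqI : q ∉ Ideal.span (Set.range g)) :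
    ∃ a : k, p - a • q ∈ Ideal.span (Set.range g) := by
  obtain ⟨h, H⟩ := exists_isAdaptedFlag g hg 1
  obtain ⟨s, h2, -, h4⟩ := H.exists_exchange (ι := Bool) (m := 0) (a := n) (zero_add n)
    (fun b => if b then p else q) (e := n * D) (by rintro (_ | _) <;> simpa)
    (fun b i _ => mem_span_of_degree_lt (j := 1 + n * D) hg
      ((isHomogeneous_X k i).mul (by cases b <;> simpa)) (by omega))
  have hconst : ∀ b, s b = C (coeff 0 (s b)) := by
    intro b
    have := h2 b 0 (zero_add _)
    rw [← totalDegree_zero_iff_isHomogeneous] at this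
    exact totalDegree_eq_zero_iff_eq_C.mp this
  have hne : coeff 0 (s false) ≠ 0 := by
    intro h0
    apply hqI
    have := h4 {false} 1
    simp only [Pi.one_apply, one_mul, Finset.sum_singleton, Bool.false_eq_true, if_false] at this
    rw [this, hconst, h0, C_0]
    exact Ideal.zero_mem _
  refine ⟨coeff 0 (s true) / coeff 0 (s false), ?_⟩
  have := h4 Finset.univ fun b => if b then 1 else C (-(coeff 0 (s true) / coeff 0 (s false)))
  simp only [Fintype.univ_bool, Finset.mem_singleton, Bool.true_eq_false, not_false_eq_true,
    Finset.sum_insert, if_true, one_mul, Finset.sum_singleton, Bool.false_eq_true, if_false] at this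
  rw [smul_eq_C_mul, sub_eq_add_neg, ← neg_mul, ← C_neg, this, hconst true, hconst false, coeff_C,
    coeff_C, if_pos rfl, if_pos rfl, ← C_mul, ← C_add]
  convert Ideal.zero_mem _
  rw [neg_mul, div_mul_cancel₀ _ hne, add_neg_cancel, C_0]

end Duality

theorem exists_perm_lt_card_iff {n : ℕ} (A : Finset (Fin n)) :
    ∃ σ : Equiv.Perm (Fin n), ∀ i, (σ.symm i : ℕ) < A.card ↔ i ∈ A := by
  have hc : Fintype.card {j : Fin n // (j : ℕ) < A.card} = Fintype.card {i // i ∈ A} := by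
    rw [Fintype.card_coe, Fintype.card_subtype]
    have h1 : A.card ≤ n := card_finset_fin_le A
    rw [Fin.card_filter_val_lt]
    omega
  let e := Fintype.equivOfCardEq hc
  refine ⟨e.extendSubtype, fun i => ?_⟩
  constructor
  · intro hi
    have := e.extendSubtype_mem _ hi
    simpa using this
  · intro hi
    by_contra h
    have := e.extendSubtype_not_mem _ h
    exact this (by simpa using hi)

section Pairing

variable {k : Type*} [Field k] {n : ℕ}

theorem exists_eq_mul_of_nondegenerate {R : Type*} [CommRing R] [Algebra k R] {J : Ideal R}
    [Module.Finite k (R ⧸ J)] (ω : R →ₗ[k] k) (hω : ∀ f ∈ J, ω f = 0)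
    (hnd : ∀ z, z ∉ J → ∃ r, ω (r * z) ≠ 0) (φ : R →ₗ[k] k) (hφ : ∀ f ∈ J, φ f = 0) :
    ∃ r, ∀ z, φ z = ω (r * z) := by
  obtain ⟨j, hj⟩ := (Ideal.Quotient.mkₐ k J).toLinearMap.exists_rightInverse_of_surjective
    (LinearMap.range_eq_top.mpr Ideal.Quotient.mk_surjective)
  have hj' : ∀ f, j (Ideal.Quotient.mk J f) - f ∈ J := by
    intro f
    rw [← Ideal.Quotient.eq_zero_iff_mem, map_sub, sub_eq_zero]
    exact LinearMap.congr_fun hj (Ideal.Quotient.mk J f)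
  have hdesc : ∀ ψ : R →ₗ[k] k, (∀ f ∈ J, ψ f = 0) →
      ∀ f, (ψ ∘ₗ j) (Ideal.Quotient.mk J f) = ψ f := by
    intro ψ hψ f
    have := hψ _ (hj' f)
    rwa [map_sub, sub_eq_zero] at this
  let B : (R ⧸ J) →ₗ[k] Module.Dual k (R ⧸ J) := (LinearMap.mul k (R ⧸ J)).compr₂ (ω ∘ₗ j)
  have hB : ∀ r z, B (Ideal.Quotient.mk J r) (Ideal.Quotient.mk J z) = ω (r * z) := by
    intro r z
    rw [← hdesc ω hω, map_mul]
    rfl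
  have hinj : Function.Injective B := by
    rw [injective_iff_map_eq_zero]
    intro q hq
    obtain ⟨z, rfl⟩ := Ideal.Quotient.mk_surjective q
    by_contra hne
    obtain ⟨r, hr⟩ := hnd z fun h => hne (Ideal.Quotient.eq_zero_iff_mem.mpr h)
    apply hr
    rw [mul_comm, ← hB, hq]
    rfl
  have hsurj := (LinearMap.injective_iff_surjective_of_finrank_eq_finrank
    (Subspace.dual_finrank_eq (K := k) (V := R ⧸ J)).symm).mp hinj
  obtain ⟨q, hq⟩ := hsurj (φ ∘ₗ j)
  obtain ⟨r, rfl⟩ := Ideal.Quotient.mk_surjective q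
  refine ⟨r, fun z => ?_⟩
  rw [← hB, hq, hdesc φ hφ]

theorem top_functional_mul {ω : MvPolynomial (Fin n) k →ₗ[k] k} {N : ℕ}
    (hω : ∀ f, ω f = ω (homogeneousComponent N f)) {f : MvPolynomial (Fin n) k} {a b : ℕ}
    (hf : f.IsHomogeneous a) (hab : a + b = N) (r : MvPolynomial (Fin n) k) :
    ω (f * r) = ω (f * homogeneousComponent b r) := by
  rw [hω, ← hab, homogeneousComponent_add_mul hf]

variable [Infinite k] {D : ℕ} {g : Fin n → MvPolynomial (Fin n) k}
    [Module.Finite k (MvPolynomial (Fin n) k ⧸ Ideal.span (Set.range g))]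

theorem exists_top_functional (hg : ∀ i, (g i).IsHomogeneous (D + 1)) :
    ∃ ω : MvPolynomial (Fin n) k →ₗ[k] k, (∀ f ∈ Ideal.span (Set.range g), ω f = 0) ∧
      (∀ f, ω f = ω (homogeneousComponent (n * D) f)) ∧
      ∀ f, f.IsHomogeneous (n * D) → f ∉ Ideal.span (Set.range g) → ω f ≠ 0 := by
  have hI : IsGradedIdeal (Ideal.span (Set.range g)) :=
    isGradedIdeal_span (by rintro _ ⟨i, rfl⟩; exact ⟨_, hg i⟩)
  obtain ⟨c, hc, hcI⟩ := exists_monomial_mul_notMem hg (isHomogeneous_one _ _)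
    (one_notMem_span hg)
  rw [one_mul] at hcI
  obtain ⟨φ, hφ, hle⟩ := Submodule.exists_le_ker_of_notMem
    (p := (Ideal.span (Set.range g)).restrictScalars k) hcI
  refine ⟨φ ∘ₗ homogeneousComponent (n * D), fun f hf => hle (hI f hf _), fun f => ?_,
    fun f hf hfI h0 => ?_⟩
  · simp only [LinearMap.comp_apply]
    rw [homogeneousComponent_eq_self (homogeneousComponent_isHomogeneous _ f)]
  · rw [LinearMap.comp_apply, homogeneousComponent_eq_self hf] at h0
    obtain ⟨a, ha⟩ := exists_smul_add_smul_mem hg (isHomogeneous_monomial (R := k) 1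
      (show c.degree = n * D by omega)) hf hfI
    have := hle ha
    rw [LinearMap.mem_ker, map_sub, map_smul, h0, smul_zero, sub_zero] at this
    exact hφ this

theorem mem_of_mul_mem_of_degree_lt (hg : ∀ i, (g i).IsHomogeneous (D + 1))
    (A : Finset (Fin n)) {r : MvPolynomial (Fin n) k} {e : ℕ} (hr : r.IsHomogeneous e)
    (hAr : ∀ i ∈ A, X i * r ∈ Ideal.span (Set.range g)) (he : e < A.card * D) :
    r ∈ Ideal.span (Set.range g) := by
  obtain ⟨σ, hσ⟩ := exists_perm_lt_card_iff A
  obtain ⟨h, H⟩ := exists_isAdaptedFlag g hg σ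
  obtain ⟨s, -, h3, h4⟩ := H.exists_exchange (ι := Unit) (m := n - A.card) (a := A.card)
    (Nat.sub_add_cancel (card_finset_fin_le A))
    (fun _ => r) (fun _ => hr) (fun _ i hi => hAr i ((hσ i).mp hi))
  have hiff := h4 {()} 1
  simp only [Pi.one_apply, one_mul, Finset.sum_singleton] at hiff
  rw [hiff, h3 he]
  exact Ideal.zero_mem _

theorem exists_top_functional_mul_ne_zero (hg : ∀ i, (g i).IsHomogeneous (D + 1))
    {ω : MvPolynomial (Fin n) k →ₗ[k] k}
    (hωc : ∀ f, ω f = ω (homogeneousComponent (n * D) f))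
    (hω : ∀ f, f.IsHomogeneous (n * D) → f ∉ Ideal.span (Set.range g) → ω f ≠ 0)
    {z : MvPolynomial (Fin n) k} (hz : z ∉ Ideal.span (Set.range g)) :
    ∃ r, ω (r * z) ≠ 0 := by
  obtain ⟨m, hm⟩ : ∃ m, homogeneousComponent m z ∉ Ideal.span (Set.range g) := by
    by_contra! h
    exact hz (IsGradedIdeal.mem_of_components h)
  have hmh := homogeneousComponent_isHomogeneous m z
  obtain ⟨c, hc, hcI⟩ := exists_monomial_mul_notMem hg hmh hm
  have hch : (monomial c (1 : k)).IsHomogeneous c.degree := isHomogeneous_monomial _ rfl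
  refine ⟨monomial c 1, ?_⟩
  rw [top_functional_mul hωc hch ((add_comm _ _).trans hc), mul_comm]
  exact hω _ (hc ▸ hmh.mul hch) hcI

theorem mem_sup_span_X_of_degree_lt (hg : ∀ i, (g i).IsHomogeneous (D + 1))
    (A : Finset (Fin n)) {z : MvPolynomial (Fin n) k} {l : ℕ} (hz : z.IsHomogeneous l)
    (hl : (n - A.card) * D < l) :
    z ∈ Ideal.span (Set.range g) ⊔ Ideal.span (X '' (A : Set (Fin n))) := by
  by_contra hzK
  have hzI : z ∉ Ideal.span (Set.range g) := fun h => hzK (Ideal.mem_sup_left h)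
  obtain ⟨c, hc, -⟩ := exists_monomial_mul_notMem hg hz hzI
  obtain ⟨ω, hω, hωc, hωne⟩ := exists_top_functional hg
  obtain ⟨φ, hφ, hle⟩ := Submodule.exists_le_ker_of_notMem
    (p := (Ideal.span (Set.range g) ⊔ Ideal.span (X '' (A : Set (Fin n)))).restrictScalars k) hzK
  obtain ⟨r, hr⟩ := exists_eq_mul_of_nondegenerate ω hω (fun y hy =>
    exists_top_functional_mul_ne_zero hg hωc hωne hy) φ fun f hf => hle (Ideal.mem_sup_left hf)
  have hrj := homogeneousComponent_isHomogeneous c.degree r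
  have hrI : homogeneousComponent c.degree r ∈ Ideal.span (Set.range g) := by
    refine mem_of_mul_mem_of_degree_lt hg A hrj (fun i hi => ?_) ?_
    · by_contra hiI
      have hXr := (isHomogeneous_X k i).mul hrj
      obtain ⟨b, hb, hbI⟩ := exists_monomial_mul_notMem hg hXr hiI
      have hbh : (monomial b (1 : k)).IsHomogeneous b.degree := isHomogeneous_monomial _ rfl
      refine hωne _ (hb ▸ hXr.mul hbh) hbI ?_
      have hXb := (isHomogeneous_X k i).mul hbh
      rw [mul_right_comm, ← top_functional_mul hωc hXb (by omega), mul_comm, ← hr]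
      refine hle (Ideal.mem_sup_right (Ideal.mul_mem_right _ _ (Ideal.subset_span ?_)))
      exact ⟨i, hi, rfl⟩
    · have hsum : (n - A.card) * D + A.card * D = n * D := by
        rw [← add_mul, Nat.sub_add_cancel (card_finset_fin_le A)]
      omega
  apply hφ
  rw [hr, mul_comm, top_functional_mul hωc hz hc]
  exact hω _ (Ideal.mul_mem_left _ _ hrI)

end Pairing

section Raise

variable {k : Type*} [Field k] {n : ℕ}

theorem degree_filter_add_degree_filter_not (A : Finset (Fin n)) (c : Fin n →₀ ℕ) :
    (c.filter (· ∈ A)).degree + (c.filter (· ∉ A)).degree = c.degree := by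
  rw [← map_add, Finsupp.filter_add_filter_not]

theorem degree_filter_mem (A : Finset (Fin n)) (c : Fin n →₀ ℕ) :
    (c.filter (· ∈ A)).degree = ∑ i ∈ A, c i := by
  rw [Finsupp.degree_eq_sum]
  simp [Finsupp.filter_apply]

variable [Infinite k] {D : ℕ} {g : Fin n → MvPolynomial (Fin n) k}
    [Module.Finite k (MvPolynomial (Fin n) k ⧸ Ideal.span (Set.range g))]

theorem exists_monomial_raise (hg : ∀ i, (g i).IsHomogeneous (D + 1)) (A : Finset (Fin n))
    (p : MvPolynomial (Fin n) k) {c : Fin n →₀ ℕ}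
    (hc : p * monomial c 1 ∉ Ideal.span (Set.range g))
    (hdeg : (n - A.card) * D + ∑ i ∈ A, c i < c.degree) :
    ∃ c' : Fin n →₀ ℕ, p * monomial c' 1 ∉ Ideal.span (Set.range g) ∧ c'.degree = c.degree ∧
      (∀ i ∈ A, c i ≤ c' i) ∧ ∃ i ∈ A, c i < c' i := by
  have hI : IsGradedIdeal (Ideal.span (Set.range g)) :=
    isGradedIdeal_span (by rintro _ ⟨i, rfl⟩; exact ⟨_, hg i⟩)
  have ha : IsGradedIdeal (Ideal.span (X '' (A : Set (Fin n)) : Set (MvPolynomial (Fin n) k))) :=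
    isGradedIdeal_span (by rintro _ ⟨i, _, rfl⟩; exact ⟨_, isHomogeneous_X _ _⟩)
  have hsplit := degree_filter_add_degree_filter_not A c
  rw [degree_filter_mem] at hsplit
  have hy : (monomial (c.filter (· ∉ A)) (1 : k)).IsHomogeneous (c.filter (· ∉ A)).degree :=
    isHomogeneous_monomial _ rfl
  obtain ⟨p₁, hp₁, q, hq, hpq⟩ := Submodule.mem_sup.mp
    (mem_sup_span_X_of_degree_lt hg A hy (by omega))
  set l := (c.filter (· ∉ A)).degree
  have hcomp : homogeneousComponent l p₁ + homogeneousComponent l q =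
      monomial (c.filter (· ∉ A)) 1 := by
    rw [← map_add, hpq, homogeneousComponent_eq_self hy]
  have hmul : p * monomial c 1 = p * monomial (c.filter (· ∈ A)) 1 * homogeneousComponent l p₁ +
      p * monomial (c.filter (· ∈ A)) 1 * homogeneousComponent l q := by
    rw [← mul_add, hcomp, mul_assoc, monomial_mul, one_mul, Finsupp.filter_add_filter_not]
  have hq' : p * monomial (c.filter (· ∈ A)) 1 * homogeneousComponent l q ∉
      Ideal.span (Set.range g) := fun h =>
    hc (hmul ▸ Ideal.add_mem _ (Ideal.mul_mem_left _ _ (hI _ hp₁ l)) h)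
  obtain ⟨b, hb, hbI⟩ : ∃ b ∈ (homogeneousComponent l q).support,
      p * monomial (c.filter (· ∈ A) + b) 1 ∉ Ideal.span (Set.range g) := by
    by_contra! h
    apply hq'
    rw [← support_sum_monomial_coeff (homogeneousComponent l q), Finset.mul_sum]
    refine Ideal.sum_mem _ fun b hb => ?_
    convert Ideal.mul_mem_left _ (C (coeff b (homogeneousComponent l q))) (h b hb) using 1
    rw [mul_assoc, mul_left_comm (C _), C_mul_monomial, monomial_mul, one_mul, mul_one]
  obtain ⟨i, hi, hbi⟩ := mem_ideal_span_X_image.mp (ha _ hq l) b hb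
  have hbdeg : b.degree = l := by
    by_contra hne
    exact mem_support_iff.mp hb
      ((homogeneousComponent_isHomogeneous l q).coeff_eq_zero hne)
  refine ⟨_, hbI, ?_, fun j hj => ?_, i, hi, ?_⟩
  · rw [map_add, degree_filter_mem]
    omega
  · simp [hj]
  · have hi' : i ∈ A := hi
    simp [hi']
    omega

theorem exists_monomial_le_sum (hg : ∀ i, (g i).IsHomogeneous (D + 1)) (A : Finset (Fin n))
    (p : MvPolynomial (Fin n) k) (t : ℕ) {c : Fin n →₀ ℕ}
    (hc : p * monomial c 1 ∉ Ideal.span (Set.range g)) (hdeg : (n - A.card) * D + t ≤ c.degree) :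
    ∃ c' : Fin n →₀ ℕ, p * monomial c' 1 ∉ Ideal.span (Set.range g) ∧ c'.degree = c.degree ∧
      t ≤ ∑ i ∈ A, c' i := by
  induction t with
  | zero => exact ⟨c, hc, rfl, Nat.zero_le _⟩
  | succ t ih =>
    obtain ⟨c', h1, h2, h3⟩ := ih (by omega)
    rcases Nat.lt_or_ge t (∑ i ∈ A, c' i) with hlt | hge
    · exact ⟨c', h1, h2, hlt⟩
    · obtain ⟨c'', h4, h5, h6, h7⟩ := exists_monomial_raise hg A p h1 (by omega)
      exact ⟨c'', h4, h5.trans h2, h3.trans_lt (Finset.sum_lt_sum h6 h7)⟩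

end Raise

section Threshold

variable {n : ℕ}

theorem sum_mul_pow_lt_sum_mul_pow {A : Finset (Fin n)} {c c' W : Fin n → ℕ} {B T : ℕ}
    (hle : ∀ i ∈ A, c i ≤ c' i) {j : Fin n} (hj : j ∈ A) (hlt : c j < c' j)
    (hWA : ∀ i ∈ A, T ≤ W i) (hWn : ∀ i, i ∉ A → W i < T) (hB : ∑ i, c i < B) :
    ∑ i, c i * B ^ W i < ∑ i, c' i * B ^ W i := by
  have hB0 : 0 < B := by omega
  rw [← Finset.sum_add_sum_compl A, ← Finset.sum_add_sum_compl A fun i => c' i * B ^ W i]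
  have h1 : ∑ i ∈ A, c i * B ^ W i + B ^ W j ≤ ∑ i ∈ A, c' i * B ^ W i := by
    rw [← Finset.add_sum_erase A _ hj, ← Finset.add_sum_erase A (fun i => c' i * B ^ W i) hj]
    have h2 : ∑ i ∈ A.erase j, c i * B ^ W i ≤ ∑ i ∈ A.erase j, c' i * B ^ W i :=
      Finset.sum_le_sum fun i hi => Nat.mul_le_mul_right _ (hle i (Finset.mem_of_mem_erase hi))
    have h3 : (c j + 1) * B ^ W j ≤ c' j * B ^ W j := Nat.mul_le_mul_right _ hlt
    rw [add_mul, one_mul] at h3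
    omega
  have h2 : ∑ i ∈ Aᶜ, c i * B ^ W i < B ^ T := by
    cases T with
    | zero =>
      rw [Finset.sum_eq_zero]
      · simp
      · intro i hi
        exact absurd (hWn i (Finset.mem_compl.mp hi)) (by omega)
    | succ T =>
      calc ∑ i ∈ Aᶜ, c i * B ^ W i ≤ ∑ i ∈ Aᶜ, c i * B ^ T :=
            Finset.sum_le_sum fun i hi => Nat.mul_le_mul_left _
              (Nat.pow_le_pow_right hB0 (Nat.le_of_lt_succ (hWn i (Finset.mem_compl.mp hi))))
        _ = (∑ i ∈ Aᶜ, c i) * B ^ T := by rw [Finset.sum_mul]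
        _ ≤ (∑ i, c i) * B ^ T :=
            Nat.mul_le_mul_right _ (Finset.sum_le_sum_of_subset (Finset.subset_univ _))
        _ < B * B ^ T := Nat.mul_lt_mul_of_pos_right hB (pow_pos hB0 _)
        _ = B ^ (T + 1) := by ring
  have h3 : B ^ T ≤ B ^ W j := Nat.pow_le_pow_right hB0 (hWA j hj)
  omega

theorem sum_filter_eq_zero_of_sum_mul_nonpos {w e : Fin n → ℤ} {a b : ℤ} (hab : a < b)
    (ha : ∀ i, a ≤ w i) (hb : ∀ i, w i ≤ b) (he : ∑ i, e i = 0)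
    (hpos : ∀ t, 0 ≤ ∑ i with t ≤ w i, e i) (hneg : ∑ i, w i * e i ≤ 0) :
    ∑ i with b ≤ w i, e i = 0 := by
  have hlayer : ∀ i, w i = a + ∑ t ∈ Finset.Ioc a b, if t ≤ w i then 1 else 0 := by
    intro i
    have : (Finset.Ioc a b).filter (· ≤ w i) = Finset.Ioc a (w i) := by
      ext t
      simp only [Finset.mem_filter, Finset.mem_Ioc]
      have := hb i
      omega
    rw [Finset.sum_boole, this, Int.card_Ioc]
    have := ha i
    simp
    omega
  have hsum : ∑ i, w i * e i = ∑ t ∈ Finset.Ioc a b, ∑ i with t ≤ w i, e i := by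
    calc ∑ i, w i * e i = ∑ i, (a * e i + ∑ t ∈ Finset.Ioc a b, if t ≤ w i then e i else 0) := by
          refine Finset.sum_congr rfl fun i _ => ?_
          conv_lhs => rw [hlayer i]
          rw [add_mul, Finset.sum_mul]
          simp only [ite_mul, one_mul, zero_mul]
      _ = _ := by
          rw [Finset.sum_add_distrib, ← Finset.mul_sum, he, mul_zero, zero_add, Finset.sum_comm]
          simp only [Finset.sum_filter]
  rw [hsum] at hneg
  have h0 := le_antisymm hneg (Finset.sum_nonneg fun t _ => hpos t)
  exact (Finset.sum_eq_zero_iff_of_nonneg fun t _ => hpos t).mp h0 b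
    (Finset.mem_Ioc.mpr ⟨hab, le_rfl⟩)

variable {k : Type*} [Field k] [Infinite k] {D : ℕ} {g : Fin n → MvPolynomial (Fin n) k}
    [Module.Finite k (MvPolynomial (Fin n) k ⧸ Ideal.span (Set.range g))]

theorem exists_monomial_forall_card_mul_le (hg : ∀ i, (g i).IsHomogeneous (D + 1))
    (w : Fin n → ℤ) (b : ℤ) {c : Fin n →₀ ℕ} (hc : c.degree = n * D)
    (hcI : monomial c 1 ∉ Ideal.span (Set.range g)) :
    ∃ c' : Fin n →₀ ℕ, c'.degree = n * D ∧ monomial c' 1 ∉ Ideal.span (Set.range g) ∧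
      ∑ i with b ≤ w i, c i ≤ ∑ i with b ≤ w i, c' i ∧
      ∀ t ≤ b, ({i | t ≤ w i} : Finset (Fin n)).card * D ≤ ∑ i with t ≤ w i, c' i := by
  classical
  rcases isEmpty_or_nonempty (Fin n) with hn | hn
  · exact ⟨c, hc, hcI, le_rfl, fun t _ => by simp [Finset.eq_empty_of_isEmpty]⟩
  obtain ⟨i₀, hi₀⟩ := Finite.exists_min w
  let W : Fin n → ℕ := fun i => (w i - w i₀).toNat
  let P : (Fin n →₀ ℕ) → Prop := fun c' => monomial c' 1 ∉ Ideal.span (Set.range g) ∧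
    ∑ i with b ≤ w i, c i ≤ ∑ i with b ≤ w i, c' i
  let s := (Finset.univ.finsuppAntidiag (n * D) : Finset (Fin n →₀ ℕ)).filter P
  have hs : ∀ c', c' ∈ s ↔ c'.degree = n * D ∧ P c' := by
    intro c'
    simp [s, Finset.mem_finsuppAntidiag, Finsupp.degree_eq_sum]
  obtain ⟨c', hc', hmax⟩ := Finset.exists_max_image s
    (fun c' => ∑ i, c' i * (n * D + 1) ^ W i) ⟨c, (hs c).mpr ⟨hc, hcI, le_rfl⟩⟩
  obtain ⟨hdeg, hI, hle⟩ := (hs c').mp hc'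
  refine ⟨c', hdeg, hI, hle, fun t ht => ?_⟩
  by_contra! hlt
  have hcard : (n - ({i | t ≤ w i} : Finset (Fin n)).card) * D +
      ({i | t ≤ w i} : Finset (Fin n)).card * D = n * D := by
    rw [← add_mul, Nat.sub_add_cancel (card_finset_fin_le _)]
  obtain ⟨c'', h1, h2, h3, j, hj, hjlt⟩ := exists_monomial_raise hg {i | t ≤ w i} 1
    (c := c') (by simpa using hI) (by omega)
  rw [one_mul] at h1
  have hbig := sum_mul_pow_lt_sum_mul_pow (W := W) (B := n * D + 1) (T := (t - w i₀).toNat)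
    h3 hj hjlt (fun i hi => by
      have := (Finset.mem_filter.mp hi).2
      simp only [W]
      omega) (fun i hi => by
      have h4 : ¬ t ≤ w i := fun h => hi (Finset.mem_filter.mpr ⟨Finset.mem_univ i, h⟩)
      have h5 := hi₀ i
      simp only [W]
      omega) (by rw [← Finsupp.degree_eq_sum]; omega)
  refine absurd (hmax c'' ((hs c'').mpr ⟨h2.trans hdeg, h1, hle.trans ?_⟩)) (not_le.mpr hbig)
  refine Finset.sum_le_sum fun i hi => h3 i ?_
  have := (Finset.mem_filter.mp hi).2
  exact Finset.mem_filter.mpr ⟨Finset.mem_univ i, ht.trans this⟩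

theorem exists_subset_forall_sum_le (hg : ∀ i, (g i).IsHomogeneous (D + 1))
    {w : Fin n → ℤ} (hw : w ≠ 0) (hsum : ∑ i, w i = 0)
    (hneg : ∀ c : Fin n →₀ ℕ, c.degree = n * D → monomial c 1 ∉ Ideal.span (Set.range g) →
      ∑ i, w i * (c i : ℤ) ≤ 0) :
    ∃ A : Finset (Fin n), 1 ≤ A.card ∧ A.card < n ∧
      ∀ c : Fin n →₀ ℕ, c.degree = n * D → monomial c 1 ∉ Ideal.span (Set.range g) →
        ∑ i ∈ A, c i ≤ A.card * D := by
  obtain ⟨i, hi⟩ := Function.ne_iff.mp hw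
  have : Nonempty (Fin n) := ⟨i⟩
  obtain ⟨i₀, hi₀⟩ := Finite.exists_min w
  obtain ⟨i₁, hi₁⟩ := Finite.exists_max w
  have hlt : w i₀ < w i₁ := by
    by_contra! hle
    have hconst : ∀ j, w j = w i := fun j =>
      le_antisymm (((hi₁ j).trans hle).trans (hi₀ i)) (((hi₁ i).trans hle).trans (hi₀ j))
    simp only [hconst, Finset.sum_const, Finset.card_univ, Fintype.card_fin, nsmul_eq_mul,
      mul_eq_zero, Nat.cast_eq_zero] at hsum
    rcases hsum with h | h
    · exact absurd i.2 (by omega)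
    · exact hi h
  refine ⟨({i | w i₁ ≤ w i} : Finset (Fin n)), Finset.card_pos.mpr ⟨i₁, by simp⟩, ?_,
    fun c hc hcI => ?_⟩
  · have : ({i | w i₁ ≤ w i} : Finset (Fin n)) ⊂ Finset.univ :=
      Finset.ssubset_univ_iff.mpr fun h => by
        have := h ▸ Finset.mem_univ i₀
        simp at this
        omega
    simpa using Finset.card_lt_card this
  · obtain ⟨c', h1, h2, h3, h4⟩ := exists_monomial_forall_card_mul_le hg w (w i₁) hc hcI
    refine h3.trans (le_of_eq ?_)
    have hS : ∀ t, ∑ i with t ≤ w i, ((c' i : ℤ) - D) =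
        (∑ i with t ≤ w i, c' i : ℕ) - ((({i | t ≤ w i} : Finset (Fin n)).card * D : ℕ) : ℤ) := by
      intro t
      rw [Finset.sum_sub_distrib, Finset.sum_const, nsmul_eq_mul]
      push_cast
      rfl
    have h5 := sum_filter_eq_zero_of_sum_mul_nonpos (w := w) (e := fun i => (c' i : ℤ) - D) hlt
      hi₀ hi₁ (by
        rw [Finset.sum_sub_distrib, Finset.sum_const, ← Nat.cast_sum, ← Finsupp.degree_eq_sum, h1]
        simp) (fun t => by
        rcases le_or_gt t (w i₁) with ht | ht
        · rw [hS, sub_nonneg]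
          exact_mod_cast h4 t ht
        · rw [Finset.filter_false_of_mem, Finset.sum_empty]
          intro j _ hj
          have := hi₁ j
          omega) (by
        simp only [mul_sub, Finset.sum_sub_distrib, ← Finset.sum_mul, hsum, zero_mul, sub_zero]
        exact hneg c' h1 h2)
    rw [hS, sub_eq_zero] at h5
    exact_mod_cast h5

end Threshold

section Splitting

variable {σ k : Type*} [Field k]

theorem homogeneousComponent_mem_span {s : Set (MvPolynomial σ k)} {d : ℕ}
    (hs : ∀ f ∈ s, f.IsHomogeneous d) {f : MvPolynomial σ k} (hf : f ∈ Ideal.span s) :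
    homogeneousComponent d f ∈ Submodule.span k s := by
  have key : ∀ a, homogeneousComponent d (a * f) ∈ Submodule.span k s := by
    induction hf using Submodule.span_induction with
    | mem x hx =>
      intro a
      have := homogeneousComponent_add_mul (hs x hx) a 0
      rw [add_zero, homogeneousComponent_zero, mul_comm x, mul_comm x, ← smul_eq_C_mul] at this
      rw [this]
      exact Submodule.smul_mem _ _ (Submodule.subset_span hx)
    | zero => simp
    | add x y _ _ hx hy => intro a; rw [mul_add, map_add]; exact Submodule.add_mem _ (hx a) (hy a)
    | smul b x _ hx => intro a; rw [smul_eq_mul, ← mul_assoc]; exact hx _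
  simpa using key 1

theorem exists_mem_span_sub_mem {s t : Set (MvPolynomial σ k)} {d : ℕ}
    (hs : ∀ f ∈ s, f.IsHomogeneous d) (ht : IsGradedIdeal (Ideal.span t)) {u : MvPolynomial σ k}
    (hu : u.IsHomogeneous d) (hmem : u ∈ Ideal.span (s ∪ t)) :
    ∃ z ∈ Submodule.span k s, u - z ∈ Ideal.span t := by
  rw [Ideal.span_union] at hmem
  obtain ⟨p, hp, q, hq, hpq⟩ := Submodule.mem_sup.mp hmem
  refine ⟨_, homogeneousComponent_mem_span hs hp, ?_⟩
  convert ht q hq d using 1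
  rw [sub_eq_iff_eq_add, add_comm, ← map_add, hpq, homogeneousComponent_eq_self hu]

theorem mem_span_right_of_degree_lt {s t : Set (MvPolynomial σ k)} {d e : ℕ}
    (hs : ∀ f ∈ s, f.IsHomogeneous d) (ht : IsGradedIdeal (Ideal.span t)) {u : MvPolynomial σ k}
    (hu : u.IsHomogeneous e) (he : e < d) (hmem : u ∈ Ideal.span (s ∪ t)) : u ∈ Ideal.span t := by
  rw [Ideal.span_union] at hmem
  obtain ⟨p, hp, q, hq, hpq⟩ := Submodule.mem_sup.mp hmem
  have hp0 : homogeneousComponent e p = 0 :=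
    homogeneous_mem_span_of_lt hs (isGradedIdeal_span (fun f hf => ⟨d, hs f hf⟩) p hp e)
      (homogeneousComponent_isHomogeneous e p) he
  have := ht q hq e
  rwa [← zero_add (homogeneousComponent e q), ← hp0, ← map_add, hpq,
    homogeneousComponent_eq_self hu] at this

end Splitting

section ExtremalSubset

variable {k : Type*} [Field k] [Infinite k] {n D : ℕ} {g : Fin n → MvPolynomial (Fin n) k}
    [Module.Finite k (MvPolynomial (Fin n) k ⧸ Ideal.span (Set.range g))] {A : Finset (Fin n)}

theorem monomial_mem_of_lt_sum (hg : ∀ i, (g i).IsHomogeneous (D + 1))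
    (hA : ∀ c : Fin n →₀ ℕ, c.degree = n * D → monomial c 1 ∉ Ideal.span (Set.range g) →
      ∑ i ∈ A, c i ≤ A.card * D)
    {c : Fin n →₀ ℕ} (hc : A.card * D < ∑ i ∈ A, c i) :
    monomial c 1 ∈ Ideal.span (Set.range g) := by
  by_contra h
  obtain ⟨c', hdeg, hI⟩ := exists_monomial_mul_notMem hg
    (isHomogeneous_monomial (R := k) 1 (rfl : c.degree = c.degree)) h
  rw [monomial_mul, one_mul] at hI
  have := hA (c + c') (by rw [map_add, hdeg]) hI
  simp only [Finsupp.add_apply, Finset.sum_add_distrib] at this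
  omega

theorem exists_monomial_mul_notMem_of_supported (hg : ∀ i, (g i).IsHomogeneous (D + 1))
    (hA : ∀ c : Fin n →₀ ℕ, c.degree = n * D → monomial c 1 ∉ Ideal.span (Set.range g) →
      ∑ i ∈ A, c i ≤ A.card * D)
    {p : MvPolynomial (Fin n) k} {e : ℕ} (hp : p.IsHomogeneous e)
    (hpA : ∀ c ∈ p.support, ∀ i, i ∉ A → c i = 0) (hpI : p ∉ Ideal.span (Set.range g))
    (he : e ≤ A.card * D) :
    ∃ b : Fin n →₀ ℕ, b.degree + e = A.card * D ∧ (∀ i, i ∉ A → b i = 0) ∧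
      p * monomial b 1 ∉ Ideal.span (Set.range g) := by
  obtain ⟨c, hc, hcI⟩ := exists_monomial_mul_notMem hg hp hpI
  have hcard : (n - A.card) * D + A.card * D = n * D := by
    rw [← add_mul, Nat.sub_add_cancel (card_finset_fin_le _)]
  obtain ⟨c', h1, h2, h3⟩ := exists_monomial_le_sum hg A p (A.card * D - e) hcI (by omega)
  have hle : ∑ i ∈ A, c' i ≤ A.card * D - e := by
    by_contra! hlt
    apply h1
    rw [← support_sum_monomial_coeff p, Finset.sum_mul]
    refine Ideal.sum_mem _ fun q hq => ?_
    have hqe : ∑ i ∈ A, q i = e := by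
      have hqd : q.degree = e := by
        by_contra hne
        exact mem_support_iff.mp hq (hp.coeff_eq_zero hne)
      rw [← hqd, Finsupp.degree_eq_sum]
      exact Finset.sum_subset (Finset.subset_univ _) fun i _ hi => hpA q hq i hi
    have : monomial (q + c') 1 ∈ Ideal.span (Set.range g) := monomial_mem_of_lt_sum hg hA (by
      simp only [Finsupp.add_apply, Finset.sum_add_distrib]
      omega)
    convert Ideal.mul_mem_left _ (C (coeff q p)) this using 1
    rw [monomial_mul, C_mul_monomial]
  refine ⟨c'.filter (· ∈ A), ?_, fun i hi => by simp [hi], fun h => h1 ?_⟩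
  · rw [degree_filter_mem]
    omega
  · convert Ideal.mul_mem_right (monomial (c'.filter (· ∉ A)) 1) _ h using 1
    rw [mul_assoc, monomial_mul, one_mul, Finsupp.filter_add_filter_not]

theorem X_mul_mem_of_supported (hg : ∀ i, (g i).IsHomogeneous (D + 1))
    (hA : ∀ c : Fin n →₀ ℕ, c.degree = n * D → monomial c 1 ∉ Ideal.span (Set.range g) →
      ∑ i ∈ A, c i ≤ A.card * D)
    {f : MvPolynomial (Fin n) k} (hf : ∀ c ∈ f.support, ∑ i ∈ A, c i = A.card * D) {i : Fin n}
    (hi : i ∈ A) : X i * f ∈ Ideal.span (Set.range g) := by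
  rw [← support_sum_monomial_coeff f, Finset.mul_sum]
  refine Ideal.sum_mem _ fun c hc => ?_
  have : monomial (Finsupp.single i 1 + c) 1 ∈ Ideal.span (Set.range g) :=
    monomial_mem_of_lt_sum hg hA (by
      simp only [Finsupp.add_apply, Finset.sum_add_distrib, hf c hc]
      have : ∑ j ∈ A, (Finsupp.single i 1 : Fin n →₀ ℕ) j = 1 := by
        simp [Finsupp.single_apply, hi]
      omega)
  convert Ideal.mul_mem_left _ (C (coeff c f)) this using 1
  rw [X, monomial_mul, C_mul_monomial, one_mul, mul_one]

theorem IsAdaptedFlag.le_flagIdeal {σ : Equiv.Perm (Fin n)} {h : ℕ → MvPolynomial (Fin n) k}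
    (H : IsAdaptedFlag g σ D h) (hσ : ∀ i, (σ.symm i : ℕ) < A.card ↔ i ∈ A)
    (hA : ∀ c : Fin n →₀ ℕ, c.degree = n * D → monomial c 1 ∉ Ideal.span (Set.range g) →
      ∑ i ∈ A, c i ≤ A.card * D)
    (hg : ∀ i, (g i).IsHomogeneous (D + 1)) :
    Ideal.span (Set.range g) ≤ flagIdeal (permVar k σ) h (n - A.card) A.card := by
  obtain ⟨b, hb, hbA, hbI⟩ := exists_monomial_mul_notMem_of_supported hg hA
    (isHomogeneous_one _ _) (by
      intro c hc i _
      have : c = 0 := by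
        by_contra hne
        exact mem_support_iff.mp hc (by rw [coeff_one, if_neg (Ne.symm hne)])
      simp [this]) (one_notMem_span hg) (Nat.zero_le _)
  rw [one_mul] at hbI
  obtain ⟨s, h2, -, h4⟩ := H.exists_exchange (ι := Unit) (m := n - A.card) (a := A.card)
    (Nat.sub_add_cancel (card_finset_fin_le A)) (e := A.card * D)
    (fun _ => monomial b 1) (fun _ => isHomogeneous_monomial _ hb)
    (fun _ i hi => X_mul_mem_of_supported hg hA (fun c hc => by
      obtain rfl := Finset.mem_singleton.mp (support_monomial_subset hc)
      rw [← hb, add_zero, Finsupp.degree_eq_sum]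
      exact Finset.sum_subset (Finset.subset_univ _) fun i _ hi => hbA i hi) ((hσ i).mp hi))
  have hconst : s () = C (coeff 0 (s ())) := by
    have := h2 () 0 (zero_add _)
    rw [← totalDegree_zero_iff_isHomogeneous] at this
    exact totalDegree_eq_zero_iff_eq_C.mp this
  have hne : coeff 0 (s ()) ≠ 0 := by
    intro h0
    apply hbI
    have := h4 {()} 1
    simp only [Pi.one_apply, one_mul, Finset.sum_singleton] at this
    rw [this, hconst, h0, C_0]
    exact Ideal.zero_mem _
  intro u hu
  have := h4 {()} fun _ => u
  simp only [Finset.sum_singleton] at this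
  have hus := Ideal.mul_mem_right (C (coeff 0 (s ()))⁻¹) _
    (this.mp (Ideal.mul_mem_right _ _ hu))
  rwa [hconst, mul_assoc, coeff_C, if_pos rfl, ← C_mul, mul_inv_cancel₀ hne, C_1, mul_one] at hus

end ExtremalSubset

section VariableSplitting

variable {k : Type*} [Field k] {n : ℕ} {A : Finset (Fin n)}

theorem flagIdeal_permVar_eq {σ : Equiv.Perm (Fin n)}
    (hσ : ∀ i, (σ.symm i : ℕ) < A.card ↔ i ∈ A) (h : ℕ → MvPolynomial (Fin n) k) (m : ℕ) :
    flagIdeal (permVar k σ) h m A.card = Ideal.span (h '' Set.Iio m ∪ X '' (A : Set (Fin n))) := by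
  rw [flagIdeal, permVar_image_Iio σ (card_finset_fin_le A)]
  simp [hσ]

theorem isGradedIdeal_span_X (s : Set (Fin n)) :
    IsGradedIdeal (Ideal.span (X '' s : Set (MvPolynomial (Fin n) k))) :=
  isGradedIdeal_span (by rintro _ ⟨i, -, rfl⟩; exact ⟨1, isHomogeneous_X _ _⟩)

theorem sum_eq_degree_of_supported {c : Fin n →₀ ℕ} (hc : ∀ i, i ∉ A → c i = 0) :
    ∑ i ∈ A, c i = c.degree := by
  rw [Finsupp.degree_eq_sum]
  exact Finset.sum_subset (Finset.subset_univ _) fun i _ hi => hc i hi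

variable [Infinite k] {D : ℕ} {g : Fin n → MvPolynomial (Fin n) k}
    [Module.Finite k (MvPolynomial (Fin n) k ⧸ Ideal.span (Set.range g))]

theorem IsAdaptedFlag.eq_zero_of_mem_span_X {σ : Equiv.Perm (Fin n)}
    {h : ℕ → MvPolynomial (Fin n) k} (H : IsAdaptedFlag g σ D h)
    (hσ : ∀ i, (σ.symm i : ℕ) < A.card ↔ i ∈ A)
    (hA : ∀ c : Fin n →₀ ℕ, c.degree = n * D → monomial c 1 ∉ Ideal.span (Set.range g) →
      ∑ i ∈ A, c i ≤ A.card * D)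
    (hg : ∀ i, (g i).IsHomogeneous (D + 1)) {u : MvPolynomial (Fin n) k}
    (hu : u.IsHomogeneous (D + 1)) (huI : u ∈ Ideal.span (Set.range g))
    (huA : u ∈ Ideal.span (X '' (A : Set (Fin n)))) {c : Fin n →₀ ℕ} (hc : c ∈ u.support)
    {i : Fin n} (hi : i ∉ A) : c i = 0 := by
  by_contra hci
  have hdeg : ∀ c ∈ u.support,
      ∑ i ∈ A, c i + (c.filter (· ∉ A)).degree = D + 1 := by
    intro c hc
    rw [← degree_filter_mem, ← map_add, Finsupp.filter_add_filter_not]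
    by_contra hne
    exact mem_support_iff.mp hc (hu.coeff_eq_zero hne)
  obtain ⟨c₀, hc₀, hmin⟩ := u.support.exists_min_image (fun c => ∑ i ∈ A, c i) ⟨c, hc⟩
  set e := ∑ i ∈ A, c₀ i with he
  have heD : e ≤ D := by
    have h1 := hmin c hc
    have h2 := hdeg c hc
    have h3 : (c.filter (· ∉ A)) i ≤ (c.filter (· ∉ A)).degree := Finsupp.le_degree i _
    rw [Finsupp.filter_apply_pos (· ∉ A) c hi] at h3
    omega
  obtain ⟨j, hjA, hj⟩ := (mem_ideal_span_X_image.mp huA) c₀ hc₀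
  have hN : e ≤ A.card * D :=
    heD.trans (Nat.le_mul_of_pos_left _ (Finset.card_pos.mpr ⟨j, hjA⟩))
  have he1 : 1 ≤ e := by
    have := Finset.single_le_sum (f := fun i => c₀ i) (fun _ _ => Nat.zero_le _) hjA
    omega
  classical
  set F := u.support.filter fun c => ∑ i ∈ A, c i = e with hF
  let p : (Fin n →₀ ℕ) → MvPolynomial (Fin n) k := fun β =>
    ∑ c ∈ F with c.filter (· ∉ A) = β, monomial (c.filter (· ∈ A)) (coeff c u)
  have hp : ∀ β, (p β).IsHomogeneous e := fun β =>
    IsHomogeneous.sum _ _ _ fun c hc => isHomogeneous_monomial _ (by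
      rw [degree_filter_mem]
      exact (Finset.mem_filter.mp (Finset.mem_filter.mp hc).1).2)
  have hpA : ∀ β, ∀ c ∈ (p β).support, ∀ i, i ∉ A → c i = 0 := by
    intro β c hc i hi
    obtain ⟨c', -, hc'⟩ := Finset.mem_biUnion.mp (support_sum hc)
    obtain rfl := Finset.mem_singleton.mp (support_monomial_subset hc')
    simp [hi]
  have hc₀F : c₀ ∈ F := Finset.mem_filter.mpr ⟨hc₀, rfl⟩
  set β₀ := c₀.filter (· ∉ A) with hβ₀
  have hpI : p β₀ ∉ Ideal.span (Set.range g) := by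
    intro hmem
    have h0 := homogeneous_mem_span_of_lt (d := D + 1) (by rintro _ ⟨i, rfl⟩; exact hg i) hmem
      (hp β₀) (by omega)
    have h1 : coeff (c₀.filter (· ∈ A)) (p β₀) = coeff c₀ u := by
      rw [coeff_sum, Finset.sum_eq_single c₀]
      · rw [coeff_monomial, if_pos rfl]
      · intro c hc hne
        rw [coeff_monomial, if_neg]
        intro heq
        apply hne
        rw [← Finsupp.filter_add_filter_not c (· ∈ A), heq, (Finset.mem_filter.mp hc).2, hβ₀,
          Finsupp.filter_add_filter_not]
      · intro hn
        exact absurd (Finset.mem_filter.mpr ⟨hc₀F, hβ₀.symm⟩) hn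
    rw [h0, coeff_zero] at h1
    exact mem_support_iff.mp hc₀ h1.symm
  obtain ⟨b, hb, hbA, hbI⟩ := exists_monomial_mul_notMem_of_supported hg hA (hp β₀) (hpA β₀) hpI hN
  obtain ⟨s, h2, -, h4⟩ := H.exists_exchange (m := n - A.card) (a := A.card)
    (Nat.sub_add_cancel (card_finset_fin_le A)) (e := A.card * D)
    (fun β => p β * monomial b 1)
    (fun β => by
      rw [← hb, add_comm]
      exact (hp β).mul (isHomogeneous_monomial _ rfl))
    (fun β i hi => X_mul_mem_of_supported hg hA (fun c hc => by
      obtain ⟨q, hq, b', hb', rfl⟩ := Finset.mem_add.mp (support_mul _ _ hc)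
      obtain rfl := Finset.mem_singleton.mp (support_monomial_subset hb')
      have hqe : q.degree = e := by
        by_contra hne
        exact mem_support_iff.mp hq ((hp β).coeff_eq_zero hne)
      rw [sum_eq_degree_of_supported fun i hi => by simp [hpA β q hq i hi, hbA i hi], map_add, hqe,
        ← hb, add_comm]) ((hσ i).mp hi))
  have hconst : ∀ β, s β = C (coeff 0 (s β)) := fun β =>
    totalDegree_eq_zero_iff_eq_C.mp
      ((totalDegree_zero_iff_isHomogeneous _).mpr (h2 β 0 (zero_add _)))
  have hne : coeff 0 (s β₀) ≠ 0 := by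
    intro h0
    apply hbI
    have := h4 {β₀} 1
    simp only [Pi.one_apply, one_mul, Finset.sum_singleton] at this
    rw [this, hconst, h0, C_0]
    exact Ideal.zero_mem _
  set T := F.image fun c => c.filter (· ∉ A) with hT
  have hsum : ∑ β ∈ T, monomial β 1 * (p β * monomial b 1) =
      ∑ c ∈ F, monomial c (coeff c u) * monomial b 1 := by
    rw [← Finset.sum_fiberwise_of_maps_to (s := F) (t := T)
      (fun c hc => Finset.mem_image_of_mem (fun c : Fin n →₀ ℕ => c.filter (· ∉ A)) hc)]
    refine Finset.sum_congr rfl fun β _ => ?_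
    rw [Finset.sum_mul, Finset.mul_sum]
    refine Finset.sum_congr rfl fun c hc => ?_
    rw [← mul_assoc, monomial_mul, one_mul, ← (Finset.mem_filter.mp hc).2, add_comm,
      Finsupp.filter_add_filter_not]
  have hmem : ∑ β ∈ T, monomial β 1 * (p β * monomial b 1) ∈ Ideal.span (Set.range g) := by
    rw [hsum]
    have h5 := Ideal.mul_mem_right (monomial b 1) _ huI
    nth_rw 1 [← support_sum_monomial_coeff u] at h5
    rw [Finset.sum_mul, ← Finset.sum_filter_add_sum_filter_not _ fun c => ∑ i ∈ A, c i = e] at h5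
    refine (Ideal.add_mem_iff_left _ (Ideal.sum_mem _ fun c hc => ?_)).mp h5
    have hlt : e < ∑ i ∈ A, c i :=
      lt_of_le_of_ne (hmin c (Finset.mem_filter.mp hc).1) (Ne.symm (Finset.mem_filter.mp hc).2)
    have : monomial (c + b) 1 ∈ Ideal.span (Set.range g) := monomial_mem_of_lt_sum hg hA (by
      simp only [Finsupp.add_apply, Finset.sum_add_distrib]
      rw [sum_eq_degree_of_supported hbA]
      omega)
    convert Ideal.mul_mem_left _ (C (coeff c u)) this using 1
    rw [monomial_mul, C_mul_monomial]
  rw [h4, flagIdeal_permVar_eq hσ] at hmem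
  have hV : ∑ β ∈ T, monomial β 1 * s β = ∑ β ∈ T, monomial β (coeff 0 (s β)) :=
    Finset.sum_congr rfl fun β _ => by
      nth_rw 1 [hconst β]
      rw [mul_comm, C_mul_monomial, mul_one]
  rw [hV] at hmem
  have hVA := mem_span_right_of_degree_lt (d := D + 1) (e := D + 1 - e)
    (by rintro _ ⟨i, -, rfl⟩; exact H.homogeneous i) (isGradedIdeal_span_X _)
    (IsHomogeneous.sum _ _ _ fun β hβ => isHomogeneous_monomial _ (by
      obtain ⟨c, hc, rfl⟩ := Finset.mem_image.mp hβ
      obtain ⟨hc, hce⟩ := Finset.mem_filter.mp hc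
      have := hdeg c hc
      omega)) (by omega) hmem
  have hβ₀T : β₀ ∈ T := Finset.mem_image.mpr ⟨c₀, hc₀F, rfl⟩
  obtain ⟨i, hiA, hi⟩ := mem_ideal_span_X_image.mp hVA β₀ (by
    rw [mem_support_iff, coeff_sum, Finset.sum_eq_single β₀]
    · rwa [coeff_monomial, if_pos rfl]
    · intro β _ hne
      rw [coeff_monomial, if_neg hne]
    · exact fun hn => absurd hβ₀T hn)
  exact hi (by rw [hβ₀, Finsupp.filter_apply_neg (· ∉ A) c₀ (by simpa using hiA)])

end VariableSplitting

section Decomposition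

variable {k : Type*} [Field k] [Infinite k] {n D : ℕ} {g : Fin n → MvPolynomial (Fin n) k}
    [Module.Finite k (MvPolynomial (Fin n) k ⧸ Ideal.span (Set.range g))] {A : Finset (Fin n)}

theorem decomposable_of_forall_sum_le (hg : ∀ i, (g i).IsHomogeneous (D + 1))
    (hA1 : 1 ≤ A.card) (hAn : A.card < n)
    (hA : ∀ c : Fin n →₀ ℕ, c.degree = n * D → monomial c 1 ∉ Ideal.span (Set.range g) →
      ∑ i ∈ A, c i ≤ A.card * D) : Decomposable g := by
  obtain ⟨σ, hσ⟩ := exists_perm_lt_card_iff A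
  obtain ⟨h, H⟩ := exists_isAdaptedFlag g hg σ
  have hI : ∀ i : Fin n, h i ∈ Ideal.span (Set.range g) := fun i => by
    rw [← ideal_span_eq_of_span_eq H.span_eq]
    exact Ideal.subset_span ⟨i, rfl⟩
  have hle := H.le_flagIdeal hσ hA hg
  rw [flagIdeal_permVar_eq hσ] at hle
  have hz : ∀ i : Fin n, ∃ z ∈ Submodule.span k (h '' Set.Iio (n - A.card)),
      if (i : ℕ) < n - A.card then z = 0 else h i - z ∈ Ideal.span (X '' (A : Set (Fin n))) := by
    intro i
    split_ifs with hi
    · exact ⟨0, Submodule.zero_mem _, rfl⟩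
    · exact exists_mem_span_sub_mem (d := D + 1) (by rintro _ ⟨i, -, rfl⟩; exact H.homogeneous i)
        (isGradedIdeal_span_X _) (H.homogeneous i) (hle (hI i))
  choose z hz hz' using hz
  have hsub : h '' Set.Iio (n - A.card) ⊆ Set.range fun i : Fin n => h i := by
    rintro _ ⟨i, hi, rfl⟩
    exact ⟨⟨i, (Set.mem_Iio.mp hi).trans_le (Nat.sub_le _ _)⟩, rfl⟩
  have hspan : Submodule.span k (Set.range fun i : Fin n => h i - z i) =
      Submodule.span k (Set.range fun i : Fin n => h i) := by
    apply le_antisymm <;> refine Submodule.span_le.mpr ?_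
    · rintro _ ⟨i, rfl⟩
      exact Submodule.sub_mem _ (Submodule.subset_span ⟨i, rfl⟩) (Submodule.span_mono hsub (hz i))
    · have hsub' : Submodule.span k (h '' Set.Iio (n - A.card)) ≤
          Submodule.span k (Set.range fun i : Fin n => h i - z i) := by
        refine Submodule.span_le.mpr ?_
        rintro _ ⟨i, hi, rfl⟩
        have h0 := hz' ⟨i, (Set.mem_Iio.mp hi).trans_le (Nat.sub_le _ _)⟩
        rw [if_pos (by exact hi)] at h0
        refine Submodule.subset_span ⟨⟨i, (Set.mem_Iio.mp hi).trans_le (Nat.sub_le _ _)⟩, ?_⟩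
        simp only [h0, sub_zero]
      rintro _ ⟨i, rfl⟩
      change h i ∈ Submodule.span k _
      rw [← sub_add_cancel (h i) (z i)]
      exact Submodule.add_mem _ (Submodule.subset_span ⟨i, rfl⟩) (hsub' (hz i))
  have hspang := hspan.trans H.span_eq
  have hgen : {p : MvPolynomial (Fin n) k | ∃ j : Fin n, n - A.card ≤ (j : ℕ) ∧
      p = X (σ (Fin.rev j))} = X '' (A : Set (Fin n)) := by
    ext p
    constructor
    · rintro ⟨j, hj, rfl⟩
      refine ⟨_, (hσ _).mp ?_, rfl⟩
      rw [Equiv.symm_apply_apply, Fin.val_rev]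
      omega
    · rintro ⟨i, hi, rfl⟩
      refine ⟨Fin.rev (σ.symm i), ?_, by simp⟩
      have := (hσ i).mpr hi
      rw [Fin.val_rev]
      omega
  refine ⟨fun i => X (σ (Fin.rev i)), n - A.card, fun i => h i - z i,
    (linearIndependent_X _ _).comp _ (σ.injective.comp Fin.rev_injective),
    fun i => isHomogeneous_X _ _, by omega, by omega, ?_, hspang, fun i hi => ?_⟩
  · rw [linearIndependent_iff_card_eq_finrank_span, Set.finrank, hspan,
      finrank_span_eq_card H.linearIndependent]
  · have hzi := hz' i
    rw [if_neg (by omega)] at hzi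
    have hhom : (h i - z i).IsHomogeneous (D + 1) := (H.homogeneous i).sub
      ((Submodule.span_le.mpr (by rintro _ ⟨i, -, rfl⟩; exact H.homogeneous i) :
        _ ≤ homogeneousSubmodule (Fin n) k (D + 1)) (hz i))
    have hmem : h i - z i ∈ Ideal.span (Set.range g) := by
      rw [← ideal_span_eq_of_span_eq hspang]
      exact Ideal.subset_span ⟨i, rfl⟩
    simp only
    rw [hgen, ← supported_eq_adjoin_X, mem_supported]
    intro j hj
    obtain ⟨c, hc, hjc⟩ := (mem_vars_iff_mem_support j).mp hj
    by_contra hjA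
    exact Finsupp.mem_support_iff.mp hjc (H.eq_zero_of_mem_span_X hσ hA hg hhom hmem hzi hc hjA)

end Decomposition

section ChangeOfVariables

variable {k : Type*} [Field k] {n : ℕ}

theorem isHomogeneous_changeVars (A : Matrix (Fin n) (Fin n) k) {f : MvPolynomial (Fin n) k}
    {d : ℕ} (hf : f.IsHomogeneous d) : (changeVars A f).IsHomogeneous d := by
  have := hf.aeval (fun i => ∑ j, A i j • (X j : MvPolynomial (Fin n) k)) (n := 1) fun i =>
    IsHomogeneous.sum _ _ _ fun j _ => by
      rw [smul_eq_C_mul]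
      exact (isHomogeneous_X k j).C_mul _
  rwa [one_mul] at this

theorem changeVars_comp (A B : Matrix (Fin n) (Fin n) k) :
    (changeVars A).comp (changeVars B) = changeVars (B * A) := by
  ext1 i
  simp only [changeVars, AlgHom.comp_apply, aeval_X, map_sum, map_smul, Matrix.mul_apply,
    Finset.sum_smul, Finset.smul_sum, smul_smul]
  exact Finset.sum_comm

theorem changeVars_one : changeVars (1 : Matrix (Fin n) (Fin n) k) = AlgHom.id k _ := by
  ext1 i
  simp [changeVars, Matrix.one_apply]

/-- An invertible linear change of variables as an algebra automorphism. -/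
noncomputable def changeVarsEquiv (A : Matrix (Fin n) (Fin n) k) (hA : IsUnit A.det) :
    MvPolynomial (Fin n) k ≃ₐ[k] MvPolynomial (Fin n) k :=
  AlgEquiv.ofAlgHom (changeVars A) (changeVars A⁻¹)
    (by rw [changeVars_comp, Matrix.nonsing_inv_mul _ hA, changeVars_one])
    (by rw [changeVars_comp, Matrix.mul_nonsing_inv _ hA, changeVars_one])

theorem Decomposable.map_algEquiv {g : Fin n → MvPolynomial (Fin n) k} (hg : Decomposable g)
    (e : MvPolynomial (Fin n) k ≃ₐ[k] MvPolynomial (Fin n) k)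
    (he : ∀ p : MvPolynomial (Fin n) k, p.IsHomogeneous 1 → (e p).IsHomogeneous 1) :
    Decomposable fun i => e (g i) := by
  obtain ⟨y, a, h, hy, hyh, ha1, han, hh, hspan, hmem⟩ := hg
  have hker : LinearMap.ker e.toLinearMap = ⊥ := LinearMap.ker_eq_bot.mpr e.injective
  refine ⟨fun i => e (y i), a, fun i => e (h i), hy.map' e.toLinearMap hker,
    fun i => he _ (hyh i), ha1, han, hh.map' e.toLinearMap hker, ?_, fun i hi => ?_⟩
  · have h1 := congrArg (Submodule.map e.toLinearMap) hspan
    rwa [Submodule.map_span, Submodule.map_span, ← Set.range_comp, ← Set.range_comp] at h1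
  · have h1 := Subalgebra.mem_map.mpr ⟨_, hmem i hi, (rfl : e.toAlgHom (h i) = e (h i))⟩
    rw [AlgHom.map_adjoin] at h1
    refine Algebra.adjoin_mono ?_ h1
    rintro _ ⟨_, ⟨j, hj, rfl⟩, rfl⟩
    exact ⟨j, hj, rfl⟩

end ChangeOfVariables

/-- Let `I = (g_1,…,g_n)` be an indecomposable balanced complete intersection ideal of
type `(d)^n`, `d ≥ 2`.  Then for every algebra automorphism `φ` of `S` induced by an
invertible linear change of variables and every nonzero integer tuple `w` with
`∑ w_i = 0`, there is a monomial `x^c` of total degree `n(d-1)` with `x^c ∉ φ(I)` and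
`∑ w_i c_i > 0`. -/
theorem stmt0 {k : Type*} [Field k] [CharZero k] {n d : ℕ} (hd : 2 ≤ d)
    (g : Fin n → MvPolynomial (Fin n) k)
    (hhom : ∀ i, (g i).IsHomogeneous d)
    (hreg : RingTheory.Sequence.IsRegular (MvPolynomial (Fin n) k) (List.ofFn g))
    (hindec : ¬ Decomposable g)
    (A : Matrix (Fin n) (Fin n) k) (hA : IsUnit A.det)
    (w : Fin n → ℤ) (hw0 : w ≠ 0) (hwsum : ∑ i, w i = 0) :
    ∃ c : Fin n →₀ ℕ, (∑ i, c i) = n * (d - 1) ∧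
      monomial c (1 : k) ∉ Ideal.map (changeVars A) (Ideal.span (Set.range g)) ∧
      0 < ∑ i, w i * (c i : ℤ) := by
  by_contra! hneg
  obtain ⟨D, rfl⟩ : ∃ D, d = D + 1 := ⟨d - 1, by omega⟩
  have hmap : Ideal.map (changeVars A) (Ideal.span (Set.range g)) =
      Ideal.span (Set.range fun i => changeVars A (g i)) := by
    rw [Ideal.map_span, ← Set.range_comp]
    rfl
  have := finite_quotient_span_of_isRegular g hreg
  have : Module.Finite k
      (MvPolynomial (Fin n) k ⧸ Ideal.span (Set.range fun i => changeVars A (g i))) :=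
    Module.Finite.equiv (Ideal.quotientEquivAlg _ _ (changeVarsEquiv A hA) hmap.symm).toLinearEquiv
  have hg : ∀ i, (changeVars A (g i)).IsHomogeneous (D + 1) :=
    fun i => isHomogeneous_changeVars A (hhom i)
  obtain ⟨T, hT1, hTn, hT⟩ := exists_subset_forall_sum_le hg hw0 hwsum fun c hc hcI =>
    hneg c (by rwa [← Finsupp.degree_eq_sum]) (by rwa [hmap])
  apply hindec
  have hdec := (decomposable_of_forall_sum_le hg hT1 hTn hT).map_algEquiv
    (changeVarsEquiv A hA).symm fun p hp => isHomogeneous_changeVars A⁻¹ hp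
  have hsymm : ∀ p, (changeVarsEquiv A hA).symm (changeVars A p) = p :=
    (changeVarsEquiv A hA).symm_apply_apply
  simpa only [hsymm] using hdec
end

section
/- Let I = (g_1,…,g_n) ⊆ S be a balanced complete intersection ideal of type (d)^n with d ≥ 2. Then for every tuple of integers (w_1,…,w_n) with w_1 + … + w_n = 0, there exists a monomial x_1^{c_1}⋯x_n^{c_n} of total degree n(d−1) such that x_1^{c_1}⋯x_n^{c_n} ∉ I and w_1c_1 + … + w_nc_n ≥ 0. (This is the Hilbert–Mumford statement that the associated form of I is semistable with respect to the SL(n)-action.) -/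
open MvPolynomial

namespace BalancedCI

section Depth

variable {R : Type*} [CommRing R]

/-- `a` is a nonzerodivisor modulo the ideal `I`. -/
def IsNzdMod (I : Ideal R) (a : R) : Prop := ∀ f, a * f ∈ I → f ∈ I

/-- There is a sequence of `s` elements of `m` which is weakly regular on `R ⧸ I`. -/
def HasDepth (m : Ideal R) : ℕ → Ideal R → Prop
  | 0, _ => True
  | s + 1, I => ∃ a ∈ m, IsNzdMod I a ∧ HasDepth m s (I ⊔ Ideal.span {a})

/-- The quotient `R ⧸ I` has no nonzero element annihilated by `m`. -/
def SocleFree (m I : Ideal R) : Prop := ∀ c, (∀ x ∈ m, x * c ∈ I) → c ∈ I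

lemma mem_sup_span_singleton {I : Ideal R} {a f : R} :
    f ∈ I ⊔ Ideal.span {a} ↔ ∃ y ∈ I, ∃ t, f = y + a * t := by
  rw [Submodule.mem_sup]
  constructor
  · rintro ⟨y, hy, z, hz, rfl⟩
    obtain ⟨t, rfl⟩ := Ideal.mem_span_singleton'.1 hz
    exact ⟨y, hy, t, by ring⟩
  · rintro ⟨y, hy, t, rfl⟩
    exact ⟨y, hy, a * t, Ideal.mul_mem_right _ _ (Ideal.mem_span_singleton_self a), rfl⟩

lemma IsNzdMod.socleFree {m I : Ideal R} {a : R} (ha : a ∈ m) (h : IsNzdMod I a) :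
    SocleFree m I := fun c hc => h c (hc a ha)

lemma HasDepth.socleFree {m I : Ideal R} {s : ℕ} (h : HasDepth m (s + 1) I) :
    SocleFree m I := by
  obtain ⟨a, ha, hn, -⟩ := h
  exact hn.socleFree ha

/-- Whether `R ⧸ (I, a)` has a socle does not depend on the nonzerodivisor `a ∈ m`. -/
lemma SocleFree.exchange {m I : Ideal R} {a b : R} (hb : b ∈ m)
    (hna : IsNzdMod I a) (hnb : IsNzdMod I b) (h : SocleFree m (I ⊔ Ideal.span {b})) :
    SocleFree m (I ⊔ Ideal.span {a}) := by
  intro c hc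
  obtain ⟨y, hy, e, hbc⟩ := mem_sup_span_singleton.1 (hc b hb)
  have he : e ∈ I ⊔ Ideal.span {b} := by
    refine h e fun x hx => ?_
    obtain ⟨z, hz, t, hxc⟩ := mem_sup_span_singleton.1 (hc x hx)
    have : a * (x * e - b * t) ∈ I := by
      have : a * (x * e - b * t) = b * z - x * y := by linear_combination b * hxc - x * hbc
      rw [this]
      exact I.sub_mem (I.mul_mem_left _ hz) (I.mul_mem_left _ hy)
    exact mem_sup_span_singleton.2 ⟨_, hna _ this, t, by ring⟩
  obtain ⟨z, hz, f, hef⟩ := mem_sup_span_singleton.1 he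
  have : b * (c - a * f) ∈ I := by
    have : b * (c - a * f) = y + a * z := by linear_combination hbc + a * hef
    rw [this]
    exact I.add_mem hy (I.mul_mem_left _ hz)
  exact mem_sup_span_singleton.2 ⟨_, hnb _ this, f, by ring⟩

/-- If `a, c` is regular modulo `I`, then `a` is regular modulo `(I, c)`. -/
lemma IsNzdMod.swap {I : Ideal R} {a c : R}
    (hac : IsNzdMod (I ⊔ Ideal.span {a}) c) (ha : IsNzdMod I a) :
    IsNzdMod (I ⊔ Ideal.span {c}) a := by
  intro f hf
  obtain ⟨y, hy, t, h⟩ := mem_sup_span_singleton.1 hf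
  have ht : t ∈ I ⊔ Ideal.span {a} := by
    apply hac
    exact mem_sup_span_singleton.2 ⟨-y, I.neg_mem hy, f, by linear_combination -h⟩
  obtain ⟨z, hz, u, hu⟩ := mem_sup_span_singleton.1 ht
  have : a * (f - c * u) ∈ I := by
    have : a * (f - c * u) = y + c * z := by linear_combination h + c * hu
    rw [this]
    exact I.add_mem hy (I.mul_mem_left _ hz)
  exact mem_sup_span_singleton.2 ⟨_, ha _ this, u, by ring⟩

lemma exists_finset_primes [IsNoetherianRing R] (I : Ideal R) :
    ∃ s : Finset (Ideal R),
      (∀ P ∈ s, P.IsPrime ∧ ∃ x, ∀ r, r ∈ P ↔ r * x ∈ I) ∧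
      ∀ a, (∀ P ∈ s, a ∉ P) → IsNzdMod I a := by
  have hfin := associatedPrimes.finite R (R ⧸ I)
  refine ⟨hfin.toFinset, fun P hP => ?_, fun a ha f hf => ?_⟩
  · rw [Set.Finite.mem_toFinset, AssociatedPrimes.mem_iff, isAssociatedPrime_iff] at hP
    obtain ⟨hp, x, hx⟩ := hP
    obtain ⟨x, rfl⟩ := Ideal.Quotient.mk_surjective x
    refine ⟨hp, x, fun r => ?_⟩
    rw [hx, Submodule.mem_colon_singleton, Submodule.mem_bot, ← Ideal.Quotient.eq_zero_iff_mem,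
      map_mul]
    rfl
  · by_contra hfI
    have : a ∈ ⋃ P ∈ associatedPrimes R (R ⧸ I), (P : Set R) := by
      rw [biUnion_associatedPrimes_eq_zero_divisors]
      refine ⟨Ideal.Quotient.mk I f, fun h => hfI (Ideal.Quotient.eq_zero_iff_mem.1 h), ?_⟩
      have := Ideal.Quotient.eq_zero_iff_mem.2 hf
      rw [map_mul] at this
      exact this
    simp only [Set.mem_iUnion] at this
    obtain ⟨P, hP, haP⟩ := this
    exact ha P (hfin.mem_toFinset.2 hP) haP

lemma SocleFree.not_le {m I P : Ideal R} [m.IsMaximal] (h : SocleFree m I)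
    (hP : P.IsPrime) (hx : ∃ x, ∀ r, r ∈ P ↔ r * x ∈ I) : ¬ m ≤ P := by
  intro hle
  obtain ⟨x, hx⟩ := hx
  have := h x fun r hr => (hx r).1 (hle hr)
  exact hP.ne_top ((Ideal.eq_top_iff_one _).2 ((hx 1).2 (by simpa using this)))

lemma exists_common_nzd [IsNoetherianRing R] {m : Ideal R} [m.IsMaximal] {I J : Ideal R}
    (hI : SocleFree m I) (hJ : SocleFree m J) : ∃ c ∈ m, IsNzdMod I c ∧ IsNzdMod J c := by
  classical
  obtain ⟨s, hs, hs'⟩ := exists_finset_primes I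
  obtain ⟨t, ht, ht'⟩ := exists_finset_primes J
  by_contra! hcon
  have hsub : (m : Set R) ⊆ ⋃ P ∈ (↑(s ∪ t) : Set (Ideal R)), (P : Set R) := by
    intro c hc
    by_contra hcu
    simp only [Set.mem_iUnion, not_exists] at hcu
    refine hcon c hc (hs' c fun P hP => hcu P ?_) (ht' c fun P hP => hcu P ?_) <;> simp [hP]
  have hprime : ∀ P ∈ s ∪ t, P.IsPrime := by
    intro P hP
    simp only [Finset.mem_union] at hP
    rcases hP with hP | hP
    exacts [(hs P hP).1, (ht P hP).1]
  obtain ⟨P, hP, hle⟩ := (Ideal.subset_union_prime (f := id) ⊥ ⊥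
    (fun P hP _ _ => hprime P hP)).1 hsub
  simp only [Finset.mem_union] at hP
  rcases hP with hP | hP
  exacts [hI.not_le (hs P hP).1 (hs P hP).2 hle, hJ.not_le (ht P hP).1 (ht P hP).2 hle]

/-- Depth drops by one modulo any nonzerodivisor in the maximal ideal. -/
lemma HasDepth.sup_span [IsNoetherianRing R] {m : Ideal R} [m.IsMaximal] :
    ∀ {s : ℕ} {I : Ideal R} {b : R}, HasDepth m (s + 1) I → b ∈ m → IsNzdMod I b →
      HasDepth m s (I ⊔ Ideal.span {b})
  | 0, _, _, _, _, _ => trivial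
  | s + 1, I, b, ⟨a, ha, hna, hd⟩, hb, hnb => by
    have hsa : SocleFree m (I ⊔ Ideal.span {a}) := hd.socleFree
    have hsb := SocleFree.exchange ha hnb hna hsa
    obtain ⟨c, hc, hca, hcb⟩ := exists_common_nzd hsa hsb
    have h1 := hd.sup_span hc hca
    have hcd : HasDepth m (s + 1) (I ⊔ Ideal.span {c}) :=
      ⟨a, ha, hca.swap hna, by rwa [sup_right_comm]⟩
    have h2 := hcd.sup_span hb (hcb.swap hnb)
    exact ⟨c, hc, hcb, by rwa [sup_right_comm]⟩

/-- A subspace generating an ideal with radical containing `m` contains a nonzerodivisor modulo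
any ideal with trivial socle. -/
lemma SocleFree.exists_nzd_mem {k : Type*} [Field k] [Infinite k] [Algebra k R]
    [IsNoetherianRing R] {m : Ideal R} [m.IsMaximal] {I : Ideal R} (h : SocleFree m I)
    (V : Submodule k R) (hV : ∀ P : Ideal R, P.IsPrime → (V : Set R) ⊆ P → m ≤ P) :
    ∃ a ∈ V, IsNzdMod I a := by
  obtain ⟨s, hs, hs'⟩ := exists_finset_primes I
  by_contra! hcon
  obtain ⟨P, hP⟩ := Subspace.exists_eq_top_of_iUnion_eq_univ (k := k) (E := V) (ι := s)
    (p := fun P => (P.1.restrictScalars k).comap V.subtype) (by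
      ext ⟨a, ha⟩
      simp only [Set.mem_iUnion, Set.mem_univ, iff_true]
      by_contra! hall
      exact hcon a ha (hs' a fun P hP haP => hall ⟨P, hP⟩ haP))
  refine h.not_le (hs P P.2).1 (hs P P.2).2 (hV P (hs P P.2).1 fun a ha => ?_)
  have : (⟨a, ha⟩ : V) ∈ (P.1.restrictScalars k).comap V.subtype := by
    rw [hP]; trivial
  exact this

end Depth

noncomputable section Hilbert

attribute [local instance] MvPolynomial.gradedAlgebra

variable {σ k : Type*} [Field k]

lemma homogeneousComponent_mul_add {a : MvPolynomial σ k} {e : ℕ} (ha : a.IsHomogeneous e)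
    (j : ℕ) (q : MvPolynomial σ k) :
    homogeneousComponent (e + j) (a * q) = a * homogeneousComponent j q := by
  have h := DirectSum.coe_decompose_mul_add_of_left_mem (homogeneousSubmodule σ k) (j := j)
    (b := q) ((mem_homogeneousSubmodule e a).2 ha)
  rw [← decomposition.decompose'_apply, ← decomposition.decompose'_apply]
  exact h

lemma homogeneousComponent_mul_of_lt {a : MvPolynomial σ k} {e : ℕ} (ha : a.IsHomogeneous e)
    {j : ℕ} (hj : j < e) (q : MvPolynomial σ k) : homogeneousComponent j (a * q) = 0 := by
  have h := DirectSum.coe_decompose_mul_of_left_mem_of_not_le (homogeneousSubmodule σ k) (n := j)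
    (b := q) ((mem_homogeneousSubmodule e a).2 ha) (by omega)
  rw [← decomposition.decompose'_apply]
  exact h

/-- The degree `j` part of an ideal. -/
def degPart (I : Ideal (MvPolynomial σ k)) (j : ℕ) : Submodule k (MvPolynomial σ k) :=
  homogeneousSubmodule σ k j ⊓ I.restrictScalars k

lemma mem_degPart {I : Ideal (MvPolynomial σ k)} {j : ℕ} {p : MvPolynomial σ k} :
    p ∈ degPart I j ↔ p.IsHomogeneous j ∧ p ∈ I := Iff.rfl

/-- The Hilbert series of the quotient by `I`. -/
def hilb (I : Ideal (MvPolynomial σ k)) : PowerSeries ℤ :=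
  .mk fun j => (Module.finrank k (homogeneousSubmodule σ k j) : ℤ) - Module.finrank k (degPart I j)

lemma isHomogeneous_sup_span {I : Ideal (MvPolynomial σ k)} {a : MvPolynomial σ k} {e : ℕ}
    (hI : I.IsHomogeneous (homogeneousSubmodule σ k)) (ha : a.IsHomogeneous e) :
    (I ⊔ Ideal.span {a}).IsHomogeneous (homogeneousSubmodule σ k) := by
  refine hI.sup (Ideal.homogeneous_span _ _ ?_)
  rintro x rfl
  exact ⟨e, ha⟩

lemma degPart_sup_of_lt {I : Ideal (MvPolynomial σ k)} {a : MvPolynomial σ k} {e j : ℕ}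
    (hI : I.IsHomogeneous (homogeneousSubmodule σ k)) (ha : a.IsHomogeneous e) (hj : j < e) :
    degPart (I ⊔ Ideal.span {a}) j = degPart I j := by
  ext p
  simp only [mem_degPart, and_congr_right_iff]
  refine fun hp => ⟨fun h => ?_, fun h => le_sup_left (a := I) h⟩
  obtain ⟨y, hy, t, rfl⟩ := mem_sup_span_singleton.1 h
  rw [← homogeneousComponent_eq_self hp, map_add, homogeneousComponent_mul_of_lt ha hj, add_zero]
  exact homogeneousComponent_mem_of_mem hI hy j

lemma degPart_sup_add {I : Ideal (MvPolynomial σ k)} {a : MvPolynomial σ k} {e : ℕ}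
    (hI : I.IsHomogeneous (homogeneousSubmodule σ k)) (ha : a.IsHomogeneous e) (j : ℕ) :
    degPart (I ⊔ Ideal.span {a}) (e + j) =
      degPart I (e + j) ⊔ (homogeneousSubmodule σ k j).map (LinearMap.mulLeft k a) := by
  ext p
  constructor
  · rintro ⟨hp, h⟩
    obtain ⟨y, hy, t, rfl⟩ := mem_sup_span_singleton.1 h
    refine Submodule.mem_sup.2 ⟨homogeneousComponent (e + j) y,
      ⟨homogeneousComponent_isHomogeneous _ _, homogeneousComponent_mem_of_mem hI hy _⟩, a * homogeneousComponent j t,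
      ⟨_, homogeneousComponent_isHomogeneous _ _, rfl⟩, ?_⟩
    rw [← homogeneousComponent_mul_add ha, ← map_add, homogeneousComponent_eq_self hp]
  · intro h
    obtain ⟨y, ⟨hy, hyI⟩, _, ⟨t, ht, rfl⟩, rfl⟩ := Submodule.mem_sup.1 h
    exact ⟨IsHomogeneous.add hy (ha.mul ht), mem_sup_span_singleton.2 ⟨y, hyI, t, rfl⟩⟩

lemma degPart_inf_map {I : Ideal (MvPolynomial σ k)} {a : MvPolynomial σ k} {e : ℕ}
    (ha : a.IsHomogeneous e) (hn : IsNzdMod I a) (j : ℕ) :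
    degPart I (e + j) ⊓ (homogeneousSubmodule σ k j).map (LinearMap.mulLeft k a) =
      (degPart I j).map (LinearMap.mulLeft k a) := by
  ext p
  rw [Submodule.mem_inf]
  constructor
  · rintro ⟨hp, t, ht, rfl⟩
    exact ⟨t, ⟨ht, hn t hp.2⟩, rfl⟩
  · rintro ⟨t, ⟨ht, htI⟩, rfl⟩
    exact ⟨⟨ha.mul ht, I.mul_mem_left _ htI⟩, t, ht, rfl⟩

lemma exists_monomial_notMem_of_coeff_hilb_ne_zero {I : Ideal (MvPolynomial σ k)} {j : ℕ}
    (h : PowerSeries.coeff j (hilb I) ≠ 0) :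
    ∃ c : σ →₀ ℕ, c.degree = j ∧ monomial c (1 : k) ∉ I := by
  by_contra! hcon
  apply h
  have : degPart I j = homogeneousSubmodule σ k j := by
    refine le_antisymm inf_le_left fun p hp => ⟨hp, ?_⟩
    have hp' : p ∈ I := by
      rw [p.as_sum]
      refine I.sum_mem fun c hc => ?_
      rw [← mul_one (coeff c p), ← C_mul_monomial]
      refine I.mul_mem_left _ (hcon c ?_)
      by_contra hne
      exact mem_support_iff.1 hc (IsHomogeneous.coeff_eq_zero hp hne)
    exact hp'
  rw [hilb, PowerSeries.coeff_mk, this, sub_self]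

variable [Finite σ]

instance finite_homogeneousSubmodule (j : ℕ) :
    Module.Finite k (homogeneousSubmodule σ k j) :=
  Module.Finite.iff_fg.2 (homogeneousSubmodule_fg σ k j)

instance finite_degPart (I : Ideal (MvPolynomial σ k)) (j : ℕ) : Module.Finite k (degPart I j) :=
  Submodule.finiteDimensional_of_le (inf_le_left : degPart I j ≤ homogeneousSubmodule σ k j)

lemma hilb_sup_span {I : Ideal (MvPolynomial σ k)} {a : MvPolynomial σ k} {e : ℕ}
    (hI : I.IsHomogeneous (homogeneousSubmodule σ k)) (ha : a.IsHomogeneous e)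
    (hn : IsNzdMod I a) (ha0 : a ≠ 0) :
    hilb (I ⊔ Ideal.span {a}) = (1 - PowerSeries.X ^ e) * hilb I := by
  ext j
  rw [sub_mul, one_mul, map_sub, PowerSeries.coeff_X_pow_mul']
  split_ifs with hj
  · obtain ⟨j, rfl⟩ := Nat.exists_eq_add_of_le hj
    have hinj : Function.Injective (LinearMap.mulLeft k a) := mul_right_injective₀ ha0
    have key := Submodule.finrank_sup_add_finrank_inf_eq (degPart I (e + j))
      ((homogeneousSubmodule σ k j).map (LinearMap.mulLeft k a))
    rw [degPart_inf_map ha hn, ← degPart_sup_add hI ha,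
      ← (Submodule.equivMapOfInjective _ hinj (degPart I j)).finrank_eq,
      ← (Submodule.equivMapOfInjective _ hinj (homogeneousSubmodule σ k j)).finrank_eq] at key
    simp only [hilb, PowerSeries.coeff_mk, Nat.add_sub_cancel_left]
    omega
  · rw [hilb, PowerSeries.coeff_mk, degPart_sup_of_lt hI ha (not_le.1 hj), hilb,
      PowerSeries.coeff_mk, sub_zero]

lemma mem_of_coeff_hilb_eq_zero {I : Ideal (MvPolynomial σ k)} {j : ℕ}
    (h : PowerSeries.coeff j (hilb I) = 0) {p : MvPolynomial σ k} (hp : p.IsHomogeneous j) :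
    p ∈ I := by
  simp only [hilb, PowerSeries.coeff_mk] at h
  have hle : degPart I j ≤ homogeneousSubmodule σ k j := inf_le_left
  have := Submodule.eq_of_le_of_finrank_eq hle (by omega)
  have hp' : p ∈ degPart I j := by rw [this]; exact hp
  exact hp'.2

end Hilbert

noncomputable section Variables

attribute [local instance] MvPolynomial.gradedAlgebra

variable {σ k : Type*} [Field k]

variable (k) in
/-- The ideal generated by a set of variables. -/
def varIdeal (T : Set σ) : Ideal (MvPolynomial σ k) := Ideal.span (X '' T)

lemma varIdeal_insert (T : Set σ) (i : σ) :
    varIdeal k (insert i T) = varIdeal k T ⊔ Ideal.span {X i} := by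
  rw [varIdeal, Set.image_insert_eq, Ideal.span_insert, sup_comm, varIdeal]

lemma isNzdMod_varIdeal {T : Set σ} {i : σ} (hi : i ∉ T) :
    IsNzdMod (varIdeal k T) (X i : MvPolynomial σ k) := by
  intro f hf
  rw [varIdeal, mem_ideal_span_X_image] at hf ⊢
  intro m hm
  obtain ⟨j, hj, hne⟩ := hf (Finsupp.single i 1 + m) (by
    rw [support_X_mul, Finset.mem_map]
    exact ⟨m, hm, rfl⟩)
  refine ⟨j, hj, ?_⟩
  have : i ≠ j := fun h => hi (h ▸ hj)
  simpa [Finsupp.single_apply, this] using hne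

lemma isHomogeneous_varIdeal (T : Set σ) :
    (varIdeal k T).IsHomogeneous (homogeneousSubmodule σ k) := by
  refine Ideal.homogeneous_span _ _ ?_
  rintro _ ⟨i, -, rfl⟩
  exact ⟨1, isHomogeneous_X _ _⟩

lemma mem_varIdeal_univ {p : MvPolynomial σ k} :
    p ∈ varIdeal k (Set.univ : Set σ) ↔ constantCoeff p = 0 := by
  rw [varIdeal, mem_ideal_span_X_image, constantCoeff_eq]
  constructor
  · intro h
    by_contra h0
    obtain ⟨i, -, hi⟩ := h 0 (mem_support_iff.2 h0)
    exact hi rfl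
  · intro h m hm
    by_contra! hall
    have : m = 0 := Finsupp.ext fun i => hall i trivial
    subst this
    exact mem_support_iff.1 hm h

instance isMaximal_varIdeal_univ : (varIdeal k (Set.univ : Set σ)).IsMaximal := by
  have : varIdeal k (Set.univ : Set σ) = RingHom.ker (constantCoeff (σ := σ) (R := k)) :=
    Ideal.ext fun p => mem_varIdeal_univ
  rw [this]
  exact RingHom.ker_isMaximal_of_surjective _ fun x => ⟨C x, by simp⟩

lemma hilb_varIdeal_univ : hilb (varIdeal k (Set.univ : Set σ)) = 1 := by
  have hle : ∀ j, 0 < j → homogeneousSubmodule σ k j ≤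
      (varIdeal k (Set.univ : Set σ)).restrictScalars k := by
    intro j hj p hp
    refine mem_varIdeal_univ.2 (IsHomogeneous.coeff_eq_zero hp ?_)
    simpa using hj.ne
  ext j
  rw [PowerSeries.coeff_one, hilb, PowerSeries.coeff_mk]
  split_ifs with hj
  · subst hj
    have h1 : degPart (varIdeal k (Set.univ : Set σ)) 0 = ⊥ := by
      rw [eq_bot_iff]
      rintro p ⟨hp, hpI⟩
      have hpI := mem_varIdeal_univ.1 hpI
      have hp : p.IsHomogeneous 0 := hp
      rw [← homogeneousComponent_eq_self hp, homogeneousComponent_zero, ← constantCoeff_eq, hpI]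
      simp
    have h2 : Module.finrank k (homogeneousSubmodule σ k 0) = 1 := by
      rw [homogeneousSubmodule_zero, Submodule.one_eq_span]
      exact finrank_span_singleton one_ne_zero
    rw [h1, h2]
    simp
  · rw [degPart, inf_eq_left.2 (hle j (Nat.pos_of_ne_zero hj)), sub_self]

variable [Fintype σ]

lemma hilb_varIdeal (T : Finset σ) :
    hilb (varIdeal k (T : Set σ)) =
      (1 - PowerSeries.X) ^ T.card * hilb (⊥ : Ideal (MvPolynomial σ k)) := by
  classical
  induction T using Finset.induction_on with
  | empty => simp [varIdeal]
  | insert i T hi ih =>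
    rw [Finset.coe_insert, varIdeal_insert, hilb_sup_span (e := 1) (isHomogeneous_varIdeal _)
      (isHomogeneous_X _ _) (isNzdMod_varIdeal (by simpa using hi)) (X_ne_zero _), ih,
      Finset.card_insert_of_notMem hi]
    ring

lemma hasDepth_varIdeal (s : ℕ) (T : Finset σ) (h : T.card + s ≤ Fintype.card σ) :
    HasDepth (varIdeal k Set.univ) s (varIdeal k (T : Set σ)) := by
  classical
  induction s generalizing T with
  | zero => trivial
  | succ s ih =>
    obtain ⟨i, hi⟩ : ∃ i, i ∉ T := by
      by_contra! hall
      rw [Finset.eq_univ_iff_forall.2 hall, Finset.card_univ] at h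
      omega
    refine ⟨X i, Ideal.subset_span ⟨i, trivial, rfl⟩, isNzdMod_varIdeal (by simpa using hi), ?_⟩
    rw [← varIdeal_insert, ← Finset.coe_insert]
    exact ih _ (by rw [Finset.card_insert_of_notMem hi]; omega)

lemma one_sub_X_pow_mul_hilb_bot :
    (1 - PowerSeries.X) ^ Fintype.card σ * hilb (⊥ : Ideal (MvPolynomial σ k)) = 1 := by
  rw [← Finset.card_univ, ← hilb_varIdeal, Finset.coe_univ, hilb_varIdeal_univ]

/-- The series `(1 + t + ⋯ + t ^ (d - 1)) ^ r` is obtained from the Hilbert series of an iterated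
quotient by `r` forms of degree `d` and `n - r` forms of degree one. -/
lemma eq_geom_sum_pow {H : PowerSeries ℤ} {d r t : ℕ} (hrt : r + t = Fintype.card σ)
    (hH : H = (1 - PowerSeries.X ^ d) ^ r *
      ((1 - PowerSeries.X) ^ t * hilb (⊥ : Ideal (MvPolynomial σ k)))) :
    H = (((∑ i ∈ Finset.range d, Polynomial.X ^ i : Polynomial ℤ) ^ r : Polynomial ℤ) :
      PowerSeries ℤ) := by
  have h1 : (1 - PowerSeries.X ^ d : PowerSeries ℤ) =
      (1 - PowerSeries.X) * ∑ i ∈ Finset.range d, PowerSeries.X ^ i := by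
    rw [mul_comm, geom_sum_mul_neg]
  have h2 := one_sub_X_pow_mul_hilb_bot (σ := σ) (k := k)
  rw [← hrt, pow_add] at h2
  have h3 : (((∑ i ∈ Finset.range d, Polynomial.X ^ i : Polynomial ℤ) ^ r : Polynomial ℤ) :
      PowerSeries ℤ) = (∑ i ∈ Finset.range d, PowerSeries.X ^ i) ^ r := by
    rw [Polynomial.coe_pow, ← Polynomial.coeToPowerSeries.ringHom_apply, map_sum]
    simp
  rw [h3, hH, h1, mul_pow]
  linear_combination (∑ i ∈ Finset.range d, PowerSeries.X ^ i : PowerSeries ℤ) ^ r * h2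

end Variables

section GeomSum

lemma natDegree_geom_sum {d : ℕ} (hd : d ≠ 0) :
    (∑ i ∈ Finset.range d, Polynomial.X ^ i : Polynomial ℤ).natDegree = d - 1 := by
  have h := congrArg Polynomial.natDegree (geom_sum_mul (Polynomial.X : Polynomial ℤ) d)
  have hX : (Polynomial.X - 1 : Polynomial ℤ) = Polynomial.X - Polynomial.C 1 := by simp
  have hXd : (Polynomial.X ^ d - 1 : Polynomial ℤ) = Polynomial.X ^ d - Polynomial.C 1 := by simp
  rw [hX, (Polynomial.monic_geom_sum_X hd).natDegree_mul (Polynomial.monic_X_sub_C 1),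
    Polynomial.natDegree_X_sub_C, hXd, Polynomial.natDegree_X_pow_sub_C] at h
  omega

lemma coeff_geom_sum_pow_eq_zero {d r j : ℕ} (hd : d ≠ 0) (hj : r * (d - 1) < j) :
    ((∑ i ∈ Finset.range d, Polynomial.X ^ i : Polynomial ℤ) ^ r).coeff j = 0 := by
  apply Polynomial.coeff_eq_zero_of_natDegree_lt
  rwa [(Polynomial.monic_geom_sum_X hd).natDegree_pow, natDegree_geom_sum hd]

lemma coeff_geom_sum_pow_top {d r : ℕ} (hd : d ≠ 0) :
    ((∑ i ∈ Finset.range d, Polynomial.X ^ i : Polynomial ℤ) ^ r).coeff (r * (d - 1)) = 1 := by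
  have h := ((Polynomial.monic_geom_sum_X (R := ℤ) hd).pow r).coeff_natDegree
  rwa [(Polynomial.monic_geom_sum_X hd).natDegree_pow, natDegree_geom_sum hd] at h

end GeomSum

section CompleteIntersection

attribute [local instance] MvPolynomial.gradedAlgebra

variable {k : Type*} [Field k] {n d : ℕ} {g : Fin n → MvPolynomial (Fin n) k}

lemma IsNzdMod.ne_zero {σ : Type*} {L : Ideal (MvPolynomial σ k)} {a : MvPolynomial σ k}
    (hL : L ≤ varIdeal k Set.univ) (h : IsNzdMod L a) : a ≠ 0 := by
  rintro rfl
  exact isMaximal_varIdeal_univ.ne_top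
    ((Ideal.eq_top_iff_one _).2 (hL (h 1 (by simp))))

lemma mem_varIdeal_univ_of_isHomogeneous {σ : Type*} {a : MvPolynomial σ k} (hd : d ≠ 0)
    (ha : a.IsHomogeneous d) : a ∈ varIdeal k (Set.univ : Set σ) :=
  mem_varIdeal_univ.2 (ha.coeff_eq_zero (by simpa using hd.symm))

lemma hilb_ofList_take (hd : d ≠ 0) (hhom : ∀ i, (g i).IsHomogeneous d)
    (hreg : RingTheory.Sequence.IsWeaklyRegular (MvPolynomial (Fin n) k) (List.ofFn g))
    (l : ℕ) (hl : l ≤ n) :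
    (Ideal.ofList ((List.ofFn g).take l)).IsHomogeneous (homogeneousSubmodule (Fin n) k) ∧
    Ideal.ofList ((List.ofFn g).take l) ≤ varIdeal k Set.univ ∧
    hilb (Ideal.ofList ((List.ofFn g).take l)) =
      (1 - PowerSeries.X ^ d) ^ l * hilb (⊥ : Ideal (MvPolynomial (Fin n) k)) := by
  induction l with
  | zero => simp [Ideal.IsHomogeneous.bot]
  | succ l ih =>
    obtain ⟨h1, h2, h3⟩ := ih (by omega)
    have hlen : l < (List.ofFn g).length := by simpa using hl
    have hstep : Ideal.ofList ((List.ofFn g).take (l + 1)) =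
        Ideal.ofList ((List.ofFn g).take l) ⊔ Ideal.span {g ⟨l, hl⟩} := by
      rw [List.take_add_one, Ideal.ofList_append, List.getElem?_eq_getElem hlen]
      simp
    have hn : IsNzdMod (Ideal.ofList ((List.ofFn g).take l)) (g ⟨l, hl⟩) := by
      have h := hreg.regular_mod_prev l hlen
      intro f hf
      rw [List.getElem_ofFn] at h
      have h0 := @h (Submodule.Quotient.mk f) 0 (by
        simp only [smul_zero]
        rw [← Submodule.Quotient.mk_smul, Submodule.Quotient.mk_eq_zero]
        simpa using hf)
      rw [Submodule.Quotient.mk_eq_zero] at h0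
      simpa using h0
    rw [hstep]
    refine ⟨isHomogeneous_sup_span h1 (hhom _), sup_le h2 ?_, ?_⟩
    · rw [Ideal.span_singleton_le_iff_mem]
      exact mem_varIdeal_univ_of_isHomogeneous hd (hhom _)
    · rw [hilb_sup_span h1 (hhom _) hn (hn.ne_zero h2), h3]
      ring

lemma ofList_ofFn {R : Type*} [CommRing R] (g : Fin n → R) :
    Ideal.ofList (List.ofFn g) = Ideal.span (Set.range g) :=
  congrArg Ideal.span (Set.ext fun x => by simp [List.mem_ofFn])

lemma hilb_span_range (hd : d ≠ 0) (hhom : ∀ i, (g i).IsHomogeneous d)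
    (hreg : RingTheory.Sequence.IsWeaklyRegular (MvPolynomial (Fin n) k) (List.ofFn g)) :
    hilb (Ideal.span (Set.range g)) =
      (((∑ i ∈ Finset.range d, Polynomial.X ^ i : Polynomial ℤ) ^ n : Polynomial ℤ) :
        PowerSeries ℤ) := by
  have h := (hilb_ofList_take hd hhom hreg n le_rfl).2.2
  rw [List.take_of_length_le (by simp), ofList_ofFn] at h
  exact eq_geom_sum_pow (σ := Fin n) (k := k) (t := 0) (by simp) (by simpa using h)

lemma varIdeal_le_of_span_le (hd : d ≠ 0) (hhom : ∀ i, (g i).IsHomogeneous d)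
    (hreg : RingTheory.Sequence.IsWeaklyRegular (MvPolynomial (Fin n) k) (List.ofFn g))
    {P : Ideal (MvPolynomial (Fin n) k)} (hP : P.IsPrime) (hle : Ideal.span (Set.range g) ≤ P) :
    varIdeal k Set.univ ≤ P := by
  rw [varIdeal, Ideal.span_le]
  rintro _ ⟨i, -, rfl⟩
  refine hP.mem_of_pow_mem (n * (d - 1) + 1) (hle ?_)
  refine mem_of_coeff_hilb_eq_zero (j := n * (d - 1) + 1) ?_ (isHomogeneous_X_pow i _)
  rw [hilb_span_range hd hhom hreg, Polynomial.coeff_coe]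
  exact coeff_geom_sum_pow_eq_zero hd (Nat.lt_succ_self _)

lemma exists_regular_sup_varIdeal [Infinite k] (hd : d ≠ 0) (hhom : ∀ i, (g i).IsHomogeneous d)
    (hreg : RingTheory.Sequence.IsWeaklyRegular (MvPolynomial (Fin n) k) (List.ofFn g))
    (T : Finset (Fin n)) (r : ℕ) (hr : T.card + r ≤ n) :
    ∃ L : Ideal (MvPolynomial (Fin n) k), L.IsHomogeneous (homogeneousSubmodule (Fin n) k) ∧
      L ≤ Ideal.span (Set.range g) ⊔ varIdeal k (T : Set (Fin n)) ∧
      L ≤ varIdeal k Set.univ ∧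
      HasDepth (varIdeal k Set.univ) (n - T.card - r) L ∧
      hilb L = (1 - PowerSeries.X ^ d) ^ r *
        ((1 - PowerSeries.X) ^ T.card * hilb (⊥ : Ideal (MvPolynomial (Fin n) k))) := by
  induction r with
  | zero =>
    refine ⟨varIdeal k (T : Set (Fin n)), isHomogeneous_varIdeal _, le_sup_right,
      Ideal.span_mono (Set.image_mono (Set.subset_univ _)),
      hasDepth_varIdeal _ _ (by simp; omega), ?_⟩
    rw [hilb_varIdeal, pow_zero, one_mul]
  | succ r ih =>
    obtain ⟨L, h1, h2, h3, h4, h5⟩ := ih (by omega)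
    obtain ⟨s, hs⟩ : ∃ s, n - T.card - r = s + 1 := ⟨n - T.card - r - 1, by omega⟩
    rw [hs] at h4
    obtain ⟨a, haV, ha⟩ := h4.socleFree.exists_nzd_mem (Submodule.span k (Set.range g))
      fun P hP hVP => varIdeal_le_of_span_le hd hhom hreg hP
        (Ideal.span_le.2 (Submodule.subset_span.trans hVP))
    have hahom : a.IsHomogeneous d := by
      have : Submodule.span k (Set.range g) ≤ homogeneousSubmodule (Fin n) k d := by
        rw [Submodule.span_le]
        rintro _ ⟨i, rfl⟩
        exact hhom i
      exact this haV
    have haI : a ∈ Ideal.span (Set.range g) := by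
      have : Submodule.span k (Set.range g) ≤
          (Ideal.span (Set.range g)).restrictScalars k :=
        Submodule.span_le.2 Ideal.subset_span
      exact this haV
    have ham := mem_varIdeal_univ_of_isHomogeneous hd hahom
    refine ⟨L ⊔ Ideal.span {a}, isHomogeneous_sup_span h1 hahom, sup_le h2 ?_, sup_le h3 ?_, ?_, ?_⟩
    · rw [Ideal.span_singleton_le_iff_mem]
      exact le_sup_left (a := Ideal.span (Set.range g)) haI
    · rwa [Ideal.span_singleton_le_iff_mem]
    · have : n - T.card - (r + 1) = s := by omega
      rw [this]
      exact h4.sup_span ham ha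
    · rw [hilb_sup_span h1 hahom ha (ha.ne_zero h3), h5]
      ring

/-- Modulo a complete intersection of `n` forms of degree `d` and a set `T` of variables, all
forms of degree greater than `(n - |T|) (d - 1)` vanish. -/
lemma mem_span_sup_varIdeal [Infinite k] (hd : d ≠ 0) (hhom : ∀ i, (g i).IsHomogeneous d)
    (hreg : RingTheory.Sequence.IsWeaklyRegular (MvPolynomial (Fin n) k) (List.ofFn g))
    (T : Finset (Fin n)) {j : ℕ} (hj : (n - T.card) * (d - 1) < j)
    {p : MvPolynomial (Fin n) k} (hp : p.IsHomogeneous j) :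
    p ∈ Ideal.span (Set.range g) ⊔ varIdeal k (T : Set (Fin n)) := by
  have hT : T.card ≤ n := by simpa using T.card_le_univ
  obtain ⟨L, -, hle, -, -, hL⟩ :=
    exists_regular_sup_varIdeal hd hhom hreg T (n - T.card) (by omega)
  refine hle (mem_of_coeff_hilb_eq_zero ?_ hp)
  rw [eq_geom_sum_pow (by simp [hT]) hL, Polynomial.coeff_coe]
  exact coeff_geom_sum_pow_eq_zero hd hj

lemma isHomogeneous_span_range (hhom : ∀ i, (g i).IsHomogeneous d) :
    (Ideal.span (Set.range g)).IsHomogeneous (homogeneousSubmodule (Fin n) k) := by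
  refine Ideal.homogeneous_span _ _ ?_
  rintro _ ⟨i, rfl⟩
  exact ⟨d, hhom i⟩

/-- A monomial outside a homogeneous ideal `I` of degree too small in the variables of `T` can be
replaced by one of the same degree which has larger exponents on `T`. -/
lemma exists_exchange {σ : Type*} {I : Ideal (MvPolynomial σ k)}
    (hI : I.IsHomogeneous (homogeneousSubmodule σ k)) {T : Finset σ} [DecidablePred (· ∈ T)]
    {c : σ →₀ ℕ} (hc : monomial c (1 : k) ∉ I)
    (ht : monomial (c.filter (· ∉ T)) (1 : k) ∈ I ⊔ varIdeal k (T : Set σ)) :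
    ∃ c' : σ →₀ ℕ, c'.degree = c.degree ∧ monomial c' (1 : k) ∉ I ∧
      (∀ i ∈ T, c i ≤ c' i) ∧ ∃ i ∈ T, c i < c' i := by
  set t := c.filter (· ∉ T) with ht_def
  set u := c.filter (· ∈ T) with hu_def
  have hut : u + t = c := Finsupp.filter_add_filter_not c (· ∈ T)
  have hu : ∀ i ∈ T, u i = c i := fun i hi => Finsupp.filter_apply_pos _ _ hi
  obtain ⟨p, hp, q, hq, hpq⟩ := Submodule.mem_sup.1 ht
  have hp' := homogeneousComponent_mem_of_mem hI hp t.degree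
  have hq' := homogeneousComponent_mem_of_mem (isHomogeneous_varIdeal _) hq t.degree
  have hsum : homogeneousComponent t.degree p + homogeneousComponent t.degree q =
      monomial t (1 : k) := by
    rw [← map_add, hpq, homogeneousComponent_eq_self (isHomogeneous_monomial _ rfl)]
  obtain ⟨m, hm, hmI⟩ : ∃ m ∈ (homogeneousComponent t.degree q).support,
      monomial (u + m) (1 : k) ∉ I := by
    by_contra! hall
    apply hc
    have : monomial c (1 : k) = monomial u 1 * homogeneousComponent t.degree p +
        monomial u 1 * homogeneousComponent t.degree q := by
      rw [← mul_add, hsum, monomial_mul, hut, one_mul]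
    rw [this]
    refine I.add_mem (I.mul_mem_left _ hp') ?_
    rw [(homogeneousComponent t.degree q).as_sum, Finset.mul_sum]
    refine I.sum_mem fun m hm => ?_
    rw [monomial_mul, one_mul, ← mul_one (coeff m _), ← C_mul_monomial]
    exact I.mul_mem_left _ (hall m hm)
  refine ⟨u + m, ?_, hmI, fun i hi => ?_, ?_⟩
  · have : m.degree = t.degree := by
      by_contra hne
      exact mem_support_iff.1 hm
        ((homogeneousComponent_isHomogeneous t.degree q).coeff_eq_zero hne)
    rw [← hut, map_add, map_add, this]
  · rw [Finsupp.add_apply, hu i hi]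
    exact Nat.le_add_right _ _
  · rw [varIdeal, mem_ideal_span_X_image] at hq'
    obtain ⟨i, hi, hne⟩ := hq' m hm
    refine ⟨i, hi, ?_⟩
    rw [Finsupp.add_apply, hu i hi]
    omega

end CompleteIntersection

section Weights

/-- Increasing exponents on a superlevel set of `u` increases the weighted sum with rapidly
growing weights `(N + 1) ^ u i`. -/
lemma sum_mul_pow_lt {ι : Type*} [Fintype ι] {u c c' : ι → ℕ} {N v : ℕ}
    (hc : ∑ i, c i = N) (hle : ∀ i, v < u i → c i ≤ c' i) (hlt : ∃ i, v < u i ∧ c i < c' i) :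
    ∑ i, c i * (N + 1) ^ u i < ∑ i, c' i * (N + 1) ^ u i := by
  classical
  obtain ⟨j, hj, hcj⟩ := hlt
  rw [← Finset.sum_filter_add_sum_filter_not _ (fun i => v < u i) (fun i => c i * (N + 1) ^ u i)]
  have h1 : ∑ i with ¬ v < u i, c i * (N + 1) ^ u i ≤ N * (N + 1) ^ v := by
    rw [← hc, Finset.sum_mul, hc]
    refine (Finset.sum_le_sum fun i hi => ?_).trans
      (Finset.sum_le_sum_of_subset (Finset.filter_subset _ _))
    simp only [Finset.mem_filter, not_lt] at hi
    exact Nat.mul_le_mul_left _ (Nat.pow_le_pow_right (Nat.succ_pos _) hi.2)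
  have h2 : N * (N + 1) ^ v < (N + 1) ^ u j :=
    calc N * (N + 1) ^ v < (N + 1) * (N + 1) ^ v :=
          Nat.mul_lt_mul_of_pos_right (Nat.lt_succ_self _) (by positivity)
      _ = (N + 1) ^ (v + 1) := by ring
      _ ≤ (N + 1) ^ u j := Nat.pow_le_pow_right (Nat.succ_pos _) hj
  have h3 : ∑ i with v < u i, c i * (N + 1) ^ u i + (N + 1) ^ u j ≤
      ∑ i with v < u i, c' i * (N + 1) ^ u i := by
    have hjm : j ∈ Finset.univ.filter (fun i => v < u i) := by simpa using hj
    rw [← Finset.add_sum_erase _ _ hjm, ← Finset.add_sum_erase _ (fun i => c' i * _) hjm]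
    have := Finset.sum_le_sum (s := (Finset.univ.filter (fun i => v < u i)).erase j)
      (f := fun i => c i * (N + 1) ^ u i) (g := fun i => c' i * (N + 1) ^ u i) fun i hi =>
        Nat.mul_le_mul_right _ (hle i (by simpa using (Finset.mem_erase.1 hi).2))
    have h4 : (c j + 1) * (N + 1) ^ u j ≤ c' j * (N + 1) ^ u j := Nat.mul_le_mul_right _ hcj
    rw [add_mul, one_mul] at h4
    omega
  have h5 : ∑ i with v < u i, c' i * (N + 1) ^ u i ≤ ∑ i, c' i * (N + 1) ^ u i :=
    Finset.sum_le_sum_of_subset (Finset.filter_subset _ _)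
  omega

lemma sum_mul_nonneg_of_superlevel {ι : Type*} [Fintype ι] {u : ι → ℕ} {b : ι → ℤ}
    (h : ∀ v, 0 ≤ ∑ i with v < u i, b i) : 0 ≤ ∑ i, (u i : ℤ) * b i := by
  classical
  have hu : ∀ i, (u i : ℤ) * b i =
      ∑ v ∈ Finset.range (∑ i, u i), if v < u i then b i else 0 := by
    intro i
    have hle : u i ≤ ∑ i, u i := Finset.single_le_sum (fun _ _ => Nat.zero_le _) (Finset.mem_univ i)
    have : (Finset.range (∑ i, u i)).filter (fun v => v < u i) = Finset.range (u i) := by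
      ext v
      simp only [Finset.mem_filter, Finset.mem_range]
      omega
    rw [← Finset.sum_filter, this, Finset.sum_const, Finset.card_range, nsmul_eq_mul]
  simp_rw [hu]
  rw [Finset.sum_comm]
  refine Finset.sum_nonneg fun v _ => ?_
  rw [← Finset.sum_filter]
  exact h v

end Weights

end BalancedCI

/-- Let `I = (g_1,…,g_n)` be a balanced complete intersection ideal of type `(d)^n`,
`d ≥ 2`.  Then for every integer tuple `w` with `∑ w_i = 0`, there is a monomial `x^c`
of total degree `n(d-1)` with `x^c ∉ I` and `∑ w_i c_i ≥ 0` (semistability of the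
associated form). -/
theorem stmt1 {k : Type*} [Field k] [CharZero k] {n d : ℕ} (hd : 2 ≤ d)
    (g : Fin n → MvPolynomial (Fin n) k)
    (hhom : ∀ i, (g i).IsHomogeneous d)
    (hreg : RingTheory.Sequence.IsRegular (MvPolynomial (Fin n) k) (List.ofFn g))
    (w : Fin n → ℤ) (hwsum : ∑ i, w i = 0) :
    ∃ c : Fin n →₀ ℕ, (∑ i, c i) = n * (d - 1) ∧
      monomial c (1 : k) ∉ Ideal.span (Set.range g) ∧
      0 ≤ ∑ i, w i * (c i : ℤ) := by
  classical
  have : Infinite k := CharZero.infinite k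
  have hd0 : d ≠ 0 := by omega
  have hreg := hreg.toIsWeaklyRegular
  obtain ⟨M, hM⟩ : ∃ M : ℤ, ∀ i, 0 ≤ w i + M :=
    ⟨∑ i, |w i|, fun i => by
      have := Finset.single_le_sum (f := fun i => |w i|) (fun _ _ => abs_nonneg _)
        (Finset.mem_univ i)
      have := neg_abs_le (w i)
      omega⟩
  let u : Fin n → ℕ := fun i => (w i + M).toNat
  have hu : ∀ i, (u i : ℤ) = w i + M := fun i => Int.toNat_of_nonneg (hM i)
  let S : Finset (Fin n →₀ ℕ) := (Finset.univ.finsuppAntidiag (n * (d - 1))).filter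
    fun c => monomial c (1 : k) ∉ Ideal.span (Set.range g)
  have hS : ∀ c, c ∈ S ↔ ∑ i, c i = n * (d - 1) ∧
      monomial c (1 : k) ∉ Ideal.span (Set.range g) := by
    intro c
    simp [S, Finset.mem_finsuppAntidiag]
  have hne : S.Nonempty := by
    obtain ⟨c, hc, hcI⟩ := BalancedCI.exists_monomial_notMem_of_coeff_hilb_ne_zero
      (I := Ideal.span (Set.range g)) (j := n * (d - 1)) (by
        rw [BalancedCI.hilb_span_range hd0 hhom hreg, Polynomial.coeff_coe,
          BalancedCI.coeff_geom_sum_pow_top hd0]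
        exact one_ne_zero)
    exact ⟨c, (hS c).2 ⟨by rw [← hc, Finsupp.degree_eq_sum], hcI⟩⟩
  obtain ⟨c, hcS, hmax⟩ := S.exists_max_image
    (fun c => ∑ i, c i * (n * (d - 1) + 1) ^ u i) hne
  obtain ⟨hdeg, hcI⟩ := (hS c).1 hcS
  refine ⟨c, hdeg, hcI, ?_⟩
  have key : ∀ v, 0 ≤ ∑ i with v < u i, ((c i : ℤ) - (d - 1 : ℕ)) := by
    intro v
    by_contra! hlt
    set T : Finset (Fin n) := Finset.univ.filter fun i => v < u i with hT
    have hTn : T.card ≤ n := by simpa using T.card_le_univ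
    have hlt' : ∑ i ∈ T, c i < T.card * (d - 1) := by
      rw [Finset.sum_sub_distrib, Finset.sum_const, nsmul_eq_mul] at hlt
      zify
      linarith
    have htail : (n - T.card) * (d - 1) < (c.filter (· ∉ T)).degree := by
      have h1 : (c.filter (· ∈ T)).degree = ∑ i ∈ T, c i := by
        simp [Finsupp.degree_eq_sum, Finsupp.filter_apply]
      have h2 : (c.filter (· ∈ T)).degree + (c.filter (· ∉ T)).degree = n * (d - 1) := by
        rw [← map_add, Finsupp.filter_add_filter_not, Finsupp.degree_eq_sum, hdeg]
      have h3 : (n - T.card) * (d - 1) + T.card * (d - 1) = n * (d - 1) := by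
        rw [← add_mul, Nat.sub_add_cancel hTn]
      omega
    obtain ⟨c', hc'deg, hc'I, hle, i, hiT, hi⟩ := BalancedCI.exists_exchange
      (BalancedCI.isHomogeneous_span_range hhom) (T := T) hcI
      (BalancedCI.mem_span_sup_varIdeal hd0 hhom hreg T htail (isHomogeneous_monomial _ rfl))
    have hc'S : c' ∈ S := (hS c').2 ⟨by
      rw [← hdeg, ← Finsupp.degree_eq_sum, hc'deg, Finsupp.degree_eq_sum], hc'I⟩
    refine (hmax c' hc'S).not_gt (BalancedCI.sum_mul_pow_lt (v := v) hdeg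
      (fun i hi => hle i (by simpa [hT] using hi)) ⟨i, by simpa [hT] using hiT, hi⟩)
  have hsum := BalancedCI.sum_mul_nonneg_of_superlevel key
  have hdegZ : ∑ i, (c i : ℤ) = n * (d - 1 : ℕ) := by exact_mod_cast hdeg
  have : ∑ i, (u i : ℤ) * ((c i : ℤ) - (d - 1 : ℕ)) = ∑ i, w i * (c i : ℤ) := by
    have : ∀ i, (u i : ℤ) * ((c i : ℤ) - (d - 1 : ℕ)) =
        w i * c i - w i * (d - 1 : ℕ) + M * (c i : ℤ) - M * (d - 1 : ℕ) := by
      intro i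
      rw [hu]
      ring
    simp_rw [this]
    rw [Finset.sum_sub_distrib, Finset.sum_add_distrib, Finset.sum_sub_distrib, ← Finset.sum_mul,
      hwsum, ← Finset.mul_sum, hdegZ, Finset.sum_const, Finset.card_univ, Fintype.card_fin,
      nsmul_eq_mul]
    ring
  rwa [this] at hsum
end

section
/- (Grevlex Lemma) Let I ⊆ S be a homogeneous ideal that is generated by its degree-d component I_d (d ≥ 2) and satisfies dim_k S/I < ∞. Fix 1 ≤ a ≤ n and N ≥ 0, and suppose that some monomial x_1^{c_1}⋯x_n^{c_n} of total degree n(d−1) with c_{a+1} + … + c_n ≥ N does not lie in I. Let M = x_1^{d_1}⋯x_n^{d_n} be the smallest, with respect to the graded reverse lexicographic order, monomial of total degree n(d−1) satisfying d_{a+1} + … + d_n ≥ N that does not lie in I. Then for every 1 ≤ i ≤ a one has d_1 + … + d_i ≤ i(d−1). In particular (taking a = n, N = 0), if M = x_1^{d_1}⋯x_n^{d_n} is the grevlex-smallest monomial of total degree n(d−1) not lying in I, then d_1 + … + d_i ≤ i(d−1) for all 1 ≤ i ≤ n. -/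
open MvPolynomial

/-- Graded reverse lexicographic order on exponent vectors: `c <_grevlex e` iff the
total degree of `c` is smaller, or the total degrees agree and the last nonzero entry
of `c - e` is positive. -/
def GrevlexLT {n : ℕ} (c e : Fin n →₀ ℕ) : Prop :=
  (∑ i, c i) < (∑ i, e i) ∨
    ((∑ i, c i) = (∑ i, e i) ∧ ∃ j : Fin n, e j < c j ∧ ∀ i : Fin n, j < i → c i = e i)

section RegularSequences

variable {σ k : Type*} [Field k]

attribute [local instance] MvPolynomial.gradedAlgebra

theorem homogeneousComponent_mul_of_isHomogeneous_left {f : MvPolynomial σ k} {d : ℕ}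
    (hf : f.IsHomogeneous d) (b : MvPolynomial σ k) (t : ℕ) :
    homogeneousComponent (d + t) (f * b) = f * homogeneousComponent t b := by
  have h := DirectSum.coe_decompose_mul_add_of_left_mem (homogeneousSubmodule σ k) (b := b)
    (j := t) hf
  have key (φ : MvPolynomial σ k) (i : ℕ) :
      (DirectSum.decompose (homogeneousSubmodule σ k) φ i : MvPolynomial σ k) =
        homogeneousComponent i φ := decomposition.decompose'_apply φ i
  rwa [key, key] at h

theorem exists_homogeneous_sub_mul_mem {Q : Ideal (MvPolynomial σ k)}
    (hQ : Q.IsHomogeneous (homogeneousSubmodule σ k)) {f p : MvPolynomial σ k} {d t : ℕ}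
    (hf : f.IsHomogeneous d) (hp : p.IsHomogeneous (d + t)) (h : p ∈ Q ⊔ Ideal.span {f}) :
    ∃ b : MvPolynomial σ k, b.IsHomogeneous t ∧ p - f * b ∈ Q := by
  obtain ⟨q, hq, r, hr, rfl⟩ := Submodule.mem_sup.mp h
  obtain ⟨b, rfl⟩ := Ideal.mem_span_singleton'.mp hr
  refine ⟨homogeneousComponent t b, homogeneousComponent_isHomogeneous t b, ?_⟩
  rw [← homogeneousComponent_mul_of_isHomogeneous_left hf, ← homogeneousComponent_eq_self hp,
    ← map_sub]
  refine homogeneousComponent_mem_of_mem hQ ?_ _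
  simpa [mul_comm f b] using hq

/-- If `Q + (x)` contains all forms of degree larger than `s`, where `x` is a linear form, and
`f` is a form of degree `d` that is regular modulo `Q`, then `Q + (f)` contains all forms of
degree at least `s + d`. -/
theorem mem_sup_span_singleton_of_isSMulRegular [Finite σ] {Q : Ideal (MvPolynomial σ k)}
    (hQ : Q.IsHomogeneous (homogeneousSubmodule σ k)) {x f : MvPolynomial σ k} {d s : ℕ}
    (hx : x.IsHomogeneous 1) (hf : f.IsHomogeneous d)
    (hreg : IsSMulRegular (MvPolynomial σ k ⧸ Q) f)
    (h : ∀ t, s < t → ∀ p : MvPolynomial σ k, p.IsHomogeneous t → p ∈ Q ⊔ Ideal.span {x})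
    {t : ℕ} (ht : s ≤ t) {p : MvPolynomial σ k} (hp : p.IsHomogeneous (d + t)) :
    p ∈ Q ⊔ Ideal.span {f} := by
  let π : MvPolynomial σ k →ₗ[k] MvPolynomial σ k ⧸ Q := (Ideal.Quotient.mkₐ k Q).toLinearMap
  have hπ (a b : MvPolynomial σ k) : π a = π b ↔ a - b ∈ Q := Ideal.Quotient.eq
  have hπm (a b : MvPolynomial σ k) : π (a * b) = π a * π b := map_mul (Ideal.Quotient.mk Q) a b
  let V (t : ℕ) : Submodule k (MvPolynomial σ k ⧸ Q) := (homogeneousSubmodule σ k t).map π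
  have hfin (t : ℕ) : FiniteDimensional k (homogeneousSubmodule σ k t) :=
    Module.Finite.iff_fg.mpr (homogeneousSubmodule_fg σ k t)
  have hstep (t : ℕ) (ht : s ≤ t) : Module.finrank k (V (t + 1)) ≤ Module.finrank k (V t) := by
    have hle : V (t + 1) ≤ (V t).map (LinearMap.mulLeft k (π x)) := by
      rintro _ ⟨p, hp, rfl⟩
      have hp' : p.IsHomogeneous (1 + t) := by rw [add_comm]; exact hp
      obtain ⟨b, hb, hpb⟩ :=
        exists_homogeneous_sub_mul_mem hQ hx hp' (h (1 + t) (by omega) p hp')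
      exact ⟨π b, ⟨b, hb, rfl⟩, by rw [LinearMap.mulLeft_apply, ← hπm, eq_comm, hπ]; exact hpb⟩
    exact (Submodule.finrank_mono hle).trans (Submodule.finrank_map_le _ _)
  have hanti (e : ℕ) : Module.finrank k (V (e + t)) ≤ Module.finrank k (V t) := by
    induction e with
    | zero => rw [zero_add]
    | succ e ih =>
      rw [add_right_comm]
      exact (hstep (e + t) (by omega)).trans ih
  have hinj : Function.Injective (LinearMap.mulLeft k (π f)) := by
    intro a b hab
    obtain ⟨a, rfl⟩ := Ideal.Quotient.mk_surjective a
    obtain ⟨b, rfl⟩ := Ideal.Quotient.mk_surjective b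
    exact hreg hab
  have hle : (V t).map (LinearMap.mulLeft k (π f)) ≤ V (d + t) := by
    rintro _ ⟨_, ⟨b, hb, rfl⟩, rfl⟩
    exact ⟨f * b, hf.mul hb, by rw [hπm]; rfl⟩
  have heq := Submodule.eq_of_le_of_finrank_le hle ((hanti d).trans_eq
    (LinearEquiv.finrank_eq (Submodule.equivMapOfInjective _ hinj (V t))))
  obtain ⟨_, ⟨b, hb, rfl⟩, hbp⟩ := heq.ge ⟨p, hp, rfl⟩
  rw [LinearMap.mulLeft_apply, ← hπm, eq_comm, hπ] at hbp
  have := Submodule.add_mem_sup hbp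
    (Ideal.mul_mem_right b _ (Ideal.mem_span_singleton_self f))
  simpa using this

/-- If `f` is regular modulo `Q + (x)` and `x` is regular modulo `Q`, then `x` is regular modulo
`Q + (f)`. -/
theorem isSMulRegular_quotient_sup_span_singleton {R : Type*} [CommRing R] {Q : Ideal R} {x f : R}
    (hx : IsSMulRegular (R ⧸ Q) x) (hf : IsSMulRegular (R ⧸ (Q ⊔ Ideal.span {x})) f) :
    IsSMulRegular (R ⧸ (Q ⊔ Ideal.span {f})) x := by
  rw [isSMulRegular_quotient_iff_mem_of_smul_mem] at hx hf ⊢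
  intro a ha
  obtain ⟨q, hq, r, hr, hqr⟩ := Submodule.mem_sup.mp ha
  obtain ⟨b, rfl⟩ := Ideal.mem_span_singleton'.mp hr
  rw [smul_eq_mul] at hqr
  have hb : b ∈ Q ⊔ Ideal.span {x} := by
    refine hf b ?_
    rw [smul_eq_mul, show f * b = -q + a * x by linear_combination hqr]
    exact Submodule.add_mem_sup (Q.neg_mem hq) (Ideal.mul_mem_left _ _
      (Ideal.mem_span_singleton_self x))
  obtain ⟨q', hq', r', hr', rfl⟩ := Submodule.mem_sup.mp hb
  obtain ⟨c, rfl⟩ := Ideal.mem_span_singleton'.mp hr'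
  have hac : a - c * f ∈ Q := by
    refine hx _ ?_
    rw [smul_eq_mul, show x * (a - c * f) = q + q' * f by linear_combination -hqr]
    exact Q.add_mem hq (Q.mul_mem_right _ hq')
  have := Submodule.add_mem_sup hac (Ideal.mul_mem_left _ c (Ideal.mem_span_singleton_self f))
  simpa using this

/-- Prime avoidance for linear subspaces: a subspace `W` of the ring contains an element regular
modulo each of finitely many ideals `Q i`, provided for each `i` some element that is
nilpotent modulo the ideal generated by `W` is regular modulo `Q i`. -/
theorem exists_mem_forall_isSMulRegular {R ι : Type*} [CommRing R] [IsNoetherianRing R]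
    [Algebra k R] [Infinite k] [Finite ι] (W : Submodule k R) (Q : ι → Ideal R) (x : ι → R)
    (hx : ∀ i, IsSMulRegular (R ⧸ Q i) (x i))
    (hW : ∀ i, x i ∈ (Ideal.span (W : Set R)).radical) :
    ∃ f ∈ W, ∀ i, IsSMulRegular (R ⧸ Q i) f := by
  let A : Set (Ideal R) := ⋃ i, associatedPrimes R (R ⧸ Q i)
  have hA : A.Finite := Set.finite_iUnion fun i => associatedPrimes.finite R (R ⧸ Q i)
  let T : Set (Submodule k W) := (fun P : Ideal R => (P.restrictScalars k).comap W.subtype) '' A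
  have hT : T.Finite := hA.image _
  have htop : (⊤ : Submodule k W) ∉ hT.toFinset := by
    rw [Set.Finite.mem_toFinset]
    rintro ⟨P, hP, hPW⟩
    obtain ⟨i, hPi⟩ := Set.mem_iUnion.mp hP
    have hle : Ideal.span (W : Set R) ≤ P := by
      refine Ideal.span_le.mpr fun w hw => ?_
      have : (⟨w, hw⟩ : W) ∈ (P.restrictScalars k).comap W.subtype := by
        simp only at hPW
        rw [hPW]; trivial
      exact this
    have hxP : x i ∈ P := (IsAssociatedPrime.isPrime hPi).radical_le_iff.mpr hle (hW i)
    have hmem : x i ∈ ⋃ p ∈ associatedPrimes R (R ⧸ Q i), (p : Set R) :=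
      Set.mem_biUnion hPi hxP
    rw [biUnion_associatedPrimes_eq_compl_regular] at hmem
    exact hmem (hx i)
  obtain ⟨f, hf⟩ := (Set.ne_univ_iff_exists_notMem _).mp
    (Subspace.biUnion_ne_univ_of_top_notMem htop)
  refine ⟨f, f.2, fun i => ?_⟩
  by_contra hi
  have hmem : (f : R) ∈ ⋃ p ∈ associatedPrimes R (R ⧸ Q i), (p : Set R) := by
    rw [biUnion_associatedPrimes_eq_compl_regular]
    exact hi
  obtain ⟨P, hP, hfP⟩ := Set.mem_iUnion₂.mp hmem
  exact hf (Set.mem_biUnion (x := (P.restrictScalars k).comap W.subtype)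
    (by simpa using ⟨P, Set.mem_iUnion.mpr ⟨i, hP⟩, rfl⟩) hfP)

theorem isHomogeneous_span_X_image (s : Set σ) :
    (Ideal.span (X '' s : Set (MvPolynomial σ k))).IsHomogeneous (homogeneousSubmodule σ k) := by
  refine Ideal.homogeneous_span _ _ ?_
  rintro _ ⟨i, -, rfl⟩
  exact ⟨1, isHomogeneous_X k i⟩

theorem isSMulRegular_X_quotient_span_X_image {s : Set σ} {i : σ} (hi : i ∉ s) :
    IsSMulRegular (MvPolynomial σ k ⧸ Ideal.span (X '' s : Set (MvPolynomial σ k)))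
      (X i : MvPolynomial σ k) := by
  classical
  rw [isSMulRegular_quotient_iff_mem_of_smul_mem]
  intro a ha
  rw [mem_ideal_span_X_image] at ha ⊢
  intro m hm
  obtain ⟨l, hl, hml⟩ := ha (Finsupp.single i 1 + m) (by
    rw [smul_eq_mul, support_X_mul]
    simpa using hm)
  refine ⟨l, hl, ?_⟩
  have : i ≠ l := by rintro rfl; exact hi hl
  simpa [Finsupp.single_apply, this] using hml

/-- A homogeneous ideal with finite-dimensional quotient contains a power of each variable. -/
theorem X_mem_radical_of_finite_quotient {I : Ideal (MvPolynomial σ k)}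
    (hI : I.IsHomogeneous (homogeneousSubmodule σ k))
    (hfin : Module.Finite k (MvPolynomial σ k ⧸ I)) (i : σ) :
    (X i : MvPolynomial σ k) ∈ I.radical := by
  obtain ⟨p, hp, hp0⟩ := Algebra.IsIntegral.isIntegral (R := k)
    (Ideal.Quotient.mkₐ k I (X i : MvPolynomial σ k))
  have hmem : Polynomial.aeval (X i : MvPolynomial σ k) p ∈ I := by
    rw [← Ideal.Quotient.eq_zero_iff_mem, ← Ideal.Quotient.mkₐ_eq_mk k,
      ← Polynomial.aeval_algHom_apply]
    exact hp0
  refine ⟨p.natDegree, ?_⟩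
  have := homogeneousComponent_mem_of_mem hI hmem p.natDegree
  rw [Polynomial.aeval_eq_sum_range, map_sum, Finset.sum_eq_single p.natDegree] at this
  · rw [map_smul, homogeneousComponent_eq_self (isHomogeneous_X_pow i _)] at this
    simpa [hp.coeff_natDegree] using this
  · intro j _ hj
    rw [map_smul, homogeneousComponent_of_mem (isHomogeneous_X_pow i j), if_neg hj.symm, smul_zero]
  · simp

/-- Let `I` be an ideal generated by forms of degree `d` with finite-dimensional quotient. For each
`j ≤ i`, the ideal generated by the variables of index at least `i` can be enlarged by `j` forms of
degree `d` in `I` to an ideal `F` modulo which the first `i - j` variables form a regular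
sequence, and all forms of degree larger than `j * (d - 1)` lie in the sum of `F` and the ideal of
these variables. -/
theorem exists_ideal_regular_variables [Infinite k] {n d : ℕ} (hd : 1 ≤ d)
    {I : Ideal (MvPolynomial (Fin n) k)}
    (hgen : I = Ideal.span {p | p ∈ I ∧ p.IsHomogeneous d})
    (hrad : ∀ l : Fin n, (X l : MvPolynomial (Fin n) k) ∈ I.radical)
    {i : ℕ} (hi : i ≤ n) (j : ℕ) (hj : j ≤ i) :
    ∃ F : Ideal (MvPolynomial (Fin n) k), F.IsHomogeneous (homogeneousSubmodule (Fin n) k) ∧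
      F ≤ I ⊔ Ideal.span (X '' {l | i ≤ (l : ℕ)}) ∧
      (∀ l : Fin n, (l : ℕ) + j < i → IsSMulRegular
        (MvPolynomial (Fin n) k ⧸ (F ⊔ Ideal.span (X '' {m : Fin n | m < l})))
        (X l : MvPolynomial (Fin n) k)) ∧
      ∀ t, j * (d - 1) < t → ∀ p : MvPolynomial (Fin n) k, p.IsHomogeneous t →
        p ∈ F ⊔ Ideal.span (X '' {m : Fin n | (m : ℕ) + j < i}) := by
  induction j with
  | zero =>
    refine ⟨Ideal.span (X '' {l | i ≤ (l : ℕ)}), isHomogeneous_span_X_image _, le_sup_right,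
      fun l hl => ?_, fun t ht p hp => ?_⟩
    · rw [← Ideal.span_union, ← Set.image_union]
      refine isSMulRegular_X_quotient_span_X_image ?_
      simpa using hl
    · rw [← Ideal.span_union, ← Set.image_union, mem_ideal_span_X_image]
      intro m hm
      have hdeg : m.degree = t := by
        by_contra hne
        exact (mem_support_iff.mp hm) (hp.coeff_eq_zero hne)
      have hm0 : m ≠ 0 := by
        rintro rfl
        simp only [map_zero] at hdeg
        omega
      obtain ⟨l, hl⟩ := Finsupp.ne_iff.mp hm0
      exact ⟨l, by simpa using le_or_gt i l, hl⟩
  | succ j ih =>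
    obtain ⟨F, hF, hFI, hreg, hdeg⟩ := ih (by omega)
    let W : Submodule k (MvPolynomial (Fin n) k) :=
      I.restrictScalars k ⊓ homogeneousSubmodule (Fin n) k d
    have hWI : Ideal.span (W : Set (MvPolynomial (Fin n) k)) = I := hgen.symm
    obtain ⟨f, ⟨hfI, hfd⟩, hfreg⟩ := exists_mem_forall_isSMulRegular W
      (fun l : {l : Fin n // (l : ℕ) + j < i} =>
        F ⊔ Ideal.span (X '' {m : Fin n | m < l}))
      (fun l => X l.1) (fun l => hreg l.1 l.2) (fun l => by rw [hWI]; exact hrad l.1)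
    have hsucc (l : Fin n) : F ⊔ Ideal.span (X '' {m : Fin n | m < l}) ⊔ Ideal.span {X l} =
        F ⊔ Ideal.span (X '' {m : Fin n | m ≤ l} : Set (MvPolynomial (Fin n) k)) := by
      rw [sup_assoc, ← Ideal.span_union, ← Set.image_singleton, ← Set.image_union]
      congr 3
      ext m
      simp [le_iff_lt_or_eq, or_comm]
    refine ⟨F ⊔ Ideal.span {f}, hF.sup (Ideal.homogeneous_span _ _ ?_),
      sup_le hFI ((Ideal.span_singleton_le_iff_mem _).mpr (Ideal.mem_sup_left hfI)),
      fun l hl => ?_, fun t ht p hp => ?_⟩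
    · rintro _ rfl
      exact ⟨d, hfd⟩
    · rw [sup_right_comm]
      refine isSMulRegular_quotient_sup_span_singleton (hreg l (by omega)) ?_
      rw [hsucc]
      have hset : {m : Fin n | m ≤ l} = {m : Fin n | m < ⟨l + 1, by omega⟩} := by
        ext m
        simp only [Set.mem_ofPred_eq, Fin.le_def, Fin.lt_def, Nat.lt_succ_iff]
      rw [hset]
      exact hfreg ⟨⟨l + 1, by omega⟩, by simp only; omega⟩
    · let l : Fin n := ⟨i - (j + 1), by omega⟩
      have hset : {m : Fin n | (m : ℕ) + (j + 1) < i} = {m : Fin n | m < l} := by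
        ext m
        simp only [Set.mem_ofPred_eq, Fin.lt_def, l]
        omega
      have hset' : {m : Fin n | (m : ℕ) + j < i} = {m : Fin n | m ≤ l} := by
        ext m
        simp only [Set.mem_ofPred_eq, Fin.le_def, l]
        omega
      rw [hset, sup_right_comm]
      rw [hset', ← hsucc] at hdeg
      have htd : j * (d - 1) + d ≤ t := by
        rw [add_mul] at ht
        omega
      obtain ⟨u, rfl⟩ := Nat.exists_eq_add_of_le (le_of_add_le_right htd)
      exact mem_sup_span_singleton_of_isSMulRegular (hF.sup (isHomogeneous_span_X_image _))
        (isHomogeneous_X k l) hfd (hfreg ⟨l, by simp only [l]; omega⟩) hdeg (by omega) hp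

/-- An ideal generated by forms of degree `d` with finite-dimensional quotient contains, modulo the
variables of index at least `i`, all forms of degree larger than `i * (d - 1)`. -/
theorem mem_sup_span_X_image_of_isHomogeneous [Infinite k] {n d : ℕ} (hd : 1 ≤ d)
    {I : Ideal (MvPolynomial (Fin n) k)}
    (hgen : I = Ideal.span {p | p ∈ I ∧ p.IsHomogeneous d})
    (hrad : ∀ l : Fin n, (X l : MvPolynomial (Fin n) k) ∈ I.radical)
    {i t : ℕ} (hi : i ≤ n) (ht : i * (d - 1) < t) {p : MvPolynomial (Fin n) k}
    (hp : p.IsHomogeneous t) :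
    p ∈ I ⊔ Ideal.span (X '' {l : Fin n | i ≤ (l : ℕ)}) := by
  obtain ⟨F, -, hFI, -, hdeg⟩ := exists_ideal_regular_variables hd hgen hrad hi i le_rfl
  have := hdeg t ht p hp
  rw [show {m : Fin n | (m : ℕ) + i < i} = ∅ by ext; simp, Set.image_empty, Ideal.span_empty,
    sup_bot_eq] at this
  exact hFI this

end RegularSequences

/-- Grevlex Lemma: if `I` is a homogeneous ideal generated by its degree-`d` component
with `dim_k S/I < ∞`, `1 ≤ a ≤ n`, `N ≥ 0`, and `M = x^{d_1}⋯x^{d_n}` is the grevlex-smallest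
monomial of total degree `n(d-1)` with `d_{a+1}+…+d_n ≥ N` not lying in `I`, then
`d_1+…+d_i ≤ i(d-1)` for all `1 ≤ i ≤ a`. -/
theorem stmt2 {k : Type*} [Field k] [CharZero k] {n d : ℕ} (hd : 2 ≤ d)
    (I : Ideal (MvPolynomial (Fin n) k))
    (hgen : I = Ideal.span {p | p ∈ I ∧ p.IsHomogeneous d})
    (hfin : Module.Finite k (MvPolynomial (Fin n) k ⧸ I))
    (a N : ℕ) (ha1 : 1 ≤ a) (ha2 : a ≤ n)
    (M : Fin n →₀ ℕ)
    (hMdeg : (∑ i, M i) = n * (d - 1))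
    (hMtail : N ≤ ∑ i ∈ Finset.univ.filter fun i : Fin n => a ≤ (i : ℕ), M i)
    (hMI : monomial M (1 : k) ∉ I)
    (hMmin : ∀ c : Fin n →₀ ℕ, (∑ i, c i) = n * (d - 1) →
      (N ≤ ∑ i ∈ Finset.univ.filter fun i : Fin n => a ≤ (i : ℕ), c i) →
      monomial c (1 : k) ∉ I → ¬ GrevlexLT c M) :
    ∀ i : ℕ, 1 ≤ i → i ≤ a →
      (∑ j ∈ Finset.univ.filter fun j : Fin n => (j : ℕ) < i, M j) ≤ i * (d - 1) := by
  classical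
  intro i hi1 hia
  by_contra! hlt
  let _ := MvPolynomial.gradedAlgebra (σ := Fin n) (R := k)
  have hI : I.IsHomogeneous (homogeneousSubmodule (Fin n) k) := by
    rw [hgen]
    exact Ideal.homogeneous_span _ _ fun p hp => ⟨d, hp.2⟩
  let head : Fin n →₀ ℕ := M.filter fun j => (j : ℕ) < i
  let tail : Fin n →₀ ℕ := M.filter fun j => ¬ (j : ℕ) < i
  have hsplit : head + tail = M := M.filter_add_filter_not _
  have htail (l : Fin n) (hl : i ≤ (l : ℕ)) : tail l = M l :=
    Finsupp.filter_apply_pos _ _ (not_lt.mpr hl)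
  have hhead : head.degree = ∑ j ∈ Finset.univ.filter fun j : Fin n => (j : ℕ) < i, M j := by
    rw [Finsupp.degree_eq_sum, Finset.sum_filter]
    exact Finset.sum_congr rfl fun j _ => Finsupp.filter_apply _ _ _
  have hhom : (monomial head (1 : k)).IsHomogeneous head.degree := isHomogeneous_monomial 1 rfl
  obtain ⟨g, hg, h, hh, hgh⟩ := Submodule.mem_sup.mp
    (mem_sup_span_X_image_of_isHomogeneous (by omega) hgen
      (X_mem_radical_of_finite_quotient hI hfin) (hia.trans ha2) (hhead ▸ hlt) hhom)
  have hcomp := congrArg (homogeneousComponent head.degree) hgh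
  rw [map_add, homogeneousComponent_eq_self hhom] at hcomp
  have hg' := homogeneousComponent_mem_of_mem hI hg head.degree
  have hh' := homogeneousComponent_mem_of_mem (isHomogeneous_span_X_image _) hh head.degree
  have hhhom := homogeneousComponent_isHomogeneous head.degree h
  generalize homogeneousComponent head.degree g = g' at *
  generalize homogeneousComponent head.degree h = h' at *
  refine hMI ?_
  rw [← hsplit, ← one_mul (1 : k), ← monomial_mul, ← hcomp, add_mul]
  refine I.add_mem (I.mul_mem_right _ hg') ?_
  rw [h'.as_sum, Finset.sum_mul]
  refine I.sum_mem fun c hc => ?_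
  obtain ⟨l, hl, hcl⟩ := mem_ideal_span_X_image.mp hh' c hc
  have hcdeg : c.degree = head.degree := by
    by_contra hne
    exact (mem_support_iff.mp hc) (hhhom.coeff_eq_zero hne)
  have hdeg : ∑ j, (c + tail) j = n * (d - 1) := by
    rw [← Finsupp.degree_eq_sum, map_add, hcdeg, ← map_add, hsplit, Finsupp.degree_eq_sum, hMdeg]
  have hmem : monomial (c + tail) (1 : k) ∈ I := by
    by_contra hnot
    refine hMmin (c + tail) hdeg (hMtail.trans (Finset.sum_le_sum fun j hj => ?_)) hnot
      (Or.inr ⟨hdeg.trans hMdeg.symm, ?_⟩)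
    · rw [← htail j (hia.trans (Finset.mem_filter.mp hj).2), Finsupp.add_apply]
      exact Nat.le_add_left _ _
    · let B : Finset (Fin n) := Finset.univ.filter fun j => i ≤ (j : ℕ) ∧ c j ≠ 0
      have hB : B.Nonempty := ⟨l, by simpa [B] using ⟨hl, hcl⟩⟩
      have hmax := Finset.mem_filter.mp (B.max'_mem hB)
      refine ⟨B.max' hB, ?_, fun j hj => ?_⟩
      · rw [Finsupp.add_apply, htail _ hmax.2.1]
        have := hmax.2.2
        omega
      · have hij : i ≤ (j : ℕ) := hmax.2.1.trans (Fin.le_def.mp hj.le)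
        have hcj : c j = 0 := by
          by_contra hne
          exact absurd (B.le_max' j (by simpa [B] using ⟨hij, hne⟩)) (not_le.mpr hj)
        rw [Finsupp.add_apply, hcj, zero_add, htail j hij]
  rw [monomial_mul, mul_one, ← mul_one (coeff c h'), ← C_mul_monomial]
  exact I.mul_mem_left _ hmem
end

section
/- Let M = x_1^{d_1}⋯x_n^{d_n} be the smallest, with respect to the graded reverse lexicographic order, monomial of total degree n(d−1) that does not lie in I (it exists since dim_k (S/I)_{n(d−1)} = 1). Then w_1d_1 + … + w_nd_n = 0 and d_1 + … + d_a = a(d−1). -/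
open MvPolynomial

namespace MvPolynomial

variable {σ R : Type*} [CommRing R]

section DegreeLT

variable (σ R) in
/-- The polynomials all of whose monomials have total degree less than `q`. -/
noncomputable def degreeLT (q : ℕ) : Submodule R (MvPolynomial σ R) :=
  restrictSupport R {m | m.degree < q}

theorem mem_degreeLT {q : ℕ} {p : MvPolynomial σ R} :
    p ∈ degreeLT σ R q ↔ ∀ m, q ≤ m.degree → p.coeff m = 0 := by
  rw [degreeLT, mem_restrictSupport_iff]
  refine ⟨fun h m hm ↦ ?_, fun h m hm ↦ ?_⟩
  · by_contra hne
    have : m.degree < q := h (mem_support_iff.2 hne)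
    omega
  · by_contra hlt
    exact mem_support_iff.1 hm (h m (not_lt.1 hlt))

theorem degreeLT_mono {q r : ℕ} (h : q ≤ r) : degreeLT σ R q ≤ degreeLT σ R r :=
  fun _ hp ↦ mem_degreeLT.2 fun m hm ↦ mem_degreeLT.1 hp m (h.trans hm)

theorem eq_zero_of_mem_degreeLT_zero {p : MvPolynomial σ R} (hp : p ∈ degreeLT σ R 0) : p = 0 :=
  ext _ _ fun m ↦ mem_degreeLT.1 hp m (Nat.zero_le _)

theorem monomial_mem_degreeLT {q : ℕ} {m : σ →₀ ℕ} (hm : m.degree < q) (r : R) :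
    monomial m r ∈ degreeLT σ R q :=
  (monomial_mem_restrictSupport R).2 (Or.inl hm)

theorem IsHomogeneous.mul_mem_degreeLT {g p : MvPolynomial σ R} {d q : ℕ}
    (hg : g.IsHomogeneous d) (hp : p ∈ degreeLT σ R (q - d)) : g * p ∈ degreeLT σ R q := by
  classical
  refine mem_degreeLT.2 fun m hm ↦ ?_
  rw [coeff_mul]
  refine Finset.sum_eq_zero fun x hx ↦ ?_
  by_cases hgx : coeff x.1 g = 0
  · rw [hgx, zero_mul]
  · have h1 : x.1.degree = d := by
      by_contra hne
      exact hgx (hg.coeff_eq_zero hne)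
    have h2 : x.1.degree + x.2.degree = m.degree := by
      rw [← Finset.HasAntidiagonal.mem_antidiagonal.1 hx, map_add]
    rw [mem_degreeLT.1 hp x.2 (by omega), mul_zero]

theorem IsHomogeneous.coeff_mul_eq_zero {g p : MvPolynomial σ R} {d q : ℕ}
    (hg : g.IsHomogeneous d) (hp : ∀ m, m.degree < q - d → p.coeff m = 0) {m : σ →₀ ℕ}
    (hm : m.degree < q) : (g * p).coeff m = 0 := by
  classical
  rw [coeff_mul]
  refine Finset.sum_eq_zero fun x hx ↦ ?_
  by_cases hgx : coeff x.1 g = 0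
  · rw [hgx, zero_mul]
  · have h1 : x.1.degree = d := by
      by_contra hne
      exact hgx (hg.coeff_eq_zero hne)
    have h2 : x.1.degree + x.2.degree = m.degree := by
      rw [← Finset.HasAntidiagonal.mem_antidiagonal.1 hx, map_add]
    rw [hp x.2 (by omega), mul_zero]

/-- The part of a polynomial of total degree less than `q`. -/
noncomputable def truncDegree (q : ℕ) (p : MvPolynomial σ R) : MvPolynomial σ R :=
  ∑ i ∈ Finset.range q, homogeneousComponent i p

theorem coeff_truncDegree (q : ℕ) (p : MvPolynomial σ R) (m : σ →₀ ℕ) :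
    (truncDegree q p).coeff m = if m.degree < q then p.coeff m else 0 := by
  simp [truncDegree, coeff_sum, coeff_homogeneousComponent]

theorem truncDegree_mem_degreeLT (q : ℕ) (p : MvPolynomial σ R) :
    truncDegree q p ∈ degreeLT σ R q :=
  mem_degreeLT.2 fun m hm ↦ by rw [coeff_truncDegree, if_neg (not_lt.2 hm)]

attribute [local instance] MvPolynomial.gradedAlgebra in
/-- If `f` has degree less than `q` and lies in `I + (g)`, the coefficient of `g` can be chosen of
the expected degree. -/
theorem exists_mem_degreeLT_sub_mul_mem {I : Ideal (MvPolynomial σ R)}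
    (hI : I.IsHomogeneous (homogeneousSubmodule σ R)) {g f : MvPolynomial σ R} {d q : ℕ}
    (hg : g.IsHomogeneous d) (hf : f ∈ degreeLT σ R q) (hfI : f ∈ I ⊔ Ideal.span {g}) :
    ∃ b ∈ degreeLT σ R (q - d), f - g * b ∈ I := by
  obtain ⟨i, hi, z, hz, rfl⟩ := Submodule.mem_sup.1 hfI
  obtain ⟨b, rfl⟩ := Ideal.mem_span_singleton'.1 hz
  refine ⟨truncDegree (q - d) b, truncDegree_mem_degreeLT _ _, ?_⟩
  have key : i + b * g - g * truncDegree (q - d) b = truncDegree q i := by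
    have hgt := hg.mul_mem_degreeLT (truncDegree_mem_degreeLT (q - d) b)
    ext m
    rw [coeff_truncDegree]
    split_ifs with hm
    · have h0 := hg.coeff_mul_eq_zero (p := b - truncDegree (q - d) b) (q := q) (m := m)
        (fun m hm ↦ by rw [coeff_sub, coeff_truncDegree, if_pos hm, sub_self]) hm
      rw [show i + b * g - g * truncDegree (q - d) b = i + g * (b - truncDegree (q - d) b) by ring,
        coeff_add, h0, add_zero]
    · exact mem_degreeLT.1 (Submodule.sub_mem _ hf hgt) m (not_lt.1 hm)
  rw [key]
  exact Ideal.sum_mem _ fun j _ ↦ homogeneousComponent_mem_of_mem hI hi j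

theorem divMonomial_mem_degreeLT {p : MvPolynomial σ R} {q : ℕ} (y : σ)
    (hp : p ∈ degreeLT σ R q) :
    divMonomial p (Finsupp.single y 1) ∈ degreeLT σ R (q - 1) := by
  refine mem_degreeLT.2 fun m hm ↦ ?_
  rw [coeff_divMonomial]
  refine mem_degreeLT.1 hp _ ?_
  rw [map_add, Finsupp.degree_single]
  omega

theorem X_mul_divMonomial_of_ne {x y : σ} (hxy : x ≠ y) (p : MvPolynomial σ R) :
    divMonomial (X x * p) (Finsupp.single y 1) = X x * divMonomial p (Finsupp.single y 1) := by
  classical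
  ext m
  simp only [coeff_divMonomial, coeff_X_mul', Finsupp.mem_support_iff, Finsupp.add_apply,
    Finsupp.single_apply, if_neg hxy.symm, zero_add]
  split_ifs with h
  · congr 1
    ext z
    by_cases hz : x = z
    · subst hz
      simp [hxy.symm]
    · simp [Finsupp.single_apply, hz]
  · rfl

theorem sub_divMonomial (p q : MvPolynomial σ R) (s : σ →₀ ℕ) :
    divMonomial (p - q) s = divMonomial p s - divMonomial q s := by
  ext m
  simp [coeff_divMonomial]

end DegreeLT

section Koszul

/-- The index set of the standard basis of the Koszul complex on a list of variables:
subsets of the list. -/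
inductive KoszulIndex : List σ → Type _
  | nil : KoszulIndex []
  | take (i : σ) {L : List σ} : KoszulIndex L → KoszulIndex (i :: L)
  | skip (i : σ) {L : List σ} : KoszulIndex L → KoszulIndex (i :: L)

namespace KoszulIndex

/-- The homological degree of a basis element of the Koszul complex. -/
def size : {L : List σ} → KoszulIndex L → ℕ
  | _, nil => 0
  | _, take _ t => t.size + 1
  | _, skip _ t => t.size

theorem size_le : {L : List σ} → (t : KoszulIndex L) → t.size ≤ L.length
  | _, nil => le_rfl
  | _, take _ t => Nat.succ_le_succ t.size_le
  | _, skip _ t => Nat.le_succ_of_le t.size_le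

/-- The index of the basis element of top degree. -/
def full : (L : List σ) → KoszulIndex L
  | [] => nil
  | i :: L => take i (full L)

theorem size_full : (L : List σ) → (full L).size = L.length
  | [] => rfl
  | _ :: L => congrArg (· + 1) (size_full L)

theorem eq_full : {L : List σ} → (t : KoszulIndex L) → t.size = L.length → t = full L
  | _, nil, _ => rfl
  | _, take i t, h => congrArg (take i) (t.eq_full (Nat.succ.inj h))
  | _, skip _ t, h => absurd h (Nat.ne_of_lt (Nat.lt_succ_of_le t.size_le))

end KoszulIndex

open KoszulIndex

/-- The differential of the Koszul complex on a list of variables. -/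
noncomputable def koszulD : (L : List σ) → (KoszulIndex L → MvPolynomial σ R) →
    KoszulIndex L → MvPolynomial σ R
  | [], _, _ => 0
  | i :: L, a, take _ t => koszulD L (fun u ↦ a (take i u)) t
  | i :: L, a, skip _ t => X i * a (take i t) - koszulD L (fun u ↦ a (skip i u)) t

theorem koszulD_sub_mul (f : MvPolynomial σ R) : (L : List σ) →
    (a b : KoszulIndex L → MvPolynomial σ R) → (t : KoszulIndex L) →
    koszulD L (fun u ↦ a u - f * b u) t = koszulD L a t - f * koszulD L b t
  | [], _, _, _ => by simp [koszulD]
  | i :: L, a, b, take _ t => by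
    simp only [koszulD]
    exact koszulD_sub_mul f L _ _ t
  | i :: L, a, b, skip _ t => by
    simp only [koszulD]
    rw [koszulD_sub_mul f L _ _ t]
    ring

theorem koszulD_sub (L : List σ) (a b : KoszulIndex L → MvPolynomial σ R) (t : KoszulIndex L) :
    koszulD L (fun u ↦ a u - b u) t = koszulD L a t - koszulD L b t := by
  simpa using koszulD_sub_mul 1 L a b t

theorem koszulD_zero (L : List σ) (t : KoszulIndex L) :
    koszulD L (fun _ ↦ (0 : MvPolynomial σ R)) t = 0 := by
  simpa using koszulD_sub L (fun _ ↦ (0 : MvPolynomial σ R)) (fun _ ↦ 0) t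

theorem koszulD_neg (L : List σ) (a : KoszulIndex L → MvPolynomial σ R) (t : KoszulIndex L) :
    koszulD L (fun u ↦ -a u) t = -koszulD L a t := by
  simpa [koszulD_zero] using koszulD_sub L (fun _ ↦ 0) a t

theorem koszulD_mul (f : MvPolynomial σ R) (L : List σ)
    (a : KoszulIndex L → MvPolynomial σ R) (t : KoszulIndex L) :
    koszulD L (fun u ↦ f * a u) t = f * koszulD L a t := by
  simpa [koszulD_zero, koszulD_neg] using koszulD_sub_mul f L (fun _ ↦ 0) a t

theorem koszulD_koszulD : (L : List σ) → (a : KoszulIndex L → MvPolynomial σ R) →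
    (t : KoszulIndex L) → koszulD L (koszulD L a) t = 0
  | [], _, _ => by simp only [koszulD]
  | i :: L, a, take _ t => by
    simp only [koszulD]
    exact koszulD_koszulD L _ t
  | i :: L, a, skip _ t => by
    simp only [koszulD]
    rw [koszulD_sub, koszulD_mul, koszulD_koszulD L _ t]
    ring

theorem koszulD_mem (J : Ideal (MvPolynomial σ R)) : (L : List σ) →
    (a : KoszulIndex L → MvPolynomial σ R) → (∀ t, a t ∈ J) → (t : KoszulIndex L) →
    koszulD L a t ∈ J
  | [], _, _, _ => by simp only [koszulD, J.zero_mem]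
  | i :: L, a, h, take _ t => by
    simp only [koszulD]
    exact koszulD_mem J L _ (fun _ ↦ h _) t
  | i :: L, a, h, skip _ t => by
    simp only [koszulD]
    exact J.sub_mem (J.mul_mem_left _ (h _)) (koszulD_mem J L _ (fun _ ↦ h _) t)

theorem koszulD_mem_degreeLT {q : ℕ} : (L : List σ) →
    (a : KoszulIndex L → MvPolynomial σ R) → (∀ t, a t ∈ degreeLT σ R q) → (t : KoszulIndex L) →
    koszulD L a t ∈ degreeLT σ R (q + 1)
  | [], _, _, _ => by simp only [koszulD, Submodule.zero_mem]
  | i :: L, a, h, take _ t => by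
    simp only [koszulD]
    exact koszulD_mem_degreeLT L _ (fun _ ↦ h _) t
  | i :: L, a, h, skip _ t => by
    simp only [koszulD]
    exact Submodule.sub_mem _ ((isHomogeneous_X R i).mul_mem_degreeLT (h _))
      (koszulD_mem_degreeLT L _ (fun _ ↦ h _) t)

/-- The chains of homological degree `s` in the Koszul complex whose coefficients have degree
less than `q`. -/
def IsKoszulChain {L : List σ} (s q : ℕ) (a : KoszulIndex L → MvPolynomial σ R) : Prop :=
  (∀ t, t.size ≠ s → a t = 0) ∧ ∀ t, a t ∈ degreeLT σ R q

theorem koszulD_eq_zero_of_size_ne : (L : List σ) → (s : ℕ) →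
    (a : KoszulIndex L → MvPolynomial σ R) → (∀ t, t.size ≠ s → a t = 0) →
    (t : KoszulIndex L) → t.size + 1 ≠ s → koszulD L a t = 0
  | [], _, _, _, _, _ => by simp only [koszulD]
  | i :: L, 0, a, h, take _ t, _ => by
    have h0 (u : KoszulIndex L) : a (take i u) = 0 := h _ (Nat.succ_ne_zero _)
    simp only [koszulD, h0, koszulD_zero]
  | i :: L, s + 1, a, h, take _ t, ht => by
    simp only [koszulD]
    exact koszulD_eq_zero_of_size_ne L s _ (fun u hu ↦ h (take i u) fun h' ↦ hu (Nat.succ.inj h')) t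
      fun h' ↦ ht (congrArg (· + 1) h')
  | i :: L, s, a, h, skip _ t, ht => by
    simp only [koszulD]
    rw [h (take i t) ht, mul_zero, zero_sub, neg_eq_zero]
    exact koszulD_eq_zero_of_size_ne L s _ (fun u hu ↦ h _ hu) t ht

theorem koszulD_divMonomial (y : σ) : (L : List σ) → y ∉ L →
    (a : KoszulIndex L → MvPolynomial σ R) → (t : KoszulIndex L) →
    koszulD L (fun u ↦ divMonomial (a u) (Finsupp.single y 1)) t =
      divMonomial (koszulD L a t) (Finsupp.single y 1)
  | [], _, _, _ => by simp [koszulD]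
  | i :: L, hy, a, take _ t => by
    simp only [koszulD]
    exact koszulD_divMonomial y L (fun h ↦ hy (List.mem_cons_of_mem _ h)) _ t
  | i :: L, hy, a, skip _ t => by
    simp only [koszulD]
    rw [koszulD_divMonomial y L (fun h ↦ hy (List.mem_cons_of_mem _ h)), sub_divMonomial,
      X_mul_divMonomial_of_ne fun (h : i = y) ↦ hy (h ▸ List.mem_cons_self)]

/-- The Koszul complex on distinct variables is exact in positive homological degrees. -/
theorem exists_koszulD_eq {q : ℕ} : (L : List σ) → L.Nodup → (s : ℕ) →
    (a : KoszulIndex L → MvPolynomial σ R) → IsKoszulChain (s + 1) q a →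
    (∀ t, koszulD L a t = 0) →
    ∃ c : KoszulIndex L → MvPolynomial σ R, IsKoszulChain (s + 2) (q - 1) c ∧
      ∀ t, koszulD L c t = a t
  | [], _, s, a, ha, _ => by
    refine ⟨fun _ ↦ 0, ⟨fun _ _ ↦ rfl, fun _ ↦ Submodule.zero_mem _⟩, fun t ↦ ?_⟩
    cases t
    rw [koszulD_zero, ha.1 nil (Nat.succ_ne_zero s).symm]
  | x :: L, hL, s, a, ha, hd => by
    obtain ⟨hx, hL⟩ := List.nodup_cons.1 hL
    have hxa (t : KoszulIndex L) : X x * a (take x t) = koszulD L (fun u ↦ a (skip x u)) t :=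
      sub_eq_zero.1 (by simpa only [koszulD] using hd (skip x t))
    set c : KoszulIndex L → MvPolynomial σ R :=
      fun u ↦ divMonomial (a (skip x u)) (Finsupp.single x 1) with hc
    have hc0 (u : KoszulIndex L) (hu : u.size ≠ s + 1) : c u = 0 := by
      simp only [hc, ha.1 (skip x u) hu, zero_divMonomial]
    have hcq (u : KoszulIndex L) : c u ∈ degreeLT σ R (q - 1) :=
      divMonomial_mem_degreeLT x (ha.2 _)
    have hcd (t : KoszulIndex L) : koszulD L c t = a (take x t) := by
      rw [hc, koszulD_divMonomial x L hx, ← hxa, X_mul_divMonomial]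
    obtain ⟨e, he, hed⟩ := exists_koszulD_eq (q := q) L hL s
      (fun u ↦ a (skip x u) - X x * c u)
      ⟨fun u hu ↦ by simp only [ha.1 (skip x u) hu, hc0 u hu, mul_zero, sub_zero],
        fun u ↦ Submodule.sub_mem _ (ha.2 _) ((isHomogeneous_X R x).mul_mem_degreeLT (hcq u))⟩
      fun t ↦ by rw [koszulD_sub_mul, ← hxa, hcd, sub_self]
    refine ⟨fun
      | take _ u => c u
      | skip _ u => -e u, ⟨?_, ?_⟩, ?_⟩
    · rintro (_ | ⟨_, u⟩ | ⟨_, u⟩) hu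
      · exact hc0 u fun h ↦ hu (congrArg (· + 1) h)
      · exact neg_eq_zero.2 (he.1 u hu)
    · rintro (_ | ⟨_, u⟩ | ⟨_, u⟩)
      · exact hcq u
      · exact Submodule.neg_mem _ (he.2 u)
    · rintro (_ | ⟨_, u⟩ | ⟨_, u⟩)
      · simp only [koszulD]
        exact hcd u
      · simp only [koszulD, koszulD_neg, hed]
        ring

attribute [local instance] MvPolynomial.gradedAlgebra in
/-- The Koszul complex on distinct variables, with coefficients modulo a regular sequence of forms
of degree `d`, is exact at chains of homological degree `s` and degree less than `s (d - 1)`. -/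
theorem exists_sub_koszulD_mem {L : List σ} (hL : L.Nodup) {d : ℕ} (hd : 0 < d)
    {rs : List (MvPolynomial σ R)} (hhom : ∀ g ∈ rs, g.IsHomogeneous d)
    (hreg : RingTheory.Sequence.IsWeaklyRegular (MvPolynomial σ R) rs) (m : ℕ)
    (hm : m ≤ rs.length) (s q : ℕ) (hq : q ≤ s * (d - 1))
    (a : KoszulIndex L → MvPolynomial σ R) (ha : IsKoszulChain s q a)
    (hda : ∀ t, koszulD L a t ∈ Ideal.ofList (rs.take m)) :
    ∃ c : KoszulIndex L → MvPolynomial σ R, IsKoszulChain (s + 1) (q - 1) c ∧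
      ∀ t, a t - koszulD L c t ∈ Ideal.ofList (rs.take m) := by
  classical
  induction m generalizing s q a with
  | zero =>
    obtain _ | s := s
    · obtain rfl : q = 0 := by simpa using hq
      refine ⟨fun _ ↦ 0, ⟨fun _ _ ↦ rfl, fun _ ↦ Submodule.zero_mem _⟩, fun t ↦ ?_⟩
      rw [koszulD_zero, eq_zero_of_mem_degreeLT_zero (ha.2 t), sub_zero]
      exact Ideal.zero_mem _
    · obtain ⟨c, hc, hca⟩ := exists_koszulD_eq L hL s a ha fun t ↦ by simpa using hda t
      exact ⟨c, hc, fun t ↦ by rw [hca, sub_self]; exact Ideal.zero_mem _⟩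
  | succ m ih =>
    obtain _ | s := s
    · obtain rfl : q = 0 := by simpa using hq
      refine ⟨fun _ ↦ 0, ⟨fun _ _ ↦ rfl, fun _ ↦ Submodule.zero_mem _⟩, fun t ↦ ?_⟩
      rw [koszulD_zero, eq_zero_of_mem_degreeLT_zero (ha.2 t), sub_zero]
      exact Ideal.zero_mem _
    have hm' : m < rs.length := hm
    specialize ih hm'.le
    set I : Ideal (MvPolynomial σ R) := Ideal.ofList (rs.take m) with hI
    set g := rs[m] with hgdef
    have hg : g.IsHomogeneous d := hhom g (List.getElem_mem hm')
    have hsucc : Ideal.ofList (rs.take (m + 1)) = I ⊔ Ideal.span {g} := by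
      rw [List.take_succ_eq_append_getElem hm', Ideal.ofList_append, Ideal.ofList_singleton]
    have hIhom : I.IsHomogeneous (homogeneousSubmodule σ R) :=
      Ideal.homogeneous_span _ _ fun x hx ↦ ⟨d, hhom x (List.mem_of_mem_take hx)⟩
    have hgI (p : MvPolynomial σ R) (hp : g * p ∈ I) : p ∈ I := by
      have := (isSMulRegular_quotient_iff_mem_of_smul_mem _ _).1 (hreg.regular_mod_prev m hm') p
      simpa using this (by simpa using hp)
    simp only [hsucc] at hda ⊢
    have hex (t : KoszulIndex L) : ∃ b ∈ degreeLT σ R (q + 1 - d),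
        koszulD L a t - g * b ∈ I ∧ (t.size ≠ s → b = 0) := by
      by_cases ht : t.size = s
      · obtain ⟨b, hb, hbI⟩ := exists_mem_degreeLT_sub_mul_mem hIhom hg
          (koszulD_mem_degreeLT L a ha.2 t) (hda t)
        exact ⟨b, hb, hbI, fun h ↦ absurd ht h⟩
      · refine ⟨0, Submodule.zero_mem _, ?_, fun _ ↦ rfl⟩
        rw [koszulD_eq_zero_of_size_ne L _ a ha.1 t fun h ↦ ht (Nat.succ.inj h), mul_zero, sub_zero]
        exact I.zero_mem
    choose b hbq hbI hb0 using hex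
    obtain ⟨c, hc, hcI⟩ := ih s (q + 1 - d)
      (by
        obtain ⟨e, rfl⟩ : ∃ e, d = e + 1 := ⟨d - 1, by omega⟩
        rw [Nat.add_sub_cancel, Nat.succ_mul] at hq
        rw [Nat.add_sub_cancel]
        omega) b ⟨hb0, hbq⟩
      fun t ↦ hgI _ (by
        have := koszulD_mem I L _ hbI t
        rwa [koszulD_sub_mul, koszulD_koszulD, zero_sub, neg_mem_iff] at this)
    obtain ⟨c', hc', hcI'⟩ := ih (s + 1) q hq (fun t ↦ a t - g * c t)
      ⟨fun t ht ↦ by simp only [ha.1 t ht, hc.1 t ht, mul_zero, sub_zero],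
        fun t ↦ Submodule.sub_mem _ (ha.2 t)
          (hg.mul_mem_degreeLT (degreeLT_mono (by omega) (hc.2 t)))⟩
      fun t ↦ by
        rw [koszulD_sub_mul]
        convert I.add_mem (hbI t) (I.mul_mem_left g (hcI t)) using 1
        ring
    refine ⟨c', hc', fun t ↦ ?_⟩
    convert Ideal.add_mem _ (Ideal.mem_sup_left (hcI' t) : _ ∈ I ⊔ Ideal.span {g})
      (Ideal.mem_sup_right (Ideal.mul_mem_right (c t) _ (Ideal.mem_span_singleton_self g))) using 1
    ring

theorem koszulD_full_mem {J : Ideal (MvPolynomial σ R)} {f : MvPolynomial σ R} :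
    (L : List σ) → (∀ i ∈ L, X i * f ∈ J) → (a : KoszulIndex L → MvPolynomial σ R) →
    (∀ t, t.size ≠ L.length → a t = 0) → a (full L) = f → (t : KoszulIndex L) →
    koszulD L a t ∈ J
  | [], _, _, _, _, _ => by simp only [koszulD, J.zero_mem]
  | i :: L, h, a, h0, hf, take _ t => by
    simp only [koszulD]
    exact koszulD_full_mem L (fun j hj ↦ h j (List.mem_cons_of_mem _ hj)) _
      (fun u hu ↦ h0 (take i u) fun h' ↦ hu (Nat.succ.inj h')) hf t
  | i :: L, h, a, h0, hf, skip _ t => by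
    have hs (u : KoszulIndex L) : a (skip i u) = 0 :=
      h0 (skip i u) (Nat.ne_of_lt (Nat.lt_succ_of_le u.size_le))
    simp only [koszulD, hs, koszulD_zero, sub_zero]
    by_cases ht : t.size = L.length
    · rw [t.eq_full ht]
      exact (congrArg (X i * ·) hf : X i * a (take i (full L)) = X i * f) ▸ h i List.mem_cons_self
    · rw [h0 (take i t) fun h' ↦ ht (Nat.succ.inj h'), mul_zero]
      exact J.zero_mem

/-- Modulo a regular sequence of forms of degree `d`, a polynomial of degree less than `r (d - 1)`
that is killed by `r` distinct variables vanishes. -/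
theorem mem_ofList_of_X_mul_mem {L : List σ} (hL : L.Nodup) {d : ℕ} (hd : 0 < d)
    {rs : List (MvPolynomial σ R)} (hhom : ∀ g ∈ rs, g.IsHomogeneous d)
    (hreg : RingTheory.Sequence.IsWeaklyRegular (MvPolynomial σ R) rs)
    {f : MvPolynomial σ R} (hf : f ∈ degreeLT σ R (L.length * (d - 1)))
    (hX : ∀ i ∈ L, X i * f ∈ Ideal.ofList rs) : f ∈ Ideal.ofList rs := by
  classical
  have h0 (t : KoszulIndex L) (ht : t.size ≠ L.length) : (if t = full L then f else 0) = 0 :=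
    if_neg fun h : t = full L ↦ ht (h ▸ size_full L)
  obtain ⟨c, hc, hcI⟩ := exists_sub_koszulD_mem hL hd hhom hreg rs.length le_rfl L.length _ le_rfl
    (fun t ↦ if t = full L then f else 0)
    ⟨h0, fun t ↦ by
      dsimp only
      split_ifs
      exacts [hf, Submodule.zero_mem _]⟩
    (koszulD_full_mem L (by simpa using hX) _ h0 (if_pos rfl))
  have hc0 : c = fun _ ↦ 0 :=
    _root_.funext fun t ↦ hc.1 t (Nat.ne_of_lt (Nat.lt_succ_of_le t.size_le))
  simpa [hc0, koszulD_zero] using hcI (full L)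

end Koszul

theorem sum_mul_nonneg_of_monotone_of_nonneg {n : ℕ} {w e : Fin n → ℤ} (hw : Monotone w)
    (hw0 : ∀ i, 0 ≤ w i)
    (he : ∀ b : ℕ, 0 ≤ ∑ j ∈ Finset.univ.filter fun j : Fin n ↦ b ≤ (j : ℕ), e j) :
    0 ≤ ∑ i, w i * e i := by
  induction n with
  | zero => simp
  | succ n ih =>
    have h := ih (w := fun i ↦ w i.succ - w 0) (e := fun i ↦ e i.succ)
      (fun i j hij ↦ sub_le_sub_right (hw (Fin.succ_le_succ_iff.2 hij)) _)
      (fun i ↦ sub_nonneg.2 (hw (Fin.zero_le _)))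
      fun b ↦ by simpa [Finset.sum_filter, Fin.sum_univ_succ] using he (b + 1)
    have h0 : 0 ≤ e 0 + ∑ i : Fin n, e i.succ := by
      simpa [Fin.sum_univ_succ] using he 0
    have := mul_nonneg (hw0 0) h0
    simp only [sub_mul, Finset.sum_sub_distrib, ← Finset.mul_sum] at h
    rw [Fin.sum_univ_succ]
    linarith

/-- Abel summation: a monotone weight pairs nonnegatively with a vector of total sum zero whose
tail sums are nonnegative. -/
theorem sum_mul_nonneg_of_monotone {n : ℕ} {w e : Fin n → ℤ} (hw : Monotone w)
    (he : ∀ b : ℕ, 0 ≤ ∑ j ∈ Finset.univ.filter fun j : Fin n ↦ b ≤ (j : ℕ), e j)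
    (he0 : ∑ i, e i = 0) : 0 ≤ ∑ i, w i * e i := by
  obtain _ | n := n
  · simp
  have h := sum_mul_nonneg_of_monotone_of_nonneg (w := fun i ↦ w i - w 0)
    (fun i j hij ↦ sub_le_sub_right (hw hij) _) (fun i ↦ sub_nonneg.2 (hw (Fin.zero_le _))) he
  simpa [sub_mul, Finset.sum_sub_distrib, ← Finset.mul_sum, he0] using h

section Monomials

variable {R : Type*} [CommRing R] {n d : ℕ} {g : Fin n → MvPolynomial (Fin n) R}

theorem mem_span_range_of_X_mul_mem (hd : 0 < d) (hhom : ∀ i, (g i).IsHomogeneous d)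
    (hreg : RingTheory.Sequence.IsWeaklyRegular (MvPolynomial (Fin n) R) (List.ofFn g))
    (s : Finset (Fin n)) {f : MvPolynomial (Fin n) R}
    (hf : f ∈ degreeLT (Fin n) R (s.card * (d - 1)))
    (hX : ∀ i ∈ s, X i * f ∈ Ideal.span (Set.range g)) : f ∈ Ideal.span (Set.range g) := by
  have hI : Ideal.ofList (List.ofFn g) = Ideal.span (Set.range g) :=
    congrArg Ideal.span (Set.ext fun x ↦ by simp [List.mem_ofFn])
  rw [← hI] at hX ⊢
  refine mem_ofList_of_X_mul_mem s.nodup_toList hd (fun p hp ↦ ?_) hreg (by simpa using hf)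
    (by simpa using hX)
  obtain ⟨i, rfl⟩ := List.mem_ofFn.1 hp
  exact hhom i

/-- A monomial of degree at most `n (d - 1)` lies in `I` as soon as all its multiples of degree
`n (d - 1)` do. -/
theorem monomial_mem_of_forall_le (hd : 0 < d) (hhom : ∀ i, (g i).IsHomogeneous d)
    (hreg : RingTheory.Sequence.IsWeaklyRegular (MvPolynomial (Fin n) R) (List.ofFn g))
    {c : Fin n →₀ ℕ} (hc : c.degree ≤ n * (d - 1))
    (h : ∀ e, c ≤ e → e.degree = n * (d - 1) →
      monomial e (1 : R) ∈ Ideal.span (Set.range g)) :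
    monomial c (1 : R) ∈ Ideal.span (Set.range g) := by
  obtain ⟨k, hk⟩ := Nat.exists_eq_add_of_le hc
  induction k generalizing c with
  | zero => exact h c le_rfl (by omega)
  | succ k ih =>
    refine mem_span_range_of_X_mul_mem hd hhom hreg Finset.univ
      (monomial_mem_degreeLT (by rw [Finset.card_fin]; omega) 1) fun i _ ↦ ?_
    have hdeg : (Finsupp.single i 1 + c).degree = c.degree + 1 := by
      rw [map_add, Finsupp.degree_single, add_comm]
    rw [X, monomial_mul, one_mul]
    exact ih (by omega) (fun e he ↦ h e (le_add_self.trans he)) (by omega)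

/-- The tail exponents of the grevlex-smallest monomial of degree `n (d - 1)` outside `I`. -/
theorem card_mul_le_sum_of_grevlex_minimal (hd : 0 < d) (hhom : ∀ i, (g i).IsHomogeneous d)
    (hreg : RingTheory.Sequence.IsWeaklyRegular (MvPolynomial (Fin n) R) (List.ofFn g))
    {M : Fin n →₀ ℕ} (hMdeg : ∑ i, M i = n * (d - 1))
    (hMI : monomial M (1 : R) ∉ Ideal.span (Set.range g))
    (hMmin : ∀ c : Fin n →₀ ℕ, (∑ i, c i) = n * (d - 1) →
      monomial c (1 : R) ∉ Ideal.span (Set.range g) → ¬ GrevlexLT c M) (b : ℕ) :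
    (Finset.univ.filter fun j : Fin n ↦ b ≤ (j : ℕ)).card * (d - 1) ≤
      ∑ j ∈ Finset.univ.filter fun j : Fin n ↦ b ≤ (j : ℕ), M j := by
  classical
  by_contra! hlt
  set s := Finset.univ.filter fun j : Fin n ↦ b ≤ (j : ℕ) with hs
  set m : Fin n →₀ ℕ := M.filter fun j ↦ b ≤ (j : ℕ) with hm
  have hmdeg : m.degree = ∑ j ∈ s, M j := by
    rw [Finsupp.degree_eq_sum, hs, Finset.sum_filter]
    exact Finset.sum_congr rfl fun j _ ↦ Finsupp.filter_apply _ _ _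
  have hcard : s.card * (d - 1) ≤ n * (d - 1) :=
    Nat.mul_le_mul_right _ (s.card_le_univ.trans_eq (Fintype.card_fin n))
  have hmI : monomial m (1 : R) ∈ Ideal.span (Set.range g) := by
    refine mem_span_range_of_X_mul_mem hd hhom hreg s
      (monomial_mem_degreeLT (by omega) 1) fun i hi ↦ ?_
    rw [X, monomial_mul, one_mul]
    refine monomial_mem_of_forall_le hd hhom hreg
      (by rw [map_add, Finsupp.degree_single]; omega) fun e he hedeg ↦ ?_
    rw [Finsupp.degree_eq_sum] at hedeg
    by_contra heI
    refine hMmin e hedeg heI (Or.inr ⟨hedeg.trans hMdeg.symm, ?_⟩)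
    have hib : b ≤ (i : ℕ) := (Finset.mem_filter.1 hi).2
    have hle (l : Fin n) (hl : b ≤ (l : ℕ)) : Finsupp.single i 1 l + M l ≤ e l := by
      have := he l
      rwa [Finsupp.add_apply, hm, Finsupp.filter_apply_pos (fun j : Fin n ↦ b ≤ (j : ℕ)) M hl]
        at this
    have hne : (s.filter fun l ↦ M l < e l).Nonempty := by
      refine ⟨i, Finset.mem_filter.2 ⟨hi, ?_⟩⟩
      have := hle i hib
      rw [Finsupp.single_eq_same] at this
      omega
    have hmax := Finset.mem_filter.1 (Finset.max'_mem _ hne)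
    refine ⟨_, hmax.2, fun l hl ↦ ?_⟩
    have hbl : b ≤ (l : ℕ) := (Finset.mem_filter.1 hmax.1).2.trans (Fin.lt_def.1 hl).le
    refine le_antisymm (not_lt.1 fun hlt' ↦ ?_) (le_add_self.trans (hle l hbl))
    exact absurd (Finset.le_max' _ l (Finset.mem_filter.2
      ⟨Finset.mem_filter.2 ⟨Finset.mem_univ _, hbl⟩, hlt'⟩)) (not_le.2 hl)
  refine hMI ?_
  have hsplit : M.filter (fun j : Fin n ↦ ¬ b ≤ (j : ℕ)) + m = M := by
    rw [add_comm, hm, Finsupp.filter_add_filter_not]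
  rw [← hsplit, ← one_mul (1 : R), ← monomial_mul]
  exact Ideal.mul_mem_left _ _ hmI

end Monomials

end MvPolynomial

/-- Let `I = (g_1,…,g_n)` be a balanced complete intersection of type `(d)^n`, let
`w_1 ≤ … ≤ w_n` be integers, not all zero, summing to `0`, with `w_a < w_{a+1} = … = w_n`,
and suppose every monomial of degree `n(d-1)` of positive `w`-weight lies in `I`.
If `M = x^{d_1}⋯x^{d_n}` is the grevlex-smallest monomial of degree `n(d-1)` not in `I`,
then `w_1d_1 + … + w_nd_n = 0` and `d_1 + … + d_a = a(d-1)`. -/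
theorem stmt3 {k : Type*} [Field k] [CharZero k] {n d : ℕ} (hd : 2 ≤ d)
    (g : Fin n → MvPolynomial (Fin n) k)
    (hhom : ∀ i, (g i).IsHomogeneous d)
    (hreg : RingTheory.Sequence.IsRegular (MvPolynomial (Fin n) k) (List.ofFn g))
    (w : Fin n → ℤ) (hw0 : w ≠ 0) (hwsum : ∑ i, w i = 0) (hwmono : Monotone w)
    (a : ℕ) (ha1 : 1 ≤ a) (ha2 : a ≤ n - 1)
    (hlt : ∀ i j : Fin n, (i : ℕ) < a → a ≤ (j : ℕ) → w i < w j)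
    (heq : ∀ i j : Fin n, a ≤ (i : ℕ) → a ≤ (j : ℕ) → w i = w j)
    (hlimit : ∀ c : Fin n →₀ ℕ, (∑ i, c i) = n * (d - 1) →
      0 < (∑ i, w i * (c i : ℤ)) → monomial c (1 : k) ∈ Ideal.span (Set.range g))
    (M : Fin n →₀ ℕ) (hMdeg : (∑ i, M i) = n * (d - 1))
    (hMI : monomial M (1 : k) ∉ Ideal.span (Set.range g))
    (hMmin : ∀ c : Fin n →₀ ℕ, (∑ i, c i) = n * (d - 1) →
      monomial c (1 : k) ∉ Ideal.span (Set.range g) → ¬ GrevlexLT c M) :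
    (∑ i, w i * (M i : ℤ)) = 0 ∧
      (∑ j ∈ Finset.univ.filter fun j : Fin n => (j : ℕ) < a, M j) = a * (d - 1) := by
  have hd0 : 0 < d := by omega
  set e : Fin n → ℤ := fun j ↦ (M j : ℤ) - (d - 1 : ℕ) with he
  have htail (b : ℕ) : 0 ≤ ∑ j ∈ Finset.univ.filter fun j : Fin n ↦ b ≤ (j : ℕ), e j := by
    have h := card_mul_le_sum_of_grevlex_minimal hd0 hhom hreg.toIsWeaklyRegular hMdeg hMI hMmin b
    zify at h
    simpa [he, Finset.sum_sub_distrib] using h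
  have htotal : ∑ j, e j = 0 := by
    have h := congrArg (Nat.cast : ℕ → ℤ) hMdeg
    push_cast at h
    simp [he, Finset.sum_sub_distrib, h]
  have hwe : ∑ i, w i * e i = ∑ i, w i * (M i : ℤ) := by
    simp [he, mul_sub, Finset.sum_sub_distrib, ← Finset.sum_mul, hwsum]
  have hwM : ∑ i, w i * (M i : ℤ) ≤ 0 := not_lt.1 fun h ↦ hMI (hlimit M hMdeg h)
  have hw' : Monotone fun i : Fin n ↦ w i - if a ≤ (i : ℕ) then 1 else 0 := by
    intro i j hij
    have h1 := hwmono hij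
    have h2 : (i : ℕ) ≤ j := hij
    have h3 := hlt i j
    dsimp only
    split_ifs <;> omega
  have hpair := sum_mul_nonneg_of_monotone hw' htail htotal
  simp only [sub_mul, Finset.sum_sub_distrib, ite_mul, one_mul, zero_mul,
    ← Finset.sum_filter, hwe] at hpair
  have ha := htail a
  refine ⟨by omega, ?_⟩
  have hsplit := Finset.sum_filter_add_sum_filter_not Finset.univ
    (fun j : Fin n ↦ a ≤ (j : ℕ)) e
  simp only [not_le, htotal] at hsplit
  have hhead : ∑ j ∈ Finset.univ.filter fun j : Fin n ↦ (j : ℕ) < a, e j = 0 := by omega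
  have hcard : (Finset.univ.filter fun j : Fin n ↦ (j : ℕ) < a).card = a := by
    rw [Fin.card_filter_val_lt]
    omega
  simp only [he, Finset.sum_sub_distrib, Finset.sum_const, hcard, nsmul_eq_mul] at hhead
  exact_mod_cast sub_eq_zero.1 hhead
end
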